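/- Let E be a compact topological 2-manifold with boundary such that every connected component of E has nonempty boundary, let L be a topological space homeomorphic to a finite disjoint union of circles S^1, and let φ : ∂E → L be a continuous map whose restriction to each connected component of ∂E is a covering map onto a connected component of L. Then the adjunction space X = L ∪_φ E (the quotient of the disjoint union L ⊔ E by the relation identifying each boundary point x ∈ ∂E with φ(x) ∈ L) admits a topological embedding into the 4-dimensional Euclidean space ℝ⁴. -/

import Mathlib

open scoped Manifold

namespace MultibranchedSurface

open Set Topology Metric

theorem exists_glue {X Y : Type*} [TopologicalSpace X] [TopologicalSpace Y] {s t : Set X}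
    {f g : X → Y} (hs : IsClosed s) (ht : IsClosed t) (hf : ContinuousOn f s)
    (hg : ContinuousOn g t) (hfi : InjOn f s) (hgi : InjOn g t)
    (hagree : ∀ x ∈ s, x ∈ t → f x = g x)
    (hcross : ∀ x ∈ s, ∀ y ∈ t, f x = g y → x = y) :
    ∃ F : X → Y, ContinuousOn F (s ∪ t) ∧ InjOn F (s ∪ t) ∧ EqOn F f s ∧ EqOn F g t := by
  classical
  have h1 : EqOn (s.piecewise f g) f s := fun x hx => piecewise_eq_of_mem _ _ _ hx
  have h2 : EqOn (s.piecewise f g) g t := fun x hx => by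
    by_cases hxs : x ∈ s
    · rw [piecewise_eq_of_mem _ _ _ hxs, hagree x hxs hx]
    · rw [piecewise_eq_of_notMem _ _ _ hxs]
  refine ⟨s.piecewise f g, ?_, ?_, h1, h2⟩
  · exact (hf.congr h1).union_of_isClosed (hg.congr h2) hs ht
  · rintro x (hx | hx) y (hy | hy) hxy
    · rw [h1 hx, h1 hy] at hxy; exact hfi hx hy hxy
    · rw [h1 hx, h2 hy] at hxy; exact hcross x hx y hy hxy
    · rw [h2 hx, h1 hy] at hxy; exact (hcross y hy x hx hxy.symm).symm
    · rw [h2 hx, h2 hy] at hxy; exact hgi hx hy hxy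

theorem exists_factor_of_isCompact {P X Y : Type*} [TopologicalSpace P] [TopologicalSpace X]
    [TopologicalSpace Y] [T2Space X] [Nonempty Y] {K : Set P} (hK : IsCompact K)
    {ρ : P → X} (hρ : ContinuousOn ρ K) {g : P → Y} (hg : ContinuousOn g K)
    (hinj : ∀ z ∈ K, ∀ z' ∈ K, ρ z = ρ z' → g z = g z') :
    ∃ F : X → Y, ContinuousOn F (ρ '' K) ∧ ∀ z ∈ K, F (ρ z) = g z := by
  classical
  have : CompactSpace K := isCompact_iff_compactSpace.1 hK
  let ρ' : K → ρ '' K := fun z => ⟨ρ z, mem_image_of_mem _ z.2⟩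
  have hρ'c : Continuous ρ' := by
    exact (continuousOn_iff_continuous_domRestrict.1 hρ).subtype_mk _
  have hρ's : Function.Surjective ρ' := by
    rintro ⟨_, z, hz, rfl⟩
    exact ⟨⟨z, hz⟩, rfl⟩
  have hq : IsQuotientMap ρ' := hρ'c.isClosedMap.isQuotientMap hρ'c hρ's
  let F : X → Y := fun x => if hx : x ∈ ρ '' K then g hx.choose else Classical.arbitrary Y
  have hF : ∀ z ∈ K, F (ρ z) = g z := by
    intro z hz
    have hx : ρ z ∈ ρ '' K := mem_image_of_mem _ hz
    simp only [F, dif_pos hx]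
    exact hinj _ hx.choose_spec.1 _ hz hx.choose_spec.2
  refine ⟨F, ?_, hF⟩
  rw [continuousOn_iff_continuous_domRestrict, hq.continuous_iff]
  have : (ρ '' K).domRestrict F ∘ ρ' = K.domRestrict g := by
    funext z
    exact hF z z.2
  rw [this]
  exact continuousOn_iff_continuous_domRestrict.1 hg

open Classical in
/-- The self-map of `V` given by `h` on the image of `ψ` and by the identity elsewhere. -/
noncomputable def extendMap {P V : Type*} (ψ : P → V) (h : P → P) (x : V) : V :=
  if hx : x ∈ range ψ then ψ (h hx.choose) else x

section extendMap
variable {P V : Type*} {ψ : P → V} {h : P → P}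

theorem extendMap_apply (hψ : Function.Injective ψ) (z : P) :
    extendMap ψ h (ψ z) = ψ (h z) := by
  have hx : ψ z ∈ range ψ := mem_range_self z
  rw [extendMap, dif_pos hx, hψ hx.choose_spec]

theorem extendMap_of_notMem_image (hψ : Function.Injective ψ) {S : Set P} (hS : ∀ z ∉ S, h z = z)
    {x : V} (hx : x ∉ ψ '' S) : extendMap ψ h x = x := by
  by_cases hx' : x ∈ range ψ
  · obtain ⟨z, rfl⟩ := hx'
    rw [extendMap_apply hψ, hS z fun hz => hx (mem_image_of_mem _ hz)]
  · rw [extendMap, dif_neg hx']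

theorem extendMap_injective (hψ : Function.Injective ψ) (hh : Function.Injective h) :
    Function.Injective (extendMap ψ h) := by
  intro x y hxy
  by_cases hx : x ∈ range ψ <;> by_cases hy : y ∈ range ψ
  · obtain ⟨z, rfl⟩ := hx
    obtain ⟨w, rfl⟩ := hy
    rw [extendMap_apply hψ, extendMap_apply hψ] at hxy
    rw [hh (hψ hxy)]
  · obtain ⟨z, rfl⟩ := hx
    rw [extendMap_apply hψ, extendMap, dif_neg hy] at hxy
    exact absurd ⟨_, hxy⟩ hy
  · obtain ⟨z, rfl⟩ := hy
    rw [extendMap_apply hψ, extendMap, dif_neg hx] at hxy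
    exact absurd ⟨_, hxy.symm⟩ hx
  · rwa [extendMap, extendMap, dif_neg hx, dif_neg hy] at hxy

theorem extendMap_continuous [TopologicalSpace P] [TopologicalSpace V] (hψ : IsOpenEmbedding ψ)
    (hc : Continuous h) {S : Set P} (hS : ∀ z ∉ S, h z = z) (hcl : IsClosed (ψ '' S)) :
    Continuous (extendMap ψ h) := by
  rw [continuous_iff_continuousAt]
  intro x
  by_cases hx : x ∈ range ψ
  · obtain ⟨z, rfl⟩ := hx
    rw [← hψ.continuousAt_iff]
    have : extendMap ψ h ∘ ψ = ψ ∘ h := funext fun z => extendMap_apply hψ.injective z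
    rw [this]
    exact (hψ.continuous.comp hc).continuousAt
  · have hx' : x ∈ (ψ '' S)ᶜ := fun h' => hx (image_subset_range _ _ h')
    have : extendMap ψ h =ᶠ[𝓝 x] id := by
      filter_upwards [hcl.isOpen_compl.mem_nhds hx'] with y hy
      exact extendMap_of_notMem_image hψ.injective hS hy
    exact continuousAt_id.congr this.symm

/-- A homeomorphism of `P` that is the identity off a set with closed image in `V` extends by the
identity to a homeomorphism of `V`. -/
noncomputable def extendHomeomorph [TopologicalSpace P] [TopologicalSpace V]
    (hψ : IsOpenEmbedding ψ) (g : P ≃ₜ P) {S : Set P} (hS : ∀ z ∉ S, g z = z)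
    (hcl : IsClosed (ψ '' S)) : V ≃ₜ V where
  toFun := extendMap ψ g
  invFun := extendMap ψ g.symm
  left_inv x := by
    by_cases hx : x ∈ range ψ
    · obtain ⟨z, rfl⟩ := hx
      rw [extendMap_apply hψ.injective, extendMap_apply hψ.injective, g.symm_apply_apply]
    · simp [extendMap, hx]
  right_inv x := by
    by_cases hx : x ∈ range ψ
    · obtain ⟨z, rfl⟩ := hx
      rw [extendMap_apply hψ.injective, extendMap_apply hψ.injective, g.apply_symm_apply]
    · simp [extendMap, hx]
  continuous_toFun := extendMap_continuous hψ g.continuous hS hcl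
  continuous_invFun := extendMap_continuous hψ g.symm.continuous
    (fun z hz => g.symm_apply_eq.2 (hS z hz).symm) hcl

theorem extendHomeomorph_apply [TopologicalSpace P] [TopologicalSpace V]
    (hψ : IsOpenEmbedding ψ) (g : P ≃ₜ P) {S : Set P} (hS : ∀ z ∉ S, g z = z)
    (hcl : IsClosed (ψ '' S)) (z : P) : extendHomeomorph hψ g hS hcl (ψ z) = ψ (g z) :=
  extendMap_apply hψ.injective z

theorem extendHomeomorph_of_notMem [TopologicalSpace P] [TopologicalSpace V]
    (hψ : IsOpenEmbedding ψ) (g : P ≃ₜ P) {S : Set P} (hS : ∀ z ∉ S, g z = z)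
    (hcl : IsClosed (ψ '' S)) {x : V} (hx : x ∉ ψ '' S) : extendHomeomorph hψ g hS hcl x = x :=
  extendMap_of_notMem_image hψ.injective hS hx

end extendMap

theorem const_of_exp_eq {X : Type*} [TopologicalSpace X] [PreconnectedSpace X] {f : X → ℂ}
    (hf : Continuous f) (h : ∀ x y, Complex.exp (f x) = Complex.exp (f y)) (x y : X) :
    f x = f y := by
  refine Complex.isCoveringMap_exp.const_of_comp hf ?_ x y
  intro a b
  exact Subtype.ext (h a b)

/-- A round circle about the origin is not null-homotopic in the punctured plane. -/
theorem not_nullhomotopic_circle {K : ℝ × ℝ → ℂ} (hK : Continuous K) (h0 : ∀ p, K p ≠ 0)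
    (hper : ∀ s θ, K (s, θ + 2 * Real.pi) = K (s, θ)) (hc : ∀ θ, K (0, θ) = K (0, 0)) {r : ℂ}
    (hr : ∀ θ : ℝ, K (1, θ) = r * Complex.exp (θ * Complex.I)) : False := by
  let K' : C(ℝ × ℝ, {z : ℂ // z ≠ 0}) := ⟨fun p => ⟨K p, h0 p⟩, hK.subtype_mk _⟩
  obtain ⟨G, ⟨-, hG⟩, -⟩ := Complex.isCoveringMap_exp.existsUnique_continuousMap_lifts K' (0, 0)
    (Complex.log (K (0, 0))) (Subtype.ext (Complex.exp_log (h0 _)))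
  have hG' : ∀ p, Complex.exp (G p) = K p := fun p => congrArg Subtype.val (congrFun hG p)
  have hD : ∀ p q : ℝ × ℝ, G (p.1, p.2 + 2 * Real.pi) - G p = G (q.1, q.2 + 2 * Real.pi) - G q := by
    refine const_of_exp_eq (by fun_prop) fun p q => ?_
    rw [Complex.exp_sub, Complex.exp_sub, hG', hG', hG', hG', hper, hper, div_self (h0 _),
      div_self (h0 _)]
  have h1 : G (0, 2 * Real.pi) = G (0, 0) :=
    const_of_exp_eq (f := fun θ : ℝ => G (0, θ)) (by fun_prop)
      (fun x y => by rw [hG', hG', hc x, hc y]) _ _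
  have h2 : G (1, 2 * Real.pi) - ((2 * Real.pi : ℝ) : ℂ) * Complex.I
      = G (1, 0) - ((0 : ℝ) : ℂ) * Complex.I :=
    const_of_exp_eq (f := fun θ : ℝ => G (1, θ) - (θ : ℂ) * Complex.I) (by fun_prop)
      (fun x y => by
        rw [Complex.exp_sub, Complex.exp_sub, hG', hG', hr, hr,
          mul_div_cancel_right₀ _ (Complex.exp_ne_zero _),
          mul_div_cancel_right₀ _ (Complex.exp_ne_zero _)]) _ _
  have h3 := hD (0, 0) (1, 0)
  simp only [zero_add, h1, sub_self] at h3
  rw [eq_comm, sub_eq_zero] at h3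
  rw [h3] at h2
  simp [Real.pi_ne_zero] at h2

/-- A half disc at a boundary point cannot be locally inverse to a full disc. -/
theorem not_halfDisc_inverse {S T : ℂ → ℂ} {a b : ℂ} {ε r : ℝ} (hε : 0 < ε) (hr : 0 < r)
    (hb : b.im = 0) (hS : ContinuousOn S ({z | 0 ≤ z.im} ∩ ball b ε))
    (hT : ContinuousOn T (ball a r)) (hTm : ∀ z ∈ ball a r, T z ∈ {z : ℂ | 0 ≤ z.im} ∩ ball b ε)
    (hTb : ∀ z ∈ ball a r, T z = b → z = a) (hST : ∀ z ∈ ball a r, S (T z) = z)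
    (hSa : ∀ z ∈ {z : ℂ | 0 ≤ z.im} ∩ ball b ε, S z = a → z = b) : False := by
  let c : ℂ := b + ((ε / 2 : ℝ) : ℂ) * Complex.I
  have hc : c ∈ {z : ℂ | 0 ≤ z.im} ∩ ball b ε := by
    constructor
    · simp [c, hb]; linarith
    · rw [mem_ball, dist_eq_norm]
      simp only [c, add_sub_cancel_left, norm_mul, Complex.norm_I, Complex.norm_real, mul_one]
      rw [Real.norm_of_nonneg (by linarith)]
      linarith
  have hcim : 0 < c.im := by simp [c, hb, hε]
  have hconv : Convex ℝ ({z : ℂ | 0 ≤ z.im} ∩ ball b ε) :=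
    (convex_halfSpace_im_ge 0).inter (convex_ball _ _)
  let l : ℝ → ℂ := fun θ => a + ((r / 2 : ℝ) : ℂ) * Complex.exp (θ * Complex.I)
  have hl : ∀ θ, l θ ∈ ball a r := fun θ => by
    rw [mem_ball, dist_eq_norm]
    simp only [l, add_sub_cancel_left, norm_mul, Complex.norm_exp_ofReal_mul_I, Complex.norm_real,
      mul_one]
    rw [Real.norm_of_nonneg (by linarith)]
    linarith
  have hla : ∀ θ, l θ ≠ a := fun θ h => by
    have : ((r / 2 : ℝ) : ℂ) * Complex.exp (θ * Complex.I) = 0 := by simpa [l] using h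
    simp [hr.ne', Complex.exp_ne_zero] at this
  have hlc : Continuous l := by fun_prop
  let u : ℝ → ℝ := fun s => max 0 (min 1 s)
  have hu0 : ∀ s, 0 ≤ u s := fun s => le_max_left _ _
  have hu1 : ∀ s, u s ≤ 1 := fun s => max_le zero_le_one (min_le_left _ _)
  have huc : Continuous u := by fun_prop
  let k : ℝ × ℝ → ℂ := fun p => (1 - u p.1) • c + u p.1 • T (l p.2)
  have hkm : ∀ p, k p ∈ {z : ℂ | 0 ≤ z.im} ∩ ball b ε := fun p =>
    hconv hc (hTm _ (hl p.2)) (by linarith [hu1 p.1]) (hu0 _) (by ring)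
  have hTl : Continuous fun p : ℝ × ℝ => T (l p.2) :=
    hT.comp_continuous (hlc.comp continuous_snd) fun p => hl _
  have hkc : Continuous k := ((continuous_const.sub (huc.comp continuous_fst)).smul
    continuous_const).add ((huc.comp continuous_fst).smul hTl)
  have hkb : ∀ p, k p ≠ b := by
    intro p hp
    have him : (k p).im = 0 := by rw [hp, hb]
    have h1 : 0 ≤ (T (l p.2)).im := (hTm _ (hl p.2)).1
    have h2 : (k p).im = (1 - u p.1) * c.im + u p.1 * (T (l p.2)).im := by
      simp [k]
    have h3 : u p.1 = 1 := by
      by_contra h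
      have : u p.1 < 1 := lt_of_le_of_ne (hu1 _) h
      nlinarith [mul_nonneg (hu0 p.1) h1, mul_pos (sub_pos.2 this) hcim]
    have : T (l p.2) = b := by simpa [k, h3] using hp
    exact hla _ (hTb _ (hl _) this)
  refine not_nullhomotopic_circle (K := fun p => S (k p) - a) (r := ((r / 2 : ℝ) : ℂ))
    ((hS.comp_continuous hkc hkm).sub continuous_const) ?_ ?_ ?_ ?_
  · intro p h
    exact hkb p (hSa _ (hkm p) (sub_eq_zero.1 h))
  · intro s θ
    have : l (θ + 2 * Real.pi) = l θ := by
      simp only [l]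
      push_cast
      rw [add_mul, Complex.exp_add, Complex.exp_two_pi_mul_I, mul_one]
    simp only [k, this]
  · intro θ
    simp [k, u]
  · intro θ
    have : k (1, θ) = T (l θ) := by simp [k, u]
    simp only [this, hST _ (hl θ)]
    simp [l]

/-- The half-plane as a subset of `ℂ`, the boundary becoming the real axis. -/
noncomputable def halfToComplex (y : EuclideanHalfSpace 2) : ℂ := ⟨y.1 1, y.1 0⟩

/-- The retraction of `ℂ` to the half-plane. -/
noncomputable def complexToHalf (z : ℂ) : EuclideanHalfSpace 2 :=
  ⟨!₂[max z.im 0, z.re], by simp⟩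

theorem continuous_halfToComplex : Continuous halfToComplex := by
  have h : halfToComplex = fun y => ((y.1 1 : ℝ) : ℂ) + ((y.1 0 : ℝ) : ℂ) * Complex.I := by
    funext y; apply Complex.ext <;> simp [halfToComplex]
  rw [h]
  have h1 : Continuous fun y : EuclideanHalfSpace 2 => y.1 := continuous_subtype_val
  fun_prop

theorem continuous_complexToHalf : Continuous complexToHalf := by
  refine Continuous.subtype_mk ?_ _
  refine (PiLp.continuous_toLp 2 _).comp ?_
  refine continuous_pi fun i => ?_
  fin_cases i
  · exact Complex.continuous_im.max continuous_const
  · exact Complex.continuous_re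

@[simp] theorem halfToComplex_im (y : EuclideanHalfSpace 2) : (halfToComplex y).im = y.1 0 := rfl

theorem complexToHalf_halfToComplex (y : EuclideanHalfSpace 2) :
    complexToHalf (halfToComplex y) = y := by
  apply Subtype.ext
  ext i
  fin_cases i
  · exact max_eq_left y.2
  · rfl

theorem halfToComplex_complexToHalf {z : ℂ} (hz : 0 ≤ z.im) :
    halfToComplex (complexToHalf z) = z := by
  apply Complex.ext
  · rfl
  · exact max_eq_left hz

theorem halfToComplex_injective : Function.Injective halfToComplex :=
  Function.LeftInverse.injective complexToHalf_halfToComplex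

section Charts
variable {E : Type*} [TopologicalSpace E]

/-- Topological invariance of the boundary in dimension two. -/
theorem chart_boundary_invariance (e e' : OpenPartialHomeomorph E (EuclideanHalfSpace 2)) {x : E}
    (hx : x ∈ e.source) (hx' : x ∈ e'.source) (h0 : (e x).1 0 = 0) : (e' x).1 0 = 0 := by
  by_contra h0'
  have hpos : 0 < (halfToComplex (e' x)).im := lt_of_le_of_ne (e' x).2 (Ne.symm h0')
  have hWo : IsOpen (complexToHalf ⁻¹' (e.target ∩ e.symm ⁻¹' e'.source)) :=
    (e.isOpen_inter_preimage_symm e'.open_source).preimage continuous_complexToHalf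
  obtain ⟨ε, hε, hεW⟩ := Metric.isOpen_iff.1 hWo (halfToComplex (e x)) (by
    simp [complexToHalf_halfToComplex, hx, hx'])
  let T : ℂ → ℂ := fun z => halfToComplex (e (e'.symm (complexToHalf z)))
  let S : ℂ → ℂ := fun z => halfToComplex (e' (e.symm (complexToHalf z)))
  have hWo' : IsOpen (complexToHalf ⁻¹' (e'.target ∩ e'.symm ⁻¹' e.source)) :=
    (e'.isOpen_inter_preimage_symm e.open_source).preimage continuous_complexToHalf
  have hTc : ContinuousOn T (complexToHalf ⁻¹' (e'.target ∩ e'.symm ⁻¹' e.source)) := by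
    refine continuous_halfToComplex.comp_continuousOn (e.continuousOn.comp
      (e'.continuousOn_symm.comp continuous_complexToHalf.continuousOn fun z hz => hz.1)
      fun z hz => hz.2)
  have hSc : ContinuousOn S (complexToHalf ⁻¹' (e.target ∩ e.symm ⁻¹' e'.source)) := by
    refine continuous_halfToComplex.comp_continuousOn (e'.continuousOn.comp
      (e.continuousOn_symm.comp continuous_complexToHalf.continuousOn fun z hz => hz.1)
      fun z hz => hz.2)
  have hTo : IsOpen ((complexToHalf ⁻¹' (e'.target ∩ e'.symm ⁻¹' e.source)) ∩
      T ⁻¹' ball (halfToComplex (e x)) ε) := hTc.isOpen_inter_preimage hWo' isOpen_ball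
  obtain ⟨r, hr, hrW⟩ := Metric.isOpen_iff.1
    (hTo.inter (isOpen_lt continuous_const Complex.continuous_im)) (halfToComplex (e' x)) (by
      refine ⟨⟨?_, ?_⟩, hpos⟩
      · simp [complexToHalf_halfToComplex, hx, hx']
      · simp [T, complexToHalf_halfToComplex, hx', hε])
  refine not_halfDisc_inverse (S := S) (T := T) hε hr h0 (hSc.mono fun z hz => hεW hz.2)
    (hTc.mono fun z hz => (hrW hz).1.1) (fun z hz => ⟨(e _).2, (hrW hz).1.2⟩) ?_ ?_ ?_
  · intro z hz h
    have hz' := hrW hz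
    have h1 : e'.symm (complexToHalf z) = x :=
      e.injOn hz'.1.1.2 hx (halfToComplex_injective h)
    rw [← h1, e'.right_inv hz'.1.1.1, halfToComplex_complexToHalf (le_of_lt hz'.2)]
  · intro z hz
    have hz' := hrW hz
    simp only [S, T]
    rw [complexToHalf_halfToComplex, e.left_inv hz'.1.1.2, e'.right_inv hz'.1.1.1,
      halfToComplex_complexToHalf (le_of_lt hz'.2)]
  · intro z hz h
    have hz' := hεW hz.2
    have h1 : e.symm (complexToHalf z) = x :=
      e'.injOn hz'.2 hx' (halfToComplex_injective h)
    rw [← h1, e.right_inv hz'.1, halfToComplex_complexToHalf hz.1]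

theorem mem_boundary_iff_chart [ChartedSpace (EuclideanHalfSpace 2) E]
    (e : OpenPartialHomeomorph E (EuclideanHalfSpace 2)) {x : E} (hx : x ∈ e.source) :
    x ∈ (𝓡∂ 2).boundary E ↔ (e x).1 0 = 0 := by
  have h1 : x ∈ (𝓡∂ 2).boundary E ↔
      (chartAt (EuclideanHalfSpace 2) x x).1 0 = 0 := by
    change (𝓡∂ 2).IsBoundaryPoint x ↔ _
    rw [ModelWithCorners.IsBoundaryPoint, frontier_range_modelWithCornersEuclideanHalfSpace]
    rw [mem_ofPred_eq, eq_comm]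
    rfl
  rw [h1]
  exact ⟨chart_boundary_invariance _ _ (mem_chart_source _ x) hx,
    chart_boundary_invariance _ _ hx (mem_chart_source _ x)⟩

end Charts

section

/-- A homeomorphism of the plane supported in the closed unit disc that moves `0` to `w`. -/
theorem exists_homeomorph_map_zero {w : ℂ} (hw : ‖w‖ < 1) :
    ∃ g : ℂ ≃ₜ ℂ, g 0 = w ∧ ∀ z ∉ closedBall (0 : ℂ) 1, g z = z := by
  let f : ℂ → ℂ := fun z => z + ((max 0 (1 - ‖z‖) : ℝ) : ℂ) * w
  have hf : ApproximatesLinearOn f ((ContinuousLinearEquiv.refl ℝ ℂ : ℂ ≃L[ℝ] ℂ) : ℂ →L[ℝ] ℂ)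
      univ ‖w‖₊ := by
    intro x _ y _
    have : f x - f y - ((ContinuousLinearEquiv.refl ℝ ℂ : ℂ ≃L[ℝ] ℂ) : ℂ →L[ℝ] ℂ) (x - y)
        = ((max 0 (1 - ‖x‖) - max 0 (1 - ‖y‖) : ℝ) : ℂ) * w := by
      simp only [f, ContinuousLinearEquiv.coe_coe, ContinuousLinearEquiv.refl_apply]
      push_cast
      ring
    rw [this, norm_mul, Complex.norm_real, mul_comm]
    refine mul_le_mul_of_nonneg_left ?_ (norm_nonneg _)
    rw [Real.norm_eq_abs]
    rw [max_comm 0 (1 - ‖x‖), max_comm 0 (1 - ‖y‖)]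
    refine (abs_max_sub_max_le_abs (1 - ‖x‖) (1 - ‖y‖) 0).trans ?_
    have := abs_norm_sub_norm_le x y
    rw [abs_sub_comm] at this
    calc |1 - ‖x‖ - (1 - ‖y‖)| = |‖y‖ - ‖x‖| := by ring_nf
      _ ≤ _ := this
  have hc : ‖w‖₊ <
      ‖((ContinuousLinearEquiv.refl ℝ ℂ : ℂ ≃L[ℝ] ℂ).symm : ℂ →L[ℝ] ℂ)‖₊⁻¹ := by
    have : ‖((ContinuousLinearEquiv.refl ℝ ℂ : ℂ ≃L[ℝ] ℂ).symm : ℂ →L[ℝ] ℂ)‖₊ = 1 := by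
      rw [ContinuousLinearEquiv.refl_symm]
      exact NNReal.eq ContinuousLinearMap.norm_id
    rw [this, inv_one]
    exact_mod_cast hw
  refine ⟨hf.toHomeomorph f (Or.inr hc), ?_, ?_⟩
  · change f 0 = w
    simp [f]
  · intro z hz
    change f z = z
    have : 1 < ‖z‖ := by simpa using hz
    simp only [f]
    rw [max_eq_left (by linarith)]
    simp

/-- The radial homeomorphism of the plane induced by a homeomorphism of the line. -/
theorem exists_radial_homeomorph (l : ℝ ≃ₜ ℝ) (hl : StrictMono l) (h0 : l 0 = 0) :
    ∃ g : ℂ ≃ₜ ℂ, (∀ z, g z = ((l ‖z‖ / ‖z‖ : ℝ) : ℂ) * z) ∧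
      ∀ z, ‖g.symm z‖ = l.symm ‖z‖ := by
  have key : ∀ l : ℝ ≃ₜ ℝ, StrictMono l → l 0 = 0 →
      (∀ z : ℂ, ‖((l ‖z‖ / ‖z‖ : ℝ) : ℂ) * z‖ = l ‖z‖) ∧
      Continuous fun z : ℂ => ((l ‖z‖ / ‖z‖ : ℝ) : ℂ) * z := by
    intro l hl h0
    have hn : ∀ z : ℂ, ‖((l ‖z‖ / ‖z‖ : ℝ) : ℂ) * z‖ = l ‖z‖ := by
      intro z
      have hpos : 0 ≤ l ‖z‖ := by rw [← h0]; exact hl.monotone (norm_nonneg _)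
      rw [norm_mul, Complex.norm_real, Real.norm_of_nonneg (div_nonneg hpos (norm_nonneg _))]
      by_cases hz : z = 0
      · simp [hz, h0]
      · exact div_mul_cancel₀ _ (norm_ne_zero_iff.2 hz)
    refine ⟨hn, continuous_iff_continuousAt.2 fun z => ?_⟩
    by_cases hz : z = 0
    · subst hz
      rw [ContinuousAt, mul_zero, tendsto_zero_iff_norm_tendsto_zero]
      simp only [hn]
      have : Continuous fun z : ℂ => l ‖z‖ := l.continuous.comp continuous_norm
      simpa [h0] using this.tendsto 0
    · have : ‖z‖ ≠ 0 := norm_ne_zero_iff.2 hz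
      have h1 : ContinuousAt (fun z : ℂ => l ‖z‖) z :=
        (l.continuous.comp continuous_norm).continuousAt
      have h2 : ContinuousAt (fun z : ℂ => (l ‖z‖ / ‖z‖ : ℝ)) z :=
        h1.div continuous_norm.continuousAt this
      exact (Complex.continuous_ofReal.continuousAt.comp h2).mul continuousAt_id
  have hls : StrictMono l.symm := fun a b hab => by
    by_contra hh
    have := hl.monotone (not_lt.1 hh)
    simp only [l.apply_symm_apply] at this
    linarith
  have hs0 : l.symm 0 = 0 := by rw [l.symm_apply_eq, h0]
  have hinv : ∀ l l' : ℝ ≃ₜ ℝ, StrictMono l → l 0 = 0 → (∀ x, l' (l x) = x) →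
      ∀ z : ℂ, ((l' ‖((l ‖z‖ / ‖z‖ : ℝ) : ℂ) * z‖ / ‖((l ‖z‖ / ‖z‖ : ℝ) : ℂ) * z‖ : ℝ) : ℂ) *
        (((l ‖z‖ / ‖z‖ : ℝ) : ℂ) * z) = z := by
    intro l l' hl h0 hll z
    rw [(key l hl h0).1 z, hll]
    by_cases hz : z = 0
    · simp [hz]
    · have h1 : (0 : ℝ) < ‖z‖ := norm_pos_iff.2 hz
      have h2 : 0 < l ‖z‖ := by rw [← h0]; exact hl h1
      rw [← mul_assoc, ← Complex.ofReal_mul]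
      have : ‖z‖ / l ‖z‖ * (l ‖z‖ / ‖z‖) = 1 := by field_simp
      rw [this]; simp
  let g : ℂ ≃ₜ ℂ :=
    { toFun := fun z => ((l ‖z‖ / ‖z‖ : ℝ) : ℂ) * z
      invFun := fun z => ((l.symm ‖z‖ / ‖z‖ : ℝ) : ℂ) * z
      left_inv := hinv l l.symm hl h0 l.symm_apply_apply
      right_inv := hinv l.symm l hls hs0 l.apply_symm_apply
      continuous_toFun := (key l hl h0).2
      continuous_invFun := (key l.symm hls hs0).2 }
  exact ⟨g, fun z => rfl, (key l.symm hls hs0).1⟩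

/-- A compactly supported homeomorphism of the plane expanding a small disc over a big one. -/
theorem exists_homeomorph_expand {r R : ℝ} (hr : 0 < r) (hR : 0 < R) :
    ∃ g : ℂ ≃ₜ ℂ, (∀ z ∉ closedBall (0 : ℂ) (2 * R), g z = z) ∧
      ∀ z ∈ closedBall (0 : ℂ) R, g.symm z ∈ closedBall (0 : ℂ) r := by
  let f : ℝ → ℝ := fun s => max s (min (R / r * s) (R + s / 2))
  have hc : 0 < R / r := div_pos hR hr
  have hm : StrictMono f := by
    intro a b hab
    have h1 : R / r * a < R / r * b := mul_lt_mul_of_pos_left hab hc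
    exact max_lt_max hab (min_lt_min h1 (by linarith))
  have hf : Continuous f := by fun_prop
  have hs : Function.Surjective f := by
    refine hf.surjective ?_ ?_
    · exact Filter.tendsto_atTop_mono (fun s => le_max_left _ _) Filter.tendsto_id
    · refine Filter.tendsto_atBot.2 fun b => ?_
      filter_upwards [Filter.eventually_le_atBot b, Filter.eventually_le_atBot (2 * (b - R))]
        with s h1 h2
      exact max_le h1 ((min_le_right _ _).trans (by linarith))
  let l : ℝ ≃ₜ ℝ := (hm.orderIsoOfSurjective f hs).toHomeomorph
  have hl : ∀ s, l s = f s := fun s => rfl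
  obtain ⟨g, hg, hg'⟩ := exists_radial_homeomorph l hm (by simp [hl, f, hR.le])
  refine ⟨g, fun z hz => ?_, fun z hz => ?_⟩
  · have hz' : 2 * R < ‖z‖ := by simpa using hz
    have : l ‖z‖ = ‖z‖ := by
      rw [hl]
      exact max_eq_left ((min_le_right _ _).trans (by linarith))
    rw [hg, this, div_self (by linarith)]
    simp
  · rw [mem_closedBall_zero_iff] at hz ⊢
    rw [hg']
    have : f r ≥ R := by
      refine le_max_of_le_right (le_min ?_ (by linarith))
      rw [div_mul_cancel₀ _ hr.ne']
    have h2 : l (l.symm ‖z‖) ≤ l r := by rw [l.apply_symm_apply, hl]; linarith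
    exact hm.le_iff_le.1 h2

variable {V : Type*} [TopologicalSpace V]

/-- `K` lies in an open disc inside `U`. -/
def Engulfed (U K : Set V) : Prop :=
  ∃ δ : ℂ → V, IsOpenEmbedding δ ∧ range δ ⊆ U ∧ K ⊆ range δ

/-- Every point is the centre of an open disc. -/
def LocallyPlane (V : Type*) [TopologicalSpace V] : Prop :=
  ∀ x : V, ∃ ψ : ℂ → V, IsOpenEmbedding ψ ∧ ψ 0 = x

theorem LocallyPlane.exists_range_subset (hV : LocallyPlane V) {W : Set V} (hW : IsOpen W) {x : V}
    (hx : x ∈ W) : ∃ ψ : ℂ → V, IsOpenEmbedding ψ ∧ ψ 0 = x ∧ range ψ ⊆ W := by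
  obtain ⟨ψ, hψ, h0⟩ := hV x
  have : ψ ⁻¹' W ∈ 𝓝 (0 : ℂ) := (hW.preimage hψ.continuous).mem_nhds (by simpa [h0] using hx)
  obtain ⟨r, hr, hb⟩ := Metric.mem_nhds_iff.1 this
  have hr' : (r : ℂ) ≠ 0 := by exact_mod_cast hr.ne'
  let j : ℂ → ℂ := fun z => (r : ℂ) * (Homeomorph.unitBall z : ℂ)
  have hj : IsOpenEmbedding j :=
    (Homeomorph.mulLeft₀ (r : ℂ) hr').isOpenEmbedding.comp
      (Metric.isOpen_ball.isOpenEmbedding_subtypeVal.comp Homeomorph.unitBall.isOpenEmbedding)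
  refine ⟨ψ ∘ j, hψ.comp hj, ?_, ?_⟩
  · simp only [Function.comp, j]
    rw [Homeomorph.coe_unitBall_apply_zero, mul_zero, h0]
  · rintro _ ⟨z, rfl⟩
    apply hb
    have : ‖(Homeomorph.unitBall z : ℂ)‖ < 1 := mem_ball_zero_iff.1 (Homeomorph.unitBall z).2
    rw [mem_ball_zero_iff]
    simp only [j, norm_mul, Complex.norm_real, Real.norm_of_nonneg hr.le]
    nlinarith

theorem Engulfed.mono {U K K' : Set V} (h : Engulfed U K) (hK : K' ⊆ K) : Engulfed U K' := by
  obtain ⟨δ, h1, h2, h3⟩ := h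
  exact ⟨δ, h1, h2, hK.trans h3⟩

theorem image_subset_of_homeomorph_fix {U : Set V} (H : V ≃ₜ V) (hH : ∀ x ∉ U, H x = x) {x : V}
    (hx : x ∈ U) : H x ∈ U := by
  by_contra h
  have := hH _ h
  rw [H.injective this] at h
  exact h hx

theorem Engulfed.of_homeomorph {U K : Set V} (H : V ≃ₜ V) (hH : ∀ x ∉ U, H x = x)
    {δ : ℂ → V} (hδ : IsOpenEmbedding δ) (hU : range δ ⊆ U) (hK : ∀ x ∈ K, H x ∈ range δ) :
    Engulfed U K := by
  have hs : ∀ x ∉ U, H.symm x = x := fun x hx => by rw [H.symm_apply_eq, hH x hx]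
  refine ⟨H.symm ∘ δ, H.symm.isOpenEmbedding.comp hδ, ?_, ?_⟩
  · rintro _ ⟨z, rfl⟩
    exact image_subset_of_homeomorph_fix H.symm hs (hU (mem_range_self z))
  · intro x hx
    obtain ⟨z, hz⟩ := hK x hx
    exact ⟨z, by simp [hz]⟩

theorem Engulfed.insert [T2Space V] (hV : LocallyPlane V) {U K : Set V} (hUo : IsOpen U)
    (hUc : IsPreconnected U) (hK : IsClosed K) (h : Engulfed U K) {c : V} (hc : c ∈ U) :
    Engulfed U (insert c K) := by
  obtain ⟨δ, hδ, hδU, hδK⟩ := h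
  by_cases hcK : c ∈ K
  · rw [insert_eq_of_mem hcK]; exact ⟨δ, hδ, hδU, hδK⟩
  let O : Set V := {y | ∃ H : V ≃ₜ V, (∀ x, x ∈ K ∨ x ∉ U → H x = x) ∧ H c = y}
  by_cases hO : ∃ y ∈ O, y ∈ range δ
  · obtain ⟨_, ⟨H, hH, rfl⟩, hy⟩ := hO
    refine Engulfed.of_homeomorph H (fun x hx => hH x (Or.inr hx)) hδ hδU ?_
    rintro x (rfl | hx)
    · exact hy
    · rw [hH x (Or.inl hx)]; exact hδK hx
  exfalso
  push Not at hO
  have hUK : IsOpen (U \ K) := hUo.sdiff hK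
  have hloc : ∀ x ∈ U \ K, ∃ N ∈ 𝓝 x, N ⊆ U \ K ∧ ∀ y ∈ N, ∃ H : V ≃ₜ V,
      (∀ x, x ∈ K ∨ x ∉ U → H x = x) ∧ H x = y := by
    intro x hx
    obtain ⟨ψ, hψ, h0, hr⟩ := hV.exists_range_subset hUK hx
    refine ⟨ψ '' ball 0 1, ?_, (image_subset_range _ _).trans hr, ?_⟩
    · rw [← h0]
      exact hψ.isOpenMap.image_mem_nhds (ball_mem_nhds _ one_pos)
    · rintro _ ⟨w, hw, rfl⟩
      obtain ⟨g, hg0, hg⟩ := exists_homeomorph_map_zero (w := w) (by simpa using hw)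
      have hcl : IsClosed (ψ '' closedBall 0 1) :=
        ((isCompact_closedBall _ _).image hψ.continuous).isClosed
      refine ⟨extendHomeomorph hψ g hg hcl, ?_, ?_⟩
      · intro y hy
        refine extendHomeomorph_of_notMem hψ g hg hcl fun hy' => ?_
        have := hr (image_subset_range _ _ hy')
        exact hy.elim this.2 fun h => h this.1
      · rw [← h0, extendHomeomorph_apply, hg0]
  have hOUK : O ⊆ U \ K := by
    rintro _ ⟨H, hH, rfl⟩
    refine ⟨image_subset_of_homeomorph_fix H (fun x hx => hH x (Or.inr hx)) hc, fun hk => ?_⟩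
    have := H.injective (hH _ (Or.inl hk))
    rw [this] at hk
    exact hcK hk
  have hOo : IsOpen O := by
    rw [isOpen_iff_mem_nhds]
    intro y hy
    obtain ⟨N, hN, -, hN'⟩ := hloc y (hOUK hy)
    refine Filter.mem_of_superset hN fun z hz => ?_
    obtain ⟨H, hH, rfl⟩ := hy
    obtain ⟨H', hH', rfl⟩ := hN' z hz
    exact ⟨H.trans H', fun x hx => by simp [hH x hx, hH' x hx], rfl⟩
  have hQo : IsOpen ((U \ K) \ O) := by
    rw [isOpen_iff_mem_nhds]
    intro y hy
    obtain ⟨N, hN, hNU, hN'⟩ := hloc y hy.1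
    refine Filter.mem_of_superset hN fun z hz => ⟨hNU hz, ?_⟩
    rintro ⟨H, hH, rfl⟩
    obtain ⟨H', hH', h'⟩ := hN' _ hz
    refine hy.2 ⟨H.trans H'.symm, fun x hx => ?_, ?_⟩
    · rw [Homeomorph.trans_apply, hH x hx, H'.symm_apply_eq, hH' x hx]
    · rw [Homeomorph.trans_apply, ← h', H'.symm_apply_apply]
  have hcO : c ∈ O := ⟨Homeomorph.refl V, fun _ _ => rfl, rfl⟩
  have hsub : U ⊆ O ∪ (range δ ∪ (U \ K) \ O) := by
    intro x hx
    by_cases h1 : x ∈ O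
    · exact Or.inl h1
    by_cases h2 : x ∈ K
    · exact Or.inr (Or.inl (hδK h2))
    · exact Or.inr (Or.inr ⟨⟨hx, h2⟩, h1⟩)
  have hdisj : Disjoint O (range δ ∪ (U \ K) \ O) := by
    rw [Set.disjoint_left]
    rintro x hx (h1 | h1)
    · exact hO x hx h1
    · exact h1.2 hx
  rcases hUc.subset_or_subset hOo (hδ.isOpen_range.union hQo) hdisj hsub with h1 | h1
  · exact hO (δ 0) (h1 (hδU (mem_range_self 0))) (mem_range_self 0)
  · exact Set.disjoint_left.1 hdisj hcO (h1 hc)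

theorem Engulfed.union_image [T2Space V] (hV : LocallyPlane V) {U K : Set V} (hUo : IsOpen U)
    (hUc : IsPreconnected U) (hK : IsClosed K) (h : Engulfed U K) {ψ : ℂ → V}
    (hψ : IsOpenEmbedding ψ) (hψU : range ψ ⊆ U) (hψK : ∀ z, ψ z ∉ K) {S : Set ℂ}
    (hS : IsCompact S) : Engulfed U (K ∪ ψ '' S) := by
  obtain ⟨δ, hδ, hδU, hδK⟩ := h.insert hV hUo hUc hK (hψU (mem_range_self 0))
  have : ψ ⁻¹' range δ ∈ 𝓝 (0 : ℂ) :=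
    (hδ.isOpen_range.preimage hψ.continuous).mem_nhds (hδK (mem_insert _ _))
  obtain ⟨r, hr, hb⟩ := Metric.nhds_basis_closedBall.mem_iff.1 this
  obtain ⟨R, hR⟩ := hS.isBounded.subset_closedBall (0 : ℂ)
  obtain ⟨g, hg, hg'⟩ := exists_homeomorph_expand hr (lt_max_of_lt_right one_pos : 0 < max R 1)
  have hgs : ∀ z ∉ closedBall (0 : ℂ) (2 * max R 1), g.symm z = z := fun z hz => by
    rw [g.symm_apply_eq, hg z hz]
  have hcl : IsClosed (ψ '' closedBall 0 (2 * max R 1)) :=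
    ((isCompact_closedBall _ _).image hψ.continuous).isClosed
  refine Engulfed.of_homeomorph (extendHomeomorph hψ g.symm hgs hcl) ?_ hδ hδU ?_
  · intro x hx
    exact extendHomeomorph_of_notMem hψ _ hgs hcl fun h' => hx (hψU (image_subset_range _ _ h'))
  · rintro x (hx | ⟨z, hz, rfl⟩)
    · rw [extendHomeomorph_of_notMem hψ _ hgs hcl]
      · exact hδK (mem_insert_of_mem _ hx)
      · rintro ⟨z, -, rfl⟩
        exact hψK z hx
    · rw [extendHomeomorph_apply]
      exact hb (hg' z (closedBall_subset_closedBall (le_max_left _ _) (hR hz)))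

/-- Open embedding of the plane onto an open rectangle. -/
theorem exists_isOpenEmbedding_rectangle {a b e : ℝ} (hab : a < b) (he : 0 < e) :
    ∃ J : ℂ → ℝ × ℝ, IsOpenEmbedding J ∧ range J = Ioo a b ×ˢ Ioo (-e) e := by
  have key : ∀ m l : ℝ, 0 < l → ∃ j : ℝ → ℝ, IsOpenEmbedding j ∧
      range j = Ioo (m - l) (m + l) := by
    intro m l hl
    have h1 : IsOpenEmbedding (fun x : ℝ => ((Homeomorph.unitBall x : ball (0 : ℝ) 1) : ℝ)) :=
      Metric.isOpen_ball.isOpenEmbedding_subtypeVal.comp Homeomorph.unitBall.isOpenEmbedding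
    have h1r : range (fun x : ℝ => ((Homeomorph.unitBall x : ball (0 : ℝ) 1) : ℝ))
        = Ioo (-1) 1 := by
      have : (fun x : ℝ => ((Homeomorph.unitBall x : ball (0 : ℝ) 1) : ℝ))
        = Subtype.val ∘ Homeomorph.unitBall := rfl
      rw [this, Homeomorph.unitBall.surjective.range_comp, Subtype.range_coe, Real.ball_eq_Ioo]
      norm_num
    let h : ℝ ≃ₜ ℝ := (Homeomorph.mulLeft₀ l hl.ne').trans (Homeomorph.addLeft m)
    refine ⟨h ∘ fun x : ℝ => ((Homeomorph.unitBall x : ball (0 : ℝ) 1) : ℝ),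
      h.isOpenEmbedding.comp h1, ?_⟩
    rw [range_comp, h1r]
    ext x
    simp only [mem_image, mem_Ioo]
    constructor
    · rintro ⟨y, hy, rfl⟩
      change m - l < m + l * y ∧ m + l * y < m + l
      constructor <;> nlinarith
    · rintro ⟨h2, h3⟩
      refine ⟨(x - m) / l, ⟨?_, ?_⟩, ?_⟩
      · rw [lt_div_iff₀ hl]; linarith
      · rw [div_lt_iff₀ hl]; linarith
      · change m + l * ((x - m) / l) = x
        field_simp
        ring
  obtain ⟨j, hj, hjr⟩ := key ((a + b) / 2) ((b - a) / 2) (by linarith)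
  obtain ⟨k, hk, hkr⟩ := key 0 e he
  refine ⟨Prod.map j k ∘ Complex.equivRealProdCLM.toHomeomorph,
    (hj.prodMap hk).comp (Homeomorph.isOpenEmbedding _), ?_⟩
  rw [(Homeomorph.surjective _).range_comp, range_prodMap, hjr, hkr]
  congr 2 <;> ring

theorem Engulfed.union_arc [T2Space V] (hV : LocallyPlane V) {U K : Set V} (hUo : IsOpen U)
    (hUc : IsPreconnected U) (hK : IsClosed K) (h : Engulfed U K) {τ : Circle × ℝ → V}
    (hτ : IsOpenEmbedding τ) (hτU : range τ ⊆ U) {α β : ℝ} (hαβ : β - α < 2 * Real.pi)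
    (hτK : ∀ θ ∈ Icc α β, τ (Circle.exp θ, 0) ∉ K) :
    Engulfed U (K ∪ (fun θ => τ (Circle.exp θ, 0)) '' Icc α β) := by
  rcases lt_or_ge β α with hlt | hle
  · simpa [Icc_eq_empty (not_le.2 hlt)] using h
  let σ : ℝ × ℝ → V := fun p => τ (Circle.exp p.1, p.2)
  have hσc : Continuous σ := by
    have := hτ.continuous
    fun_prop
  have hσo : IsOpenMap σ :=
    hτ.isOpenMap.comp (isLocalHomeomorph_circleExp.isOpenMap.prodMap IsOpenMap.id)
  obtain ⟨e₀, he₀, hth⟩ := (isCompact_Icc.prod isCompact_singleton :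
      IsCompact (Icc α β ×ˢ ({0} : Set ℝ))).exists_thickening_subset_open
    (hK.isOpen_compl.preimage hσc) (by
      rintro ⟨θ, v⟩ ⟨hθ, hv⟩
      obtain rfl : v = 0 := hv
      exact hτK θ hθ)
  obtain ⟨e, he, he1, he2⟩ : ∃ e > 0, e ≤ e₀ ∧ β - α + 2 * e < 2 * Real.pi := by
    refine ⟨min e₀ ((2 * Real.pi - (β - α)) / 4), lt_min he₀ (by linarith), min_le_left _ _, ?_⟩
    have := min_le_right e₀ ((2 * Real.pi - (β - α)) / 4)
    linarith
  obtain ⟨J, hJ, hJr⟩ := exists_isOpenEmbedding_rectangle (a := α - e) (b := β + e)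
    (by linarith) he
  have hJm : ∀ z, J z ∈ Ioo (α - e) (β + e) ×ˢ Ioo (-e) e := fun z => hJr ▸ mem_range_self z
  have hinj : Function.Injective (σ ∘ J) := by
    intro z w hzw
    apply hJ.injective
    have h1 := hτ.injective hzw
    rw [Prod.mk.injEq] at h1
    refine Prod.ext ?_ h1.2
    refine Circle.exp_injOn_Icc (a := α - e) (b := β + e) (by linarith) ?_ ?_ h1.1
    · exact Ioo_subset_Icc_self (hJm z).1
    · exact Ioo_subset_Icc_self (hJm w).1
  have hψ : IsOpenEmbedding (σ ∘ J) :=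
    IsOpenEmbedding.of_continuous_injective_isOpenMap (hσc.comp hJ.continuous) hinj
      (hσo.comp hJ.isOpenMap)
  have hsub : Icc α β ×ˢ ({0} : Set ℝ) ⊆ range J := by
    rw [hJr]
    rintro ⟨θ, v⟩ ⟨hθ, hv⟩
    obtain rfl : v = 0 := hv
    refine ⟨⟨?_, ?_⟩, ?_, ?_⟩ <;> simp at * <;> linarith
  have hS : IsCompact (J ⁻¹' (Icc α β ×ˢ ({0} : Set ℝ))) := by
    rw [hJ.isInducing.isCompact_iff, image_preimage_eq_of_subset hsub]
    exact isCompact_Icc.prod isCompact_singleton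
  have := h.union_image hV hUo hUc hK hψ ?_ ?_ hS
  · refine this.mono (union_subset_union_right _ ?_)
    rintro _ ⟨θ, hθ, rfl⟩
    obtain ⟨z, hz⟩ := hsub (show (θ, (0 : ℝ)) ∈ _ from ⟨hθ, rfl⟩)
    refine ⟨z, ?_, ?_⟩
    · rw [mem_preimage, hz]; exact ⟨hθ, rfl⟩
    · simp [Function.comp, hz, σ]
  · rintro _ ⟨z, rfl⟩
    exact hτU (mem_range_self _)
  · intro z
    apply hth
    rw [mem_thickening_iff]
    have h1 := (hJm z).1
    have h2 := (hJm z).2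
    refine ⟨(max α (min β (J z).1), 0), ⟨⟨le_max_left _ _, max_le hle (min_le_left _ _)⟩, rfl⟩, ?_⟩
    rw [Prod.dist_eq, max_lt_iff, Real.dist_eq, Real.dist_eq, abs_lt, abs_lt]
    simp only [mem_Ioo] at h1 h2
    refine ⟨⟨?_, ?_⟩, ?_, ?_⟩
    · rcases le_total (J z).1 α with h | h
      · rw [min_eq_right (h.trans hle), max_eq_left h]; linarith
      · rcases le_total (J z).1 β with h' | h'
        · rw [min_eq_right h', max_eq_right h]; linarith
        · rw [min_eq_left h', max_eq_right hle]; linarith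
    · rcases le_total (J z).1 α with h | h
      · rw [min_eq_right (h.trans hle), max_eq_left h]; linarith
      · rcases le_total (J z).1 β with h' | h'
        · rw [min_eq_right h', max_eq_right h]; linarith
        · rw [min_eq_left h', max_eq_right hle]; linarith
    · simp; linarith
    · simp; linarith

end

/-- The closed upper half-plane. -/
abbrev UpperHalf : Type := {z : ℂ // 0 ≤ z.im}

/-- Affine open embedding of the plane onto a small disc. -/
theorem exists_disc_embedding (c : ℂ) {r : ℝ} (hr : 0 < r) :
    ∃ J : ℂ → ℂ, IsOpenEmbedding J ∧ range J ⊆ ball c r ∧ J 0 = c ∧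
      ∀ z, ∃ k : ℝ, 0 < k ∧ J z = c + k * z := by
  have hr' : (r : ℂ) ≠ 0 := by exact_mod_cast hr.ne'
  let j : ℂ → ℂ := fun z => c + (r : ℂ) * (Homeomorph.unitBall z : ℂ)
  have hj : IsOpenEmbedding j :=
    (Homeomorph.addLeft c).isOpenEmbedding.comp <|
    (Homeomorph.mulLeft₀ (r : ℂ) hr').isOpenEmbedding.comp
      (Metric.isOpen_ball.isOpenEmbedding_subtypeVal.comp Homeomorph.unitBall.isOpenEmbedding)
  refine ⟨j, hj, ?_, ?_, ?_⟩
  · rintro _ ⟨z, rfl⟩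
    have : ‖(Homeomorph.unitBall z : ℂ)‖ < 1 := mem_ball_zero_iff.1 (Homeomorph.unitBall z).2
    rw [mem_ball, dist_eq_norm]
    simp only [j, add_sub_cancel_left, norm_mul, Complex.norm_real, Real.norm_of_nonneg hr.le]
    nlinarith
  · simp only [j]
    rw [Homeomorph.coe_unitBall_apply_zero, mul_zero, add_zero]
  · intro z
    refine ⟨r * (√(1 + ‖z‖ ^ 2))⁻¹, by positivity, ?_⟩
    simp only [j, Homeomorph.unitBall_apply_coe, OpenPartialHomeomorph.univUnitBall_apply]
    rw [Complex.real_smul]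
    push_cast
    ring

section Charts
variable {E : Type*} [TopologicalSpace E]

theorem isOpenEmbedding_symm_comp {P : Type*} [TopologicalSpace P]
    (e : OpenPartialHomeomorph E (EuclideanHalfSpace 2)) {J : P → ℂ} (hJ : Continuous J)
    (hinj : Function.Injective J)
    (him : ∀ z, 0 ≤ (J z).im) (ht : ∀ z, complexToHalf (J z) ∈ e.target)
    (hop : ∀ U : Set P, IsOpen U → IsOpen (halfToComplex ⁻¹' (J '' U))) :
    IsOpenEmbedding fun z => e.symm (complexToHalf (J z)) := by
  have hc : Continuous fun z => complexToHalf (J z) := continuous_complexToHalf.comp hJ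
  refine IsOpenEmbedding.of_continuous_injective_isOpenMap ?_ ?_ ?_
  · exact e.continuousOn_symm.comp_continuous hc ht
  · intro z w h
    have h1 := e.symm.injOn (ht z) (ht w) h
    apply hinj
    rw [← halfToComplex_complexToHalf (him z), h1, halfToComplex_complexToHalf (him w)]
  · intro U hU
    have h1 : (fun z => e.symm (complexToHalf (J z))) '' U =
        e.symm '' (halfToComplex ⁻¹' (J '' U)) := by
      ext x
      constructor
      · rintro ⟨z, hz, rfl⟩
        exact ⟨_, ⟨z, hz, (halfToComplex_complexToHalf (him z)).symm⟩, rfl⟩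
      · rintro ⟨y, ⟨z, hz, hy⟩, rfl⟩
        exact ⟨z, hz, by simp only [hy, complexToHalf_halfToComplex]⟩
    rw [h1]
    refine e.symm.isOpen_image_of_subset_source (hop U hU) ?_
    rintro y ⟨z, hz, hy⟩
    have := ht z
    rwa [hy, complexToHalf_halfToComplex] at this

variable [ChartedSpace (EuclideanHalfSpace 2) E]

theorem exists_boundary_chart {x : E} (hx : x ∈ (𝓡∂ 2).boundary E) :
    ∃ κ : UpperHalf → E, IsOpenEmbedding κ ∧ κ ⟨0, le_rfl⟩ = x ∧
      ∀ z, κ z ∈ (𝓡∂ 2).boundary E ↔ z.1.im = 0 := by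
  let e := chartAt (EuclideanHalfSpace 2) x
  have hxe : x ∈ e.source := mem_chart_source _ x
  have h0 : (e x).1 0 = 0 := (mem_boundary_iff_chart e hxe).1 hx
  have hWo : IsOpen (complexToHalf ⁻¹' e.target) := e.open_target.preimage continuous_complexToHalf
  obtain ⟨r, hr, hrW⟩ := Metric.isOpen_iff.1 hWo (halfToComplex (e x)) (by
    simp [complexToHalf_halfToComplex, hxe])
  obtain ⟨J, hJ, hJr, hJ0, hJk⟩ := exists_disc_embedding (halfToComplex (e x)) hr
  have hsign : ∀ z, ∃ k : ℝ, 0 < k ∧ (J z).im = k * z.im := by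
    intro z
    obtain ⟨k, hk, h⟩ := hJk z
    refine ⟨k, hk, ?_⟩
    rw [h]
    simp [h0]
  have him : ∀ z : ℂ, 0 ≤ (J z).im ↔ 0 ≤ z.im := by
    intro z
    obtain ⟨k, hk, h⟩ := hsign z
    rw [h, mul_nonneg_iff_of_pos_left hk]
  have ht : ∀ z, complexToHalf (J z) ∈ e.target := fun z => hrW (hJr (mem_range_self z))
  refine ⟨fun z => e.symm (complexToHalf (J z.1)),
    isOpenEmbedding_symm_comp e (hJ.continuous.comp continuous_subtype_val)
      (hJ.injective.comp Subtype.val_injective) (fun z => (him _).2 z.2) (fun z => ht _) ?_, ?_, ?_⟩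
  · rintro _ ⟨O, hO, rfl⟩
    have : halfToComplex ⁻¹' ((fun z : UpperHalf => J z.1) '' (Subtype.val ⁻¹' O))
        = halfToComplex ⁻¹' (J '' O) := by
      ext y
      constructor
      · rintro ⟨z, hz, h⟩
        exact ⟨z.1, hz, h⟩
      · rintro ⟨z, hz, h⟩
        exact ⟨⟨z, (him z).1 (by rw [h]; exact y.2)⟩, hz, h⟩
    rw [this]
    exact (hJ.isOpenMap O hO).preimage continuous_halfToComplex
  · simp only [hJ0]
    rw [complexToHalf_halfToComplex, e.left_inv hxe]
  · intro z
    rw [mem_boundary_iff_chart e (e.map_target (ht _)), e.right_inv (ht _), ← halfToComplex_im,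
      halfToComplex_complexToHalf ((him _).2 z.2)]
    obtain ⟨k, hk, h⟩ := hsign z
    rw [h]
    simp [hk.ne']

theorem exists_interior_chart {x : E} (hx : x ∉ (𝓡∂ 2).boundary E) :
    ∃ κ : ℂ → E, IsOpenEmbedding κ ∧ κ 0 = x ∧ ∀ z, κ z ∉ (𝓡∂ 2).boundary E := by
  let e := chartAt (EuclideanHalfSpace 2) x
  have hxe : x ∈ e.source := mem_chart_source _ x
  have h0 : 0 < (halfToComplex (e x)).im :=
    lt_of_le_of_ne (e x).2 fun h => hx ((mem_boundary_iff_chart e hxe).2 h.symm)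
  have hWo : IsOpen (complexToHalf ⁻¹' e.target ∩ {z | 0 < z.im}) :=
    (e.open_target.preimage continuous_complexToHalf).inter
      (isOpen_lt continuous_const Complex.continuous_im)
  obtain ⟨r, hr, hrW⟩ := Metric.isOpen_iff.1 hWo (halfToComplex (e x)) (by
    refine ⟨?_, h0⟩
    simp [complexToHalf_halfToComplex, hxe])
  obtain ⟨J, hJ, hJr, hJ0, hJk⟩ := exists_disc_embedding (halfToComplex (e x)) hr
  have ht : ∀ z, complexToHalf (J z) ∈ e.target ∧ 0 < (J z).im :=
    fun z => hrW (hJr (mem_range_self z))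
  refine ⟨fun z => e.symm (complexToHalf (J z)), isOpenEmbedding_symm_comp e hJ.continuous
    hJ.injective (fun z => (ht z).2.le) (fun z => (ht z).1) ?_, ?_, ?_⟩
  · intro O hO
    exact (hJ.isOpenMap O hO).preimage continuous_halfToComplex
  · simp only [hJ0]
    rw [complexToHalf_halfToComplex, e.left_inv hxe]
  · intro z
    rw [mem_boundary_iff_chart e (e.map_target (ht _).1), e.right_inv (ht _).1, ← halfToComplex_im,
      halfToComplex_complexToHalf (ht z).2.le]
    exact (ht z).2.ne'

theorem isClosed_boundary : IsClosed ((𝓡∂ 2).boundary E) := by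
  rw [← isOpen_compl_iff, isOpen_iff_mem_nhds]
  intro x hx
  obtain ⟨κ, hκ, rfl, h⟩ := exists_interior_chart hx
  refine Filter.mem_of_superset (hκ.isOpen_range.mem_nhds (mem_range_self 0)) ?_
  rintro _ ⟨z, rfl⟩
  exact h z

/-- Charts of the boundary curve. -/
theorem exists_boundary_line (x : (𝓡∂ 2).boundary E) :
    ∃ l : ℝ → (𝓡∂ 2).boundary E, IsOpenEmbedding l ∧ l 0 = x := by
  obtain ⟨κ, hκ, h0, hb⟩ := exists_boundary_chart x.2
  let i : ℝ → UpperHalf := fun a => ⟨(a : ℂ), by simp⟩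
  have hi : IsEmbedding i := by
    have : Continuous i := Complex.continuous_ofReal.subtype_mk _
    refine IsEmbedding.of_leftInverse (f := fun z : UpperHalf => z.1.re) (fun a => by simp [i])
      (Complex.continuous_re.comp continuous_subtype_val) this
  have hil : ∀ a, κ (i a) ∈ (𝓡∂ 2).boundary E := fun a => (hb _).2 (by simp [i])
  refine ⟨fun a => ⟨κ (i a), hil a⟩, ⟨?_, ?_⟩, ?_⟩
  · refine IsEmbedding.of_comp (g := Subtype.val) ?_ continuous_subtype_val ?_
    · exact (hκ.continuous.comp hi.continuous).subtype_mk _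
    · exact hκ.isEmbedding.comp hi
  · have : range (fun a => (⟨κ (i a), hil a⟩ : (𝓡∂ 2).boundary E)) = Subtype.val ⁻¹' range κ := by
      ext y
      constructor
      · rintro ⟨a, rfl⟩
        exact ⟨i a, rfl⟩
      · rintro ⟨z, hz⟩
        refine ⟨z.1.re, Subtype.ext ?_⟩
        simp only
        rw [← hz]
        congr 1
        apply Subtype.ext
        apply Complex.ext
        · simp [i]
        · simp [i, (hb z).1 (hz ▸ y.2)]
    rw [this]
    exact hκ.isOpen_range.preimage continuous_subtype_val
  · apply Subtype.ext
    rw [← h0]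
    rfl

instance locallyConnectedSpace_boundary : LocallyConnectedSpace ((𝓡∂ 2).boundary E) := by
  have : ∀ x : (𝓡∂ 2).boundary E, ∃ l : ℝ → (𝓡∂ 2).boundary E, IsOpenEmbedding l ∧ l 0 = x :=
    exists_boundary_line
  choose l hl h0 using this
  refine locallyConnectedSpace_of_connected_bases (fun x (n : Set ℝ) => l x '' n)
    (fun _ n => n ∈ 𝓝 (0 : ℝ) ∧ IsConnected n) ?_ ?_
  · intro x
    have hb : (𝓝 (0 : ℝ)).HasBasis (fun n : Set ℝ => n ∈ 𝓝 (0 : ℝ) ∧ IsConnected n) id := by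
      refine ⟨fun s => ⟨fun hs => ?_, fun ⟨n, hn, hns⟩ => Filter.mem_of_superset hn.1 hns⟩⟩
      obtain ⟨r, hr, h⟩ := Metric.mem_nhds_iff.1 hs
      exact ⟨ball 0 r, ⟨ball_mem_nhds _ hr, (convex_ball _ _).isConnected ⟨0, mem_ball_self hr⟩⟩, h⟩
    have := hb.map (l x)
    rwa [(hl x).map_nhds_eq, h0] at this
  · intro x n hn
    exact hn.2.isPreconnected.image _ (hl x).continuous.continuousOn

end Charts

/-- A compact connected cover of the circle is a circle. -/
theorem exists_homeomorph_circle_of_cover {C : Type*} [TopologicalSpace C] [T2Space C]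
    [CompactSpace C] [ConnectedSpace C] {p : C → Circle} (hp : IsCoveringMap p)
    (hs : Function.Surjective p) : ∃ h : Circle ≃ₜ C, p (h 1) = 1 := by
  have hlift : ∀ (t : ℝ) (y : C), p y = Circle.exp t → ∃ γ : ℝ → C, Continuous γ ∧ γ t = y ∧
      p ∘ γ = Circle.exp := by
    intro t y h
    obtain ⟨G, ⟨h1, h2⟩, -⟩ := hp.existsUnique_continuousMap_lifts Circle.exp t y h
    exact ⟨G, G.continuous, h1, h2⟩
  have hopen : ∀ γ : ℝ → C, Continuous γ → p ∘ γ = Circle.exp → IsOpenMap γ := by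
    intro γ hγ h
    refine IsLocalHomeomorph.isOpenMap
      (IsLocalHomeomorph.of_comp (g := p) ?_ hp.isLocalHomeomorph hγ)
    rw [h]
    exact isLocalHomeomorph_circleExp
  have hper : ∀ (γ γ' : ℝ → C), Continuous γ → p ∘ γ = Circle.exp → Continuous γ' →
      p ∘ γ' = Circle.exp → ∀ (s t : ℝ) (m : ℤ), s = t + m * (2 * Real.pi) → γ' s = γ t →
      ∀ x, γ' (x + m * (2 * Real.pi)) = γ x := by
    intro γ γ' hγ h hγ' h' s t m hst he x
    have h1 : (fun x => γ' (x + m * (2 * Real.pi))) = γ := by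
      refine hp.eq_of_comp_eq (by fun_prop) hγ ?_ t (by rw [← he, hst])
      funext x
      have h2 := congrFun h' (x + m * (2 * Real.pi))
      have h3 := congrFun h x
      simp only [Function.comp] at h2 h3 ⊢
      rw [h2, h3, Circle.exp_eq_exp]
      exact ⟨m, rfl⟩
    exact congrFun h1 x
  obtain ⟨x₀, hx₀⟩ := hs 1
  obtain ⟨γ, hγ, hγ0, hpγ⟩ := hlift 0 x₀ (by simp [hx₀])
  have hpγ' : ∀ t, p (γ t) = Circle.exp t := congrFun hpγ
  have hsurj : Function.Surjective γ := by
    have hcl : IsClosed (range γ) := by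
      rw [← isOpen_compl_iff, isOpen_iff_mem_nhds]
      intro y hy
      obtain ⟨θ, hθ⟩ := Circle.exp_surjective (p y)
      obtain ⟨γ', hγ', h0, hpγ''⟩ := hlift θ y hθ.symm
      refine Filter.mem_of_superset
        ((hopen γ' hγ' hpγ'').isOpen_range.mem_nhds ⟨θ, h0⟩) ?_
      rintro _ ⟨s, rfl⟩ ⟨t, ht⟩
      have h1 : Circle.exp s = Circle.exp t := by
        rw [← congrFun hpγ'' s, ← hpγ', ht]; rfl
      obtain ⟨m, hm⟩ := Circle.exp_eq_exp.1 h1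
      have := hper γ γ' hγ hpγ hγ' hpγ'' s t m hm ht.symm (θ - m * (2 * Real.pi))
      rw [sub_add_cancel, h0] at this
      exact hy ⟨_, this.symm⟩
    have : range γ = univ :=
      IsClopen.eq_univ ⟨hcl, (hopen γ hγ hpγ).isOpen_range⟩ (range_nonempty γ)
    exact range_eq_univ.1 this
  have hexists : ∃ n : ℕ, 0 < n ∧ Function.Periodic γ (n * (2 * Real.pi)) := by
    obtain ⟨y, hy⟩ := exists_clusterPt_of_compactSpace
      (Filter.map (fun k : ℕ => γ (k * (2 * Real.pi))) Filter.atTop)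
    obtain ⟨e, hye, hpe⟩ := hp.isLocalHomeomorph y
    have hN := (mapClusterPt_iff_frequently.1 hy) e.source (e.open_source.mem_nhds hye)
    rw [Filter.frequently_atTop] at hN
    obtain ⟨k, -, hk⟩ := hN 0
    obtain ⟨l, hl, hl'⟩ := hN (k + 1)
    have h1 : γ (l * (2 * Real.pi)) = γ (k * (2 * Real.pi)) := by
      apply e.injOn hl' hk
      rw [← hpe, hpγ', hpγ', Circle.exp_eq_exp]
      exact ⟨(l : ℤ) - k, by push_cast; ring⟩
    refine ⟨l - k, by omega, fun x => ?_⟩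
    have h2 := hper γ γ hγ hpγ hγ hpγ (l * (2 * Real.pi)) (k * (2 * Real.pi)) ((l : ℤ) - k)
      (by push_cast; ring) h1 x
    rw [Nat.cast_sub (by omega)]
    rw [← h2]
    push_cast
    rfl
  classical
  let n := Nat.find hexists
  obtain ⟨hn, hnper⟩ : 0 < n ∧ Function.Periodic γ (n * (2 * Real.pi)) := Nat.find_spec hexists
  have hnpos : 0 < (n : ℝ) * (2 * Real.pi) := by positivity
  have : Fact (0 < (n : ℝ) * (2 * Real.pi)) := ⟨hnpos⟩
  let Γ : AddCircle ((n : ℝ) * (2 * Real.pi)) → C := hnper.lift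
  have hΓ : ∀ x : ℝ, Γ (x : AddCircle _) = γ x := fun x => rfl
  have hΓc : Continuous Γ := continuous_coinduced_dom.2 hγ
  have hΓi : Function.Injective Γ := by
    intro a b hab
    induction a using QuotientAddGroup.induction_on with | H s =>
    induction b using QuotientAddGroup.induction_on with | H t =>
    change γ s = γ t at hab
    have h1 : Circle.exp s = Circle.exp t := by rw [← hpγ', ← hpγ', hab]
    obtain ⟨m, hm⟩ := Circle.exp_eq_exp.1 h1
    have h2 : Function.Periodic γ (m * (2 * Real.pi)) :=
      hper γ γ hγ hpγ hγ hpγ s t m hm hab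
    have hr0 : 0 ≤ m % n := Int.emod_nonneg _ (by omega)
    have hrn : m % n < n := Int.emod_lt_of_pos _ (by omega)
    have hmod : m % n = 0 := by
      by_contra hne
      have hlt : (m % n).toNat < n := by omega
      refine Nat.find_min hexists hlt ⟨by omega, ?_⟩
      have h3 := h2.sub_period ((hnper.int_mul (m / n)))
      have h4 : (m : ℝ) * (2 * Real.pi) - ((m / n : ℤ) : ℝ) * (n * (2 * Real.pi))
          = (((m % n).toNat : ℕ) : ℝ) * (2 * Real.pi) := by
        have h5 : (((m % n).toNat : ℕ) : ℤ) = m - n * (m / n) := by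
          rw [Int.toNat_of_nonneg hr0, Int.emod_def]
        have h6 : (((m % n).toNat : ℕ) : ℝ) = (m : ℝ) - n * ((m / n : ℤ) : ℝ) := by
          exact_mod_cast h5
        rw [h6]; ring
      rwa [h4] at h3
    obtain ⟨q, hq⟩ := Int.dvd_of_emod_eq_zero hmod
    rw [eq_comm]
    refine (QuotientAddGroup.eq).2 ?_
    refine AddSubgroup.mem_zmultiples_iff.2 ⟨q, ?_⟩
    rw [hm, hq]
    push_cast
    rw [zsmul_eq_mul]
    ring
  have hΓs : Function.Surjective Γ := fun y => by
    obtain ⟨s, hs⟩ := hsurj y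
    exact ⟨(s : AddCircle _), (hΓ s).trans hs⟩
  let H : AddCircle ((n : ℝ) * (2 * Real.pi)) ≃ₜ C :=
    (show Continuous (Equiv.ofBijective Γ ⟨hΓi, hΓs⟩) from hΓc).homeoOfEquivCompactToT2
  refine ⟨(AddCircle.homeomorphCircle hnpos.ne').symm.trans H, ?_⟩
  have h1 : (AddCircle.homeomorphCircle hnpos.ne').symm 1 = ((0 : ℝ) : AddCircle _) := by
    rw [Homeomorph.symm_apply_eq, AddCircle.homeomorphCircle_apply]
    simp
  rw [Homeomorph.trans_apply, h1]
  change p (γ 0) = 1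
  rw [hpγ', Circle.exp_zero]

section Boundary
variable {E : Type*} [TopologicalSpace E] [T2Space E] [CompactSpace E]
  [ChartedSpace (EuclideanHalfSpace 2) E]

/-- Parametrization of the boundary by finitely many circles. -/
theorem exists_boundary_param {L : Type*} [TopologicalSpace L] {M : ℕ} (Λ : L ≃ₜ Fin M × Circle)
    {φ : ((𝓡∂ 2).boundary E) → L} (hφ : Continuous φ)
    (hcov : ∀ x : ((𝓡∂ 2).boundary E),
      ∃ h : Set.MapsTo φ (connectedComponent x) (connectedComponent (φ x)),
        IsCoveringMap h.restrict ∧ Function.Surjective h.restrict) :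
    ∃ (β : Type) (_ : Fintype β) (Ω : β → Circle → (𝓡∂ 2).boundary E) (m : β → Fin M)
      (φ' : β → Circle → Circle), (∀ b, Continuous (Ω b)) ∧ (∀ b, Continuous (φ' b)) ∧
      (∀ b, φ' b 1 = 1) ∧ (∀ x, ∃ b w, Ω b w = x) ∧
      (∀ b w b' w', Ω b w = Ω b' w' → b = b' ∧ w = w') ∧
      ∀ b w, Λ (φ (Ω b w)) = (m b, φ' b w) := by
  let B := (𝓡∂ 2).boundary E
  have : CompactSpace B := isCompact_iff_compactSpace.1 isClosed_boundary.isCompact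
  have : Finite (ConnectedComponents B) := finite_of_compact_of_discrete
  obtain ⟨N, ⟨eN⟩⟩ := Finite.exists_equiv_fin (ConnectedComponents B)
  let rep : Fin N → B := fun b => (ConnectedComponents.surjective_coe (eN.symm b)).choose
  have hrep : ∀ b, ((rep b : B) : ConnectedComponents B) = eN.symm b :=
    fun b => (ConnectedComponents.surjective_coe (eN.symm b)).choose_spec
  have hcirc : ∀ b : Fin N, ∃ h : Circle ≃ₜ connectedComponent (rep b),
      (Λ (φ (h 1))).2 = 1 := by
    intro b
    obtain ⟨h, hc, hsj⟩ := hcov (rep b)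
    let m := (Λ (φ (rep b))).1
    have hm : ∀ y ∈ connectedComponent (φ (rep b)), (Λ y).1 = m := by
      intro y hy
      have h1 : Λ y ∈ connectedComponent (Λ (φ (rep b))) :=
        Λ.continuous.mapsTo_connectedComponent _ hy
      have h2 := continuous_fst.mapsTo_connectedComponent (Λ (φ (rep b))) h1
      have h3 : connectedComponent (Λ (φ (rep b))).1 = {(Λ (φ (rep b))).1} :=
        connectedComponent_eq_singleton _
      rw [h3] at h2
      exact h2
    have hcirc : ∀ w : Circle, Λ.symm (m, w) ∈ connectedComponent (φ (rep b)) := by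
      intro w
      have h1 : IsPreconnected (range fun w : Circle => Λ.symm (m, w)) :=
        isPreconnected_range (by fun_prop)
      refine h1.subset_connectedComponent (x := φ (rep b)) ⟨(Λ (φ (rep b))).2, ?_⟩ ⟨w, rfl⟩
      simp [m]
    let q : connectedComponent (φ (rep b)) ≃ₜ Circle :=
      { toFun := fun y => (Λ y.1).2
        invFun := fun w => ⟨Λ.symm (m, w), hcirc w⟩
        left_inv := fun y => Subtype.ext (by
          have := hm y.1 y.2
          simp only
          rw [Λ.symm_apply_eq, ← this])
        right_inv := fun w => by simp
        continuous_toFun := by fun_prop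
        continuous_invFun := by fun_prop }
    have : ConnectedSpace (connectedComponent (rep b)) :=
      isConnected_iff_connectedSpace.1 isConnected_connectedComponent
    have : CompactSpace (connectedComponent (rep b)) :=
      isCompact_iff_compactSpace.1 isClosed_connectedComponent.isCompact
    have hcq : IsCoveringMap (q ∘ h.restrict) := hc.homeomorph_comp q
    obtain ⟨k, hk⟩ := exists_homeomorph_circle_of_cover hcq (q.surjective.comp hsj)
    exact ⟨k, hk⟩
  choose h hh using hcirc
  have hmem : ∀ b w, (((h b w : connectedComponent (rep b)) : B) : ConnectedComponents B)
      = eN.symm b := by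
    intro b w
    rw [← hrep b]
    exact ConnectedComponents.coe_eq_coe'.2 (h b w).2
  have hconst : ∀ b w, (Λ (φ (h b w))).1 = (Λ (φ (h b 1))).1 := by
    intro b w
    have hcont : Continuous fun w => (Λ (φ (h b w))).1 := by
      have := (h b).continuous
      fun_prop
    have : PreconnectedSpace Circle := by
      rw [preconnectedSpace_iff_univ, ← Circle.exp_surjective.range_eq]
      exact isPreconnected_range Circle.exp.continuous
    exact PreconnectedSpace.constant inferInstance hcont
  refine ⟨Fin N, inferInstance, fun b w => h b w, fun b => (Λ (φ (h b 1))).1,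
    fun b w => (Λ (φ (h b w))).2, ?_, ?_, hh, ?_, ?_, ?_⟩
  · intro b
    exact continuous_subtype_val.comp (h b).continuous
  · intro b
    have := (h b).continuous
    fun_prop
  · intro x
    let b := eN (x : ConnectedComponents B)
    have hx : x ∈ connectedComponent (rep b) := by
      rw [← ConnectedComponents.coe_eq_coe', hrep]
      simp [b]
    obtain ⟨w, hw⟩ := (h b).surjective ⟨x, hx⟩
    exact ⟨b, w, congrArg Subtype.val hw⟩
  · intro b w b' w' he
    change (h b w : B) = h b' w' at he
    have hbb : b = b' := by
      apply eN.symm.injective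
      rw [← hmem b w, ← hmem b' w', he]
    subst hbb
    exact ⟨rfl, (h b).injective (Subtype.ext he)⟩
  · intro b w
    exact Prod.ext (hconst b w) rfl

end Boundary

instance : Nonempty UpperHalf := ⟨⟨0, le_rfl⟩⟩

/-- A space with a distinguished subset that is locally the boundary of a half-plane. -/
structure HalfSurface (E : Type*) [TopologicalSpace E] (bd : Set E) : Prop where
  boundary_chart : ∀ x ∈ bd, ∃ κ : UpperHalf → E, IsOpenEmbedding κ ∧ κ ⟨0, le_rfl⟩ = x ∧
    ∀ z, κ z ∈ bd ↔ z.1.im = 0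
  interior_chart : ∀ x ∉ bd, ∃ κ : ℂ → E, IsOpenEmbedding κ ∧ κ 0 = x ∧ ∀ z, κ z ∉ bd

/-- The surface with an infinite open collar glued to its boundary. -/
abbrev Collar {E : Type*} (bd : Set E) : Type _ := {p : E × ℝ // 0 ≤ p.2 ∧ (p.2 = 0 ∨ p.1 ∈ bd)}

section Collar
variable {E : Type*} [TopologicalSpace E] {bd : Set E}

/-- A point of the surface, seen in the collared surface. -/
def Collar.base (bd : Set E) (x : E) : Collar bd := ⟨(x, 0), le_rfl, Or.inl rfl⟩

/-- A point of the collar. -/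
def Collar.tail {y : E} (hy : y ∈ bd) (s : ℝ) : Collar bd :=
  ⟨(y, max s 0), le_max_right _ _, Or.inr hy⟩

theorem Collar.continuous_base : Continuous (Collar.base bd) := by
  unfold Collar.base
  fun_prop

theorem UpperHalf.isPreconnected_univ : IsPreconnected (univ : Set UpperHalf) := by
  have : Convex ℝ {z : ℂ | 0 ≤ z.im} := convex_halfSpace_im_ge 0
  exact isPreconnected_iff_preconnectedSpace.1 this.isPreconnected |>.isPreconnected_univ

theorem HalfSurface.isClosed (h : HalfSurface E bd) : IsClosed bd := by
  rw [← isOpen_compl_iff, isOpen_iff_mem_nhds]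
  intro x hx
  obtain ⟨κ, hκ, rfl, hb⟩ := h.interior_chart x hx
  refine Filter.mem_of_superset (hκ.isOpen_range.mem_nhds (mem_range_self 0)) ?_
  rintro _ ⟨z, rfl⟩
  exact hb z

theorem HalfSurface.of_chartedSpace [ChartedSpace (EuclideanHalfSpace 2) E] :
    HalfSurface E ((𝓡∂ 2).boundary E) :=
  ⟨fun _ => exists_boundary_chart, fun _ => exists_interior_chart⟩

theorem HalfSurface.restrict (h : HalfSurface E bd) {C : Set E} (hC : IsClopen C) :
    HalfSurface C (Subtype.val ⁻¹' bd) := by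
  have key : ∀ {P : Type} [TopologicalSpace P] {κ : P → E}, IsOpenEmbedding κ →
      (∀ z, κ z ∈ C) → ∃ κ' : P → C, IsOpenEmbedding κ' ∧ ∀ z, (κ' z : E) = κ z := by
    intro P _ κ hκ hm
    refine ⟨fun z => ⟨κ z, hm z⟩, ?_, fun _ => rfl⟩
    exact IsOpenEmbedding.of_comp _ (hC.isOpen.isOpenEmbedding_subtypeVal) hκ
  constructor
  · intro x hx
    obtain ⟨κ, hκ, h0, hb⟩ := h.boundary_chart x.1 hx
    have hr : IsPreconnected (range κ) := by
      rw [← image_univ]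
      exact UpperHalf.isPreconnected_univ.image _ hκ.continuous.continuousOn
    have hsub : range κ ⊆ C := hr.subset_isClopen hC ⟨x.1, ⟨_, h0⟩, x.2⟩
    obtain ⟨κ', hκ', he⟩ := key hκ fun z => hsub (mem_range_self z)
    exact ⟨κ', hκ', Subtype.ext ((he _).trans h0), fun z => by rw [mem_preimage, he, hb]⟩
  · intro x hx
    obtain ⟨κ, hκ, h0, hb⟩ := h.interior_chart x.1 hx
    have hr : IsPreconnected (range κ) := isPreconnected_range hκ.continuous
    have hsub : range κ ⊆ C := hr.subset_isClopen hC ⟨x.1, ⟨_, h0⟩, x.2⟩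
    obtain ⟨κ', hκ', he⟩ := key hκ fun z => hsub (mem_range_self z)
    exact ⟨κ', hκ', Subtype.ext ((he _).trans h0), fun z => by rw [mem_preimage, he]; exact hb z⟩

/-- The chart of the collared surface around a boundary point. -/
noncomputable def collarChart {κ : UpperHalf → E} (hb : ∀ z, κ z ∈ bd ↔ z.1.im = 0) (z : ℂ) :
    Collar bd :=
  ⟨(κ ⟨⟨z.re, max z.im 0⟩, le_max_right _ _⟩, max (-z.im) 0), le_max_right _ _, by
    rcases le_total z.im 0 with h | h
    · exact Or.inr ((hb _).2 (max_eq_right h))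
    · exact Or.inl (max_eq_right (by simpa using h))⟩

theorem collarChart_eq {E : Type*} {bd : Set E} {κ : UpperHalf → E}
    (hb : ∀ z, κ z ∈ bd ↔ z.1.im = 0) (p : Collar bd) (y : UpperHalf) (hy : κ y = p.1.1) :
    collarChart hb (y.1 - (p.1.2 : ℂ) * Complex.I) = p := by
  have h0 := p.2.1
  apply Subtype.ext
  rcases p.2.2 with h | h
  · have h1 : (⟨⟨(y.1 - (p.1.2 : ℂ) * Complex.I).re, max (y.1 - (p.1.2 : ℂ) * Complex.I).im 0⟩,
        le_max_right _ _⟩ : UpperHalf) = y := by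
      apply Subtype.ext
      apply Complex.ext <;> simp [h, y.2]
    refine Prod.ext ?_ ?_
    · simp only [collarChart]; rw [h1, hy]
    · simp [collarChart, h, y.2]
  · have him : y.1.im = 0 := (hb y).1 (by rwa [hy])
    have h1 : (⟨⟨(y.1 - (p.1.2 : ℂ) * Complex.I).re, max (y.1 - (p.1.2 : ℂ) * Complex.I).im 0⟩,
        le_max_right _ _⟩ : UpperHalf) = y := by
      apply Subtype.ext
      apply Complex.ext <;> simp [him, h0]
    refine Prod.ext ?_ ?_
    · simp only [collarChart]; rw [h1, hy]
    · simp [collarChart, him, h0]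

theorem isOpenEmbedding_collarChart {κ : UpperHalf → E} (hκ : IsOpenEmbedding κ)
    (hb : ∀ z, κ z ∈ bd ↔ z.1.im = 0) : IsOpenEmbedding (collarChart hb) := by
  have hinv : ∀ z : ℂ, (⟨z.re, max z.im 0⟩ : ℂ) - ((max (-z.im) 0 : ℝ) : ℂ) * Complex.I = z := by
    intro z
    apply Complex.ext
    · simp
    · simp
  have hc : Continuous (collarChart hb) := by
    refine Continuous.subtype_mk (Continuous.prodMk ?_ ?_) _
    · refine hκ.continuous.comp (Continuous.subtype_mk ?_ _)
      have : (fun z : ℂ => (⟨z.re, max z.im 0⟩ : ℂ)) = fun z : ℂ =>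
          ((z.re : ℝ) : ℂ) + ((max z.im 0 : ℝ) : ℂ) * Complex.I := by
        funext z; apply Complex.ext <;> simp
      rw [this]
      fun_prop
    · fun_prop
  refine IsOpenEmbedding.of_continuous_injective_isOpenMap hc ?_ ?_
  · intro z w hzw
    have h1 := congrArg (fun p => p.1.1) hzw
    have h2 := congrArg (fun p => p.1.2) hzw
    simp only [collarChart] at h1 h2
    have h3 := congrArg Subtype.val (hκ.injective h1)
    simp only at h3
    rw [← hinv z, ← hinv w, h3, h2]
  · intro U hU
    let κ' := hκ.toOpenPartialHomeomorph κ
    have hs : ∀ y, κ'.symm (κ y) = y := fun y => hκ.toOpenPartialHomeomorph_left_inv κ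
    let g : Collar bd → ℂ := fun p => (κ'.symm p.1.1).1 - (p.1.2 : ℂ) * Complex.I
    have hg : ContinuousOn g {p | p.1.1 ∈ range κ} := by
      have h1 : ContinuousOn κ'.symm (range κ) := by
        have := κ'.continuousOn_symm
        rwa [hκ.toOpenPartialHomeomorph_target] at this
      have h2 : ContinuousOn (fun p : Collar bd => κ'.symm p.1.1) {p | p.1.1 ∈ range κ} :=
        h1.comp (by fun_prop) fun p hp => hp
      have h3 : Continuous fun p : Collar bd => (p.1.2 : ℂ) * Complex.I := by fun_prop
      exact (continuous_subtype_val.comp_continuousOn h2).sub h3.continuousOn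
    have hro : IsOpen {p : Collar bd | p.1.1 ∈ range κ} :=
      hκ.isOpen_range.preimage (by fun_prop : Continuous fun p : Collar bd => p.1.1)
    have himg : collarChart hb '' U = {p : Collar bd | p.1.1 ∈ range κ} ∩ g ⁻¹' U := by
      ext p
      constructor
      · rintro ⟨z, hz, rfl⟩
        refine ⟨mem_range_self _, ?_⟩
        simp only [mem_preimage, g, collarChart, hs, hinv]
        exact hz
      · rintro ⟨⟨y, hy⟩, hp⟩
        refine ⟨g p, hp, ?_⟩
        simp only [g]
        rw [← hy, hs]
        exact collarChart_eq hb p y hy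
    rw [himg]
    exact hg.isOpen_inter_preimage hro hU

theorem HalfSurface.locallyPlane_collar (h : HalfSurface E bd) : LocallyPlane (Collar bd) := by
  intro p
  by_cases hp : p.1.1 ∈ bd
  · obtain ⟨κ, hκ, h0, hb⟩ := h.boundary_chart _ hp
    have h1 := isOpenEmbedding_collarChart hκ hb
    let a : ℂ := (0 : ℂ) - (p.1.2 : ℂ) * Complex.I
    refine ⟨collarChart hb ∘ fun z => a + z, h1.comp (Homeomorph.addLeft a).isOpenEmbedding, ?_⟩
    simp only [Function.comp, add_zero]
    exact collarChart_eq hb p ⟨0, le_rfl⟩ h0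
  · obtain ⟨κ, hκ, h0, hb⟩ := h.interior_chart _ hp
    have hp2 : p.1.2 = 0 := p.2.2.resolve_right hp
    refine ⟨fun z => Collar.base bd (κ z), ?_, ?_⟩
    · refine IsOpenEmbedding.of_continuous_injective_isOpenMap
        (Collar.continuous_base.comp hκ.continuous) ?_ ?_
      · intro z w hzw
        exact hκ.injective (congrArg (fun p => p.1.1) hzw)
      · intro U hU
        have : (fun z => Collar.base bd (κ z)) '' U
            = (fun p : Collar bd => p.1.1) ⁻¹' (κ '' U) := by
          ext q
          constructor
          · rintro ⟨z, hz, rfl⟩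
            exact ⟨z, hz, rfl⟩
          · rintro ⟨z, hz, hq⟩
            simp only at hq
            refine ⟨z, hz, Subtype.ext (Prod.ext hq ?_)⟩
            exact (q.2.2.resolve_right (hq ▸ hb z)).symm
        rw [this]
        exact (hκ.isOpenMap U hU).preimage (by fun_prop)
    · exact Subtype.ext (Prod.ext h0 hp2.symm)

/-- A continuous injection of the collared surface shifting the collar outwards by `m`. -/
def IsPush (bd : Set E) (g : Collar bd → Collar bd) (m : E → ℝ) : Prop :=
  Continuous g ∧ Function.Injective g ∧ (∀ y ∈ bd, 0 ≤ m y) ∧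
    ∀ p : Collar bd, p.1.1 ∈ bd → (g p).1 = (p.1.1, p.1.2 + m p.1.1)

theorem IsPush.continuousOn {g : Collar bd → Collar bd} {m : E → ℝ} (h : IsPush bd g m) :
    ContinuousOn m bd := by
  have h1 : Continuous fun y => (g (Collar.base bd y)).1.2 := by
    have := h.1.comp Collar.continuous_base
    exact continuous_snd.comp (continuous_subtype_val.comp this)
  refine h1.continuousOn.congr fun y hy => ?_
  show m y = (g (Collar.base bd y)).1.2
  rw [h.2.2.2 (Collar.base bd y) hy]
  simp [Collar.base]

theorem IsPush.comp {g g' : Collar bd → Collar bd} {m m' : E → ℝ} (h : IsPush bd g m)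
    (h' : IsPush bd g' m') : IsPush bd (g' ∘ g) (m + m') := by
  refine ⟨h'.1.comp h.1, h'.2.1.comp h.2.1, fun y hy => add_nonneg (h.2.2.1 y hy) (h'.2.2.1 y hy),
    fun p hp => ?_⟩
  have h1 := h.2.2.2 p hp
  have h2 : (g p).1.1 = p.1.1 := by rw [h1]
  rw [Function.comp, h'.2.2.2 (g p) (by rwa [h2]), h1]
  simp [add_assoc]

theorem HalfSurface.exists_push_at [T2Space E] (h : HalfSurface E bd) {x : E} (hx : x ∈ bd) :
    ∃ g m, IsPush bd g m ∧ 0 < m x := by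
  classical
  obtain ⟨κ, hκ, h0, hb⟩ := h.boundary_chart x hx
  have hΨ := isOpenEmbedding_collarChart hκ hb
  let μ : ℝ → ℝ := fun a => max 0 (1 - |a|)
  let θ : ℝ → ℝ := fun b => max 0 (min 1 (1 - b))
  have hμ : ∀ a, 0 ≤ μ a := fun a => le_max_left _ _
  have hθ : Antitone θ := by
    intro a b hab
    exact max_le_max le_rfl (min_le_min le_rfl (by linarith))
  let f : ℂ → ℂ := fun z => z - ((μ z.re * θ z.im : ℝ) : ℂ) * Complex.I
  have hfc : Continuous f := by fun_prop
  have hfre : ∀ z, (f z).re = z.re := fun z => by simp [f]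
  have hfim : ∀ z, (f z).im = z.im - μ z.re * θ z.im := fun z => by
    simp only [f, Complex.sub_im, Complex.im_ofReal_mul, Complex.I_im, mul_one]
  have hfi : Function.Injective f := by
    intro z w hzw
    have h1 : z.re = w.re := by rw [← hfre z, hzw, hfre]
    have h2 : z.im - μ z.re * θ z.im = w.im - μ z.re * θ w.im := by
      rw [← hfim z, hzw, hfim, h1]
    refine Complex.ext h1 ?_
    rcases lt_trichotomy z.im w.im with h3 | h3 | h3
    · nlinarith [mul_le_mul_of_nonneg_left (hθ h3.le) (hμ z.re)]
    · exact h3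
    · nlinarith [mul_le_mul_of_nonneg_left (hθ h3.le) (hμ z.re)]
  let S : Set ℂ := {z | |z.re| ≤ 1 ∧ z.im ≤ 1}
  have hfS : ∀ z ∉ S, f z = z := by
    intro z hz
    have : μ z.re * θ z.im = 0 := by
      rw [mul_eq_zero]
      by_contra hne
      push Not at hne
      apply hz
      constructor
      · by_contra h1
        exact hne.1 (max_eq_left (by linarith))
      · by_contra h1
        exact hne.2 (max_eq_left ((min_le_right _ _).trans (by linarith)))
    simp only [f, this]
    simp
  have hcl : IsClosed (collarChart hb '' S) := by
    let K : Set UpperHalf := Subtype.val ⁻¹' ({z : ℂ | |z.re| ≤ 1 ∧ z.im ≤ 1} ∩ {z | 0 ≤ z.im})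
    have hK : IsCompact K := by
      have hcv : IsClosedEmbedding (Subtype.val : UpperHalf → ℂ) :=
        (isClosed_le continuous_const Complex.continuous_im).isClosedEmbedding_subtypeVal
      refine hcv.isCompact_preimage ?_
      refine Metric.isCompact_of_isClosed_isBounded ?_ ?_
      · refine (IsClosed.inter ?_ ?_).inter (isClosed_le continuous_const Complex.continuous_im)
        · exact isClosed_le (continuous_abs.comp Complex.continuous_re) continuous_const
        · exact isClosed_le Complex.continuous_im continuous_const
      · refine (isBounded_closedBall (x := (0 : ℂ)) (r := 2)).subset ?_
        rintro z ⟨⟨h1, h2⟩, h3⟩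
        rw [mem_closedBall_zero_iff]
        refine (Complex.norm_le_abs_re_add_abs_im z).trans ?_
        have : |z.im| ≤ 1 := abs_le.2 ⟨by linarith [show 0 ≤ z.im from h3], h2⟩
        linarith
    have : collarChart hb '' S = (fun p : Collar bd => p.1.1) ⁻¹' (κ '' K) := by
      ext p
      constructor
      · rintro ⟨z, hz, rfl⟩
        refine ⟨_, ⟨⟨hz.1, ?_⟩, ?_⟩, rfl⟩
        · exact max_le hz.2 zero_le_one
        · show 0 ≤ max z.im 0
          exact le_max_right _ _
      · rintro ⟨y, hy, hp⟩
        refine ⟨_, ⟨?_, ?_⟩, collarChart_eq hb p y hp⟩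
        · simpa using hy.1.1
        · have h2 := hy.1.2
          have h3 := p.2.1
          simp
          linarith
    rw [this]
    exact (hK.image hκ.continuous).isClosed.preimage (by fun_prop)
  let m : E → ℝ := fun y => if hy : y ∈ range κ then μ (hy.choose.1.re) else 0
  have hm : ∀ z, m (κ z) = μ z.1.re := by
    intro z
    have hy : κ z ∈ range κ := mem_range_self z
    simp only [m, dif_pos hy]
    rw [hκ.injective hy.choose_spec]
  have hm0 : ∀ y ∉ range κ, m y = 0 := fun y hy => dif_neg hy
  refine ⟨extendMap (collarChart hb) f, m, ⟨extendMap_continuous hΨ hfc hfS hcl,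
    extendMap_injective hΨ.injective hfi, ?_, ?_⟩, ?_⟩
  · intro y _
    by_cases hy : y ∈ range κ
    · obtain ⟨z, rfl⟩ := hy
      rw [hm]; exact hμ _
    · rw [hm0 y hy]
  · intro p hp
    by_cases hy : p.1.1 ∈ range κ
    · obtain ⟨y, hy⟩ := hy
      have him : y.1.im = 0 := (hb y).1 (by rwa [hy])
      have hp0 := p.2.1
      have e1 := collarChart_eq hb p y hy
      have e3 : 0 ≤ p.1.2 + μ y.1.re := add_nonneg hp0 (hμ _)
      let p' : Collar bd := ⟨(p.1.1, p.1.2 + μ y.1.re), e3, Or.inr hp⟩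
      have e2 := collarChart_eq hb p' y hy
      have e4 : f (y.1 - (p.1.2 : ℂ) * Complex.I) = y.1 - (p'.1.2 : ℂ) * Complex.I := by
        have : θ (y.1.im - p.1.2) = 1 := by
          simp only [θ]
          rw [min_eq_left (by linarith), max_eq_right zero_le_one]
        simp only [f, p']
        simp [this]
        ring
      have e5 : extendMap (collarChart hb) f p = p' := by
        conv_lhs => rw [← e1]
        rw [extendMap_apply hΨ.injective, e4, e2]
      rw [e5, ← hy, hm]
      exact Prod.ext hy.symm rfl
    · have : p ∉ collarChart hb '' S := by
        rintro ⟨z, -, rfl⟩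
        exact hy (mem_range_self _)
      rw [extendMap_of_notMem_image hΨ.injective hfS this]
      simp [hm0 _ hy]
  · rw [← h0, hm]
    simp [μ]

theorem HalfSurface.exists_push [T2Space E] [CompactSpace E] (h : HalfSurface E bd) :
    ∃ g m, IsPush bd g m ∧ ∀ y ∈ bd, 0 < m y := by
  have hK : IsCompact bd := h.isClosed.isCompact
  refine hK.induction_on (p := fun S => ∃ g m, IsPush bd g m ∧ ∀ y ∈ bd, y ∈ S → 0 < m y)
    ?_ ?_ ?_ ?_ |>.imp fun g hg => hg.imp fun m hm => ⟨hm.1, fun y hy => hm.2 y hy hy⟩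
  · exact ⟨id, 0, ⟨continuous_id, Function.injective_id, fun _ _ => le_rfl, fun p _ => by simp⟩,
      by simp⟩
  · rintro S T hST ⟨g, m, hg, hm⟩
    exact ⟨g, m, hg, fun y hy hyS => hm y hy (hST hyS)⟩
  · rintro S T ⟨g, m, hg, hm⟩ ⟨g', m', hg', hm'⟩
    refine ⟨_, _, hg.comp hg', ?_⟩
    rintro y hy (hyS | hyT)
    · exact add_pos_of_pos_of_nonneg (hm y hy hyS) (hg'.2.2.1 y hy)
    · exact add_pos_of_nonneg_of_pos (hg.2.2.1 y hy) (hm' y hy hyT)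
  · intro x hx
    obtain ⟨g, m, hg, hm⟩ := h.exists_push_at hx
    refine ⟨{y | 0 < m y}, (hg.continuousOn x hx).eventually (lt_mem_nhds hm), g, m, hg,
      fun y _ hy => hy⟩

/-- A compact surface embeds in its collared surface with boundary at height `4`. -/
theorem HalfSurface.exists_collar_embedding [T2Space E] [CompactSpace E] (h : HalfSurface E bd) :
    ∃ Θ : E → Collar bd, Continuous Θ ∧ Function.Injective Θ ∧
      (∀ y ∈ bd, (Θ y).1 = (y, 4)) ∧ ∀ x ∉ bd, (Θ x).1.2 < 4 := by
  obtain ⟨g, m, hg, hm⟩ := h.exists_push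
  obtain ⟨c, hc, hcm⟩ := h.isClosed.isCompact.exists_forall_le' hg.continuousOn hm
  let μ : E → ℝ := fun x => max c (g (Collar.base bd x)).1.2
  have hμ0 : ∀ x, 0 < μ x := fun x => lt_max_of_lt_left hc
  have hμc : Continuous μ := by
    have := hg.1.comp (Collar.continuous_base (bd := bd))
    exact continuous_const.max (continuous_snd.comp (continuous_subtype_val.comp this))
  have hgb : ∀ y ∈ bd, (g (Collar.base bd y)).1 = (y, m y) := fun y hy => by
    rw [hg.2.2.2 _ hy]; simp [Collar.base]
  have hμm : ∀ y ∈ bd, μ y = m y := fun y hy => by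
    simp only [μ]
    rw [hgb y hy]
    exact max_eq_right (hcm y hy)
  let ρ : Collar bd → Collar bd := fun p => ⟨(p.1.1, 4 * p.1.2 / μ p.1.1),
    div_nonneg (mul_nonneg (by norm_num) p.2.1) (hμ0 _).le, by
      rcases p.2.2 with h | h
      · left; simp [h]
      · right; exact h⟩
  have hρc : Continuous ρ := by
    refine Continuous.subtype_mk (Continuous.prodMk (by fun_prop) ?_) _
    exact Continuous.div (by fun_prop) (hμc.comp (by fun_prop)) fun p => (hμ0 _).ne'
  have hρi : Function.Injective ρ := by
    intro p q hpq
    have h1 : p.1.1 = q.1.1 := congrArg (fun p => p.1.1) hpq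
    have h2 : 4 * p.1.2 / μ p.1.1 = 4 * q.1.2 / μ q.1.1 := congrArg (fun p => p.1.2) hpq
    rw [h1, div_left_inj' (hμ0 _).ne'] at h2
    exact Subtype.ext (Prod.ext h1 (by linarith))
  refine ⟨fun x => ρ (g (Collar.base bd x)), hρc.comp (hg.1.comp Collar.continuous_base),
    fun x y hxy => ?_, ?_, ?_⟩
  · exact congrArg (fun p => p.1.1) (hg.2.1 (hρi hxy))
  · intro y hy
    simp only [ρ, hgb y hy]
    rw [hμm y hy, mul_div_cancel_right₀ _ (hm y hy).ne']
  · intro x hx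
    by_contra hge
    set q := g (Collar.base bd x) with hq
    have h1 : 4 ≤ 4 * q.1.2 / μ q.1.1 := not_lt.1 hge
    rw [le_div_iff₀ (hμ0 _)] at h1
    have h2 : μ q.1.1 ≤ q.1.2 := by linarith
    have hqb : q.1.1 ∈ bd := q.2.2.resolve_left (by linarith [hμ0 q.1.1])
    rw [hμm _ hqb] at h2
    let p : Collar bd := ⟨(q.1.1, q.1.2 - m q.1.1), sub_nonneg.2 h2, Or.inr hqb⟩
    have h3 : g p = q := Subtype.ext (by rw [hg.2.2.2 p hqb]; simp [p])
    have h4 := hg.2.1 (h3.trans hq)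
    have h5 : q.1.1 = x := congrArg (fun p => p.1.1) h4
    exact hx (h5 ▸ hqb)

end Collar

/-- A surface `V` with finitely many cylindrical ends `c b : Circle × (0, ∞) → V`, on which the
height `ht` is the second coordinate. -/
structure Cuffed {V : Type*} [TopologicalSpace V] {β : Type*} (ht : V → ℝ)
    (c : β → Circle → ℝ → V) : Prop where
  locallyPlane : LocallyPlane V
  continuous_ht : Continuous ht
  isCompact_le : ∀ R, IsCompact {x | ht x ≤ R}
  continuous_c : ∀ b, Continuous fun p : Circle × ℝ => c b p.1 p.2
  ht_c : ∀ b w s, ht (c b w s) = max s 0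
  inj : ∀ b w s b' w' s', 0 < s → c b w s = c b' w' s' → b = b' ∧ w = w' ∧ s = s'
  surj : ∀ x, 0 < ht x → ∃ b w, c b w (ht x) = x
  isOpenEmbedding_c : ∀ b, IsOpenEmbedding fun q : Circle × ℝ => c b q.1 (Real.exp q.2)
  isPreconnected_lt : IsPreconnected {x | ht x < 3}

theorem isOpenEmbedding_tail {E : Type*} [TopologicalSpace E] (bd : Set E) :
    IsOpenEmbedding fun q : bd × ℝ => Collar.tail q.1.2 (Real.exp q.2) := by
  have hval : ∀ q : bd × ℝ, (Collar.tail q.1.2 (Real.exp q.2)).1 = ((q.1 : E), Real.exp q.2) :=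
    fun q => Prod.ext rfl (max_eq_left (Real.exp_pos _).le)
  have hc : Continuous fun q : bd × ℝ => Collar.tail q.1.2 (Real.exp q.2) := by
    unfold Collar.tail
    fun_prop
  refine ⟨?_, ?_⟩
  · refine IsEmbedding.of_comp hc continuous_subtype_val ?_
    have h1 : IsEmbedding (Prod.map (Subtype.val : bd → E) Real.exp) :=
      IsEmbedding.subtypeVal.prodMap Real.isOpenEmbedding_exp.isEmbedding
    convert h1 using 1
    funext q
    exact hval q
  · have : (range fun q : bd × ℝ => Collar.tail q.1.2 (Real.exp q.2))
        = {p : Collar bd | 0 < p.1.2} := by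
      ext p
      constructor
      · rintro ⟨q, rfl⟩
        show 0 < (Collar.tail q.1.2 (Real.exp q.2)).1.2
        rw [hval]
        exact Real.exp_pos _
      · intro hp
        have hp' : 0 < p.1.2 := hp
        refine ⟨(⟨p.1.1, p.2.2.resolve_left hp'.ne'⟩, Real.log p.1.2), Subtype.ext ?_⟩
        rw [hval]
        exact Prod.ext rfl (Real.exp_log hp')
    rw [this]
    exact isOpen_lt continuous_const (by fun_prop)

theorem HalfSurface.cuffed {E : Type*} [TopologicalSpace E] [T2Space E] [CompactSpace E]
    [ConnectedSpace E] {bd : Set E} (h : HalfSurface E bd) {β : Type*} [Finite β]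
    (Ω : β → Circle → bd) (hΩ : ∀ b, Continuous (Ω b)) (hΩs : ∀ x, ∃ b w, Ω b w = x)
    (hΩi : ∀ b w b' w', Ω b w = Ω b' w' → b = b' ∧ w = w') :
    Cuffed (fun p : Collar bd => p.1.2) fun b w s => Collar.tail (Ω b w).2 s where
  locallyPlane := h.locallyPlane_collar
  continuous_ht := by fun_prop
  isCompact_le R := by
    have hcl : IsClosed {p : E × ℝ | 0 ≤ p.2 ∧ (p.2 = 0 ∨ p.1 ∈ bd)} :=
      (isClosed_le continuous_const continuous_snd).inter
        ((isClosed_eq continuous_snd continuous_const).union (h.isClosed.preimage continuous_fst))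
    have hK : IsCompact ((univ : Set E) ×ˢ Icc (0 : ℝ) R) := isCompact_univ.prod isCompact_Icc
    have he : {p : Collar bd | p.1.2 ≤ R} = Subtype.val ⁻¹' ((univ : Set E) ×ˢ Icc (0 : ℝ) R) := by
      ext p
      exact ⟨fun hp => ⟨mem_univ _, p.2.1, hp⟩, fun hp => hp.2.2⟩
    rw [he]
    exact hcl.isClosedEmbedding_subtypeVal.isCompact_preimage hK
  continuous_c b := by
    have := hΩ b
    unfold Collar.tail
    fun_prop
  ht_c b w s := rfl
  inj b w s b' w' s' hs hc := by
    have h1 : (Ω b w : E) = Ω b' w' := congrArg (fun p => p.1.1) hc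
    have h2 : max s 0 = max s' 0 := congrArg (fun p => p.1.2) hc
    obtain ⟨h3, h4⟩ := hΩi _ _ _ _ (Subtype.ext h1)
    refine ⟨h3, h4, ?_⟩
    rw [max_eq_left hs.le] at h2
    rcases max_choice s' 0 with h5 | h5 <;> linarith
  surj p hp := by
    obtain ⟨b, w, hb⟩ := hΩs ⟨p.1.1, p.2.2.resolve_left hp.ne'⟩
    exact ⟨b, w, Subtype.ext (Prod.ext (congrArg Subtype.val hb) (max_eq_left hp.le))⟩
  isOpenEmbedding_c b := by
    let T : (Σ _ : β, Circle) → bd := fun q => Ω q.1 q.2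
    have hT : Continuous T := continuous_sigma hΩ
    have hTb : Function.Bijective T := by
      constructor
      · rintro ⟨b, w⟩ ⟨b', w'⟩ hq
        obtain ⟨rfl, rfl⟩ := hΩi _ _ _ _ hq
        rfl
      · intro x
        obtain ⟨b, w, hb⟩ := hΩs x
        exact ⟨⟨b, w⟩, hb⟩
    have hTo : IsOpenEmbedding T :=
      (isHomeomorph_iff_continuous_bijective.2 ⟨hT, hTb⟩).isOpenEmbedding
    have hb : IsOpenEmbedding (Ω b) := hTo.comp (IsOpenEmbedding.sigmaMk (i := b))
    exact (isOpenEmbedding_tail bd).comp (hb.prodMap IsOpenEmbedding.id)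
  isPreconnected_lt := by
    obtain ⟨x₀⟩ : Nonempty E := inferInstance
    refine isPreconnected_of_forall (Collar.base bd x₀) fun p hp => ?_
    have hr : IsPreconnected (range (Collar.base bd)) :=
      isPreconnected_range Collar.continuous_base
    have hrs : range (Collar.base bd) ⊆ {p : Collar bd | p.1.2 < 3} := by
      rintro _ ⟨x, rfl⟩
      show (0 : ℝ) < 3
      norm_num
    rcases p.2.2 with h0 | hb
    · exact ⟨_, hrs, mem_range_self _, ⟨p.1.1, Subtype.ext (Prod.ext rfl h0.symm)⟩, hr⟩
    · have hseg : IsPreconnected (Collar.tail hb '' Icc 0 p.1.2) := by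
        refine isPreconnected_Icc.image _ (Continuous.continuousOn ?_)
        unfold Collar.tail
        fun_prop
      refine ⟨range (Collar.base bd) ∪ Collar.tail hb '' Icc 0 p.1.2, union_subset hrs ?_,
        Or.inl (mem_range_self _), Or.inr ⟨p.1.2, ⟨p.2.1, le_rfl⟩,
          Subtype.ext (Prod.ext rfl (max_eq_left p.2.1))⟩, ?_⟩
      · rintro _ ⟨s, hs, rfl⟩
        exact max_lt (lt_of_le_of_lt hs.2 hp) (by norm_num)
      · refine hr.union (Collar.base bd p.1.1) (mem_range_self _) ⟨0, ⟨le_rfl, p.2.1⟩, ?_⟩ hseg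
        exact Subtype.ext (Prod.ext rfl (max_self _))

/-- The arcs `exp (x i + η u)`, `|u| ≤ 1`, `i < n`, are disjoint and avoid `Z`. -/
def IsGaps (Z : Set Circle) (n : ℕ) (x : ℕ → ℝ) (η : ℝ) : Prop :=
  0 < η ∧ (∀ i < n, ∀ j < n, ∀ u ∈ Icc (-1 : ℝ) 1, ∀ v ∈ Icc (-1 : ℝ) 1,
    Circle.exp (x i + η * u) = Circle.exp (x j + η * v) → i = j ∧ u = v) ∧
  ∀ i < n, ∀ u ∈ Icc (-1 : ℝ) 1, Circle.exp (x i + η * u) ∉ Z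

/-- A closed set with dense complement is avoided by finitely many short arcs cutting the circle
into arcs subordinate to a given open cover. -/
theorem exists_gaps {Z O₁ O₂ : Set Circle} (hZ : IsClosed Z) (hZd : Dense Zᶜ) (h₁ : IsOpen O₁)
    (h₂ : IsOpen O₂) (hO : ∀ w, w ∈ O₁ ∨ w ∈ O₂) : ∃ n x η, IsGaps Z n x η ∧
      (∀ i < n, x (i + 1) - η - (x i + η) < 2 * Real.pi) ∧
      (∀ i < n, (∀ θ ∈ Icc (x i + η) (x (i + 1) - η), Circle.exp θ ∈ O₁) ∨
        ∀ θ ∈ Icc (x i + η) (x (i + 1) - η), Circle.exp θ ∈ O₂) ∧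
      (∀ i < n, ∀ j < n, ∀ θ ∈ Icc (x i + η) (x (i + 1) - η),
        ∀ θ' ∈ Icc (x j + η) (x (j + 1) - η), Circle.exp θ = Circle.exp θ' → i = j) ∧
      (∀ w, (∃ i < n, ∃ u ∈ Ioo (-1 : ℝ) 1, w = Circle.exp (x i + η * u)) ∨
        ∃ i < n, ∃ θ ∈ Icc (x i + η) (x (i + 1) - η), w = Circle.exp θ) := by
  have hπ := Real.pi_pos
  obtain ⟨δ, hδ, hleb⟩ := lebesgue_number_lemma_of_metric
    (s := Icc 0 (4 * Real.pi)) (c := fun b : Bool => Circle.exp ⁻¹' (if b then O₁ else O₂))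
    isCompact_Icc
    (fun b => by
      cases b
      exacts [h₂.preimage Circle.exp.continuous, h₁.preimage Circle.exp.continuous])
    (fun θ _ => by
      rcases hO (Circle.exp θ) with h | h
      · exact mem_iUnion.2 ⟨true, h⟩
      · exact mem_iUnion.2 ⟨false, h⟩)
  obtain ⟨n, hn⟩ := exists_nat_gt (max 1 (4 * Real.pi / δ))
  have hn1 : (1 : ℝ) < n := (le_max_left _ _).trans_lt hn
  have hn0 : (0 : ℝ) < n := by linarith
  obtain ⟨d, hd⟩ : ∃ d : ℝ, d = 2 * Real.pi / n := ⟨_, rfl⟩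
  have hd0 : 0 < d := by rw [hd]; positivity
  have hnd : n * d = 2 * Real.pi := by rw [hd]; field_simp
  have hdδ : 2 * d < δ := by
    have h3 := (le_max_right _ _).trans_lt hn
    rw [div_lt_iff₀ hδ] at h3
    have : n * (2 * d) < n * δ := by linarith
    exact lt_of_mul_lt_mul_left this hn0.le
  have hdense : Dense (Circle.exp ⁻¹' Zᶜ) := hZd.preimage isLocalHomeomorph_circleExp.isOpenMap
  have hx' : ∀ i : ℕ, ∃ y ∈ Circle.exp ⁻¹' Zᶜ, d * (i + 1 / 4) < y ∧ y < d * (i + 3 / 4) := by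
    intro i
    obtain ⟨y, hy, hyZ⟩ := hdense.exists_mem_open (isOpen_Ioo (a := d * (i + 1 / 4))
      (b := d * (i + 3 / 4))) (nonempty_Ioo.2 (by nlinarith))
    exact ⟨y, hy, hyZ⟩
  choose x' hx'Z hx'l hx'u using hx'
  let x : ℕ → ℝ := fun i => if i = n then x' 0 + 2 * Real.pi else x' i
  have hxl : ∀ i, d * (i + 1 / 4) < x i := by
    intro i
    by_cases h : i = n
    · simp only [x, h, if_true]
      have := hx'l 0
      push_cast at this
      nlinarith
    · simp only [x, if_neg h]; exact hx'l i
  have hxu : ∀ i, x i < d * (i + 3 / 4) := by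
    intro i
    by_cases h : i = n
    · simp only [x, h, if_true]
      have := hx'u 0
      push_cast at this
      nlinarith
    · simp only [x, if_neg h]; exact hx'u i
  have hxlt : ∀ i < n, x i = x' i := fun i hi => if_neg hi.ne
  have hn0' : 0 < n := by exact_mod_cast hn0
  have hxn : x n = x 0 + 2 * Real.pi := by rw [hxlt 0 hn0']; exact if_pos rfl
  have hmono : ∀ i j, i < j → x i + d / 2 < x j := by
    intro i j hij
    have h3 : (i : ℝ) + 1 ≤ j := by exact_mod_cast hij
    have := hxl j
    have := hxu i
    nlinarith
  obtain ⟨η, hηZ, hη0, hηd⟩ : ∃ η, (∀ i < n, ∀ u ∈ Icc (-1 : ℝ) 1, Circle.exp (x i + η * u) ∉ Z) ∧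
      0 < η ∧ η < d / 8 := by
    have h3 : ∀ i ∈ Finset.range n, ∀ᶠ η in 𝓝[>] (0 : ℝ), ∀ u ∈ Icc (-1 : ℝ) 1,
        Circle.exp (x i + η * u) ∉ Z := by
      intro i hi
      apply nhdsWithin_le_nhds
      refine isCompact_Icc.eventually_forall_of_forall_eventually fun u _ => ?_
      have hc : Continuous fun z : ℝ × ℝ => Circle.exp (x i + z.1 * z.2) :=
        Circle.exp.continuous.comp (by fun_prop)
      refine (hZ.isOpen_compl.preimage hc).mem_nhds ?_
      show Circle.exp (x i + 0 * u) ∉ Z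
      rw [zero_mul, add_zero, hxlt i (Finset.mem_range.1 hi)]
      exact hx'Z i
    have h4 := (Filter.eventually_all_finset _).2 h3
    have h5 : ∀ᶠ η in 𝓝[>] (0 : ℝ), η ∈ Ioo 0 (d / 8) := Ioo_mem_nhdsGT (by linarith)
    obtain ⟨η, h6, h7⟩ := (h4.and h5).exists
    exact ⟨η, fun i hi => h6 i (Finset.mem_range.2 hi), h7⟩
  have hle : ∀ i j, i ≤ j → x i ≤ x j := by
    intro i j hij
    rcases hij.eq_or_lt with rfl | h
    · exact le_rfl
    · linarith [hmono i j h]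
  refine ⟨n, x, η, ⟨hη0, ?_, hηZ⟩, ?_, ?_, ?_, ?_⟩
  · intro i hi j hj u hu v hv huv
    have hw : ∀ i < n, ∀ u ∈ Icc (-1 : ℝ) 1,
        x i + η * u ∈ Ico (x 0 - η) (x 0 - η + 2 * Real.pi) := by
      intro i hi u hu
      have h3 := hmono i n hi
      have h4 := hle 0 i (Nat.zero_le _)
      constructor <;> nlinarith [hu.1, hu.2]
    have h3 := Circle.exp_injOn_Ico (by linarith) (hw i hi u hu) (hw j hj v hv) huv
    have h4 : i = j := by
      rcases lt_trichotomy i j with h | h | h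
      · nlinarith [hmono i j h, hu.1, hu.2, hv.1, hv.2]
      · exact h
      · nlinarith [hmono j i h, hu.1, hu.2, hv.1, hv.2]
    subst h4
    exact ⟨rfl, by nlinarith⟩
  · intro i hi
    have h3 := hle 0 i (Nat.zero_le _)
    have h4 := hle (i + 1) n hi
    linarith
  · intro i hi
    have h3 : x i ∈ Icc 0 (4 * Real.pi) := by
      have := hxl i
      have h4 := hle i n hi.le
      have h5 := hxu 0
      push_cast at h5
      have h6 : (0 : ℝ) ≤ i := Nat.cast_nonneg _
      constructor
      · nlinarith
      · nlinarith
    obtain ⟨b, hb⟩ := hleb _ h3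
    have h4 : Icc (x i + η) (x (i + 1) - η) ⊆ ball (x i) δ := by
      intro θ hθ
      have h5 := hxl i
      have h6 := hxu (i + 1)
      push_cast at h6
      rw [mem_ball, Real.dist_eq, abs_lt]
      constructor <;> linarith [hθ.1, hθ.2]
    cases b
    · exact Or.inr fun θ hθ => hb (h4 hθ)
    · exact Or.inl fun θ hθ => hb (h4 hθ)
  · intro i hi j hj θ hθ θ' hθ' he
    have hw : ∀ i < n, ∀ θ ∈ Icc (x i + η) (x (i + 1) - η), θ ∈ Ico (x 0) (x 0 + 2 * Real.pi) := by
      intro i hi θ hθ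
      have h3 := hle 0 i (Nat.zero_le _)
      have h4 := hle (i + 1) n hi
      constructor <;> linarith [hθ.1, hθ.2]
    have h3 := Circle.exp_injOn_Ico (by linarith) (hw i hi θ hθ) (hw j hj θ' hθ') he
    rcases lt_trichotomy i j with h | h | h
    · linarith [hle (i + 1) j h, hθ.2, hθ'.1]
    · exact h
    · linarith [hle (j + 1) i h, hθ.1, hθ'.2]
  · intro w
    obtain ⟨θ₀, rfl⟩ := Circle.exp_surjective w
    obtain ⟨θ, hθ, hθe⟩ := Circle.periodic_exp.exists_mem_Ico Real.two_pi_pos θ₀ (x 0)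
    rw [hθe]
    have hex : ∃ j, θ < x j := ⟨n, by rw [hxn]; exact hθ.2⟩
    classical
    obtain ⟨i, hi⟩ : ∃ i, Nat.find hex = i + 1 := Nat.exists_eq_succ_of_ne_zero fun h0 => by
      have := Nat.find_spec hex
      rw [h0] at this
      linarith [hθ.1]
    have h3 : θ < x (i + 1) := hi ▸ Nat.find_spec hex
    have h4 : x i ≤ θ := not_lt.1 (Nat.find_min hex (by omega))
    have h5 : i < n := by
      have : i + 1 ≤ n := hi ▸ Nat.find_min' hex (by rw [hxn]; exact hθ.2)
      omega
    by_cases h6 : θ < x i + η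
    · refine Or.inl ⟨i, h5, (θ - x i) / η, ⟨?_, ?_⟩, ?_⟩
      · rw [lt_div_iff₀ hη0]; linarith
      · rw [div_lt_iff₀ hη0]; linarith
      · congr 1; field_simp; ring
    by_cases h7 : x (i + 1) - η < θ
    · left
      have h8 : -1 < (θ - x (i + 1)) / η ∧ (θ - x (i + 1)) / η < 1 := by
        constructor
        · rw [lt_div_iff₀ hη0]; linarith
        · rw [div_lt_iff₀ hη0]; linarith
      have h9 : Circle.exp θ = Circle.exp (x (i + 1) + η * ((θ - x (i + 1)) / η)) := by
        congr 1; field_simp; ring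
      by_cases hin : i + 1 = n
      · refine ⟨0, hn0', _, h8, ?_⟩
        rw [h9, hin, hxn, ← Circle.exp_add_two_pi (x 0 + _)]
        congr 1; ring
      · exact ⟨i + 1, by omega, _, h8, h9⟩
    · exact Or.inr ⟨i, h5, θ, ⟨by linarith, by linarith⟩, rfl⟩

section

variable {V : Type*} [TopologicalSpace V]

/-- All of a closed curve except finitely many short arcs can be swallowed by a disc. -/
theorem Engulfed.union_curve [T2Space V] (hV : LocallyPlane V) {U K : Set V} (hUo : IsOpen U)
    (hUc : IsPreconnected U) (hK : IsCompact K) (h : Engulfed U K) {τ : Circle × ℝ → V}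
    (hτ : IsOpenEmbedding τ) (hτU : range τ ⊆ U) {Z : Set Circle} (hZ : IsClosed Z)
    (hZd : Dense Zᶜ) : ∃ K', IsCompact K' ∧ K ⊆ K' ∧ Engulfed U K' ∧ ∃ n x η, IsGaps Z n x η ∧
      ∀ w, (∃ i < n, ∃ u ∈ Ioo (-1 : ℝ) 1, w = Circle.exp (x i + η * u)) ∨ τ (w, 0) ∈ K' := by
  classical
  obtain ⟨δ, hδ, hδU, hKδ⟩ := h
  have hτ0 : Continuous fun w : Circle => τ (w, 0) := hτ.continuous.comp (by fun_prop)
  obtain ⟨n, x, η, hg, hlen, hsub, hdisj, hcov⟩ := exists_gaps hZ hZd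
    (hδ.isOpen_range.preimage hτ0) (hK.isClosed.isOpen_compl.preimage hτ0) fun w => by
      by_cases hw : τ (w, 0) ∈ K
      · exact Or.inl (hKδ hw)
      · exact Or.inr hw
  let A : ℕ → Set V := fun i => (fun θ => τ (Circle.exp θ, 0)) '' Icc (x i + η) (x (i + 1) - η)
  have hA : ∀ i, IsCompact (A i) := fun i =>
    isCompact_Icc.image (hτ0.comp Circle.exp.continuous)
  let G : Finset ℕ := (Finset.range n).filter fun i => A i ⊆ range δ
  have hind : ∀ m ≤ n, Engulfed U (K ∪ (⋃ i ∈ G, A i) ∪ ⋃ i ∈ Finset.range m, A i) := by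
    intro m
    induction m with
    | zero =>
      intro _
      refine ⟨δ, hδ, hδU, ?_⟩
      simp only [Finset.range_zero, Finset.notMem_empty, iUnion_of_empty, iUnion_empty, union_empty]
      refine union_subset hKδ (iUnion₂_subset fun i hi => (Finset.mem_filter.1 hi).2)
    | succ m ih =>
      intro hm
      have h1 := ih (by omega)
      have hc : IsCompact (K ∪ (⋃ i ∈ G, A i) ∪ ⋃ i ∈ Finset.range m, A i) :=
        (hK.union (G.isCompact_biUnion fun i _ => hA i)).union
          ((Finset.range m).isCompact_biUnion fun i _ => hA i)
      have he : K ∪ (⋃ i ∈ G, A i) ∪ ⋃ i ∈ Finset.range (m + 1), A i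
          = (K ∪ (⋃ i ∈ G, A i) ∪ ⋃ i ∈ Finset.range m, A i) ∪ A m := by
        rw [Finset.range_add_one, Finset.set_biUnion_insert]
        ac_rfl
      rw [he]
      by_cases hmG : m ∈ G
      · refine h1.mono (union_subset Subset.rfl ?_)
        refine Subset.trans ?_ subset_union_left
        exact Subset.trans (subset_biUnion_of_mem (u := A) hmG) subset_union_right
      · refine h1.union_arc hV hUo hUc hc.isClosed hτ hτU (hlen m hm) fun θ hθ hmem => ?_
        have hO : ∀ θ ∈ Icc (x m + η) (x (m + 1) - η), τ (Circle.exp θ, 0) ∉ K := by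
          rcases hsub m hm with h2 | h2
          · refine absurd (Finset.mem_filter.2 ⟨Finset.mem_range.2 hm, ?_⟩) hmG
            rintro _ ⟨θ, hθ, rfl⟩
            exact h2 θ hθ
          · exact h2
        have hAj : ∀ j < n, τ (Circle.exp θ, 0) ∈ A j → j = m := by
          rintro j hj ⟨θ', hθ', he'⟩
          have h3 : Circle.exp θ' = Circle.exp θ := congrArg Prod.fst (hτ.injective he')
          exact hdisj j hj m hm θ' hθ' θ hθ h3
        rcases hmem with (hmem | hmem) | hmem
        · exact hO θ hθ hmem
        · obtain ⟨j, hj, hmem⟩ := mem_iUnion₂.1 hmem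
          have := hAj j (Finset.mem_range.1 (Finset.mem_filter.1 hj).1) hmem
          exact hmG (this ▸ hj)
        · obtain ⟨j, hj, hmem⟩ := mem_iUnion₂.1 hmem
          have h4 := Finset.mem_range.1 hj
          have := hAj j (by omega) hmem
          omega
  refine ⟨_, ?_, ?_, hind n le_rfl, n, x, η, hg, fun w => ?_⟩
  · exact (hK.union (G.isCompact_biUnion fun i _ => hA i)).union
      ((Finset.range n).isCompact_biUnion fun i _ => hA i)
  · exact Subset.trans subset_union_left subset_union_left
  · refine (hcov w).imp_right ?_
    rintro ⟨i, hi, θ, hθ, rfl⟩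
    exact Or.inr (mem_iUnion₂.2 ⟨i, Finset.mem_range.2 hi, θ, hθ, rfl⟩)

/-- All of a finite system of closed curves except finitely many short arcs can be swallowed by a
disc. -/
theorem Engulfed.exists_disc [T2Space V] (hV : LocallyPlane V) {U K : Set V} (hUo : IsOpen U)
    (hUc : IsPreconnected U) (hK : IsCompact K) (h : Engulfed U K) {α : Type*} [Finite α]
    {τ : α → Circle × ℝ → V} (hτ : ∀ k, IsOpenEmbedding (τ k)) (hτU : ∀ k, range (τ k) ⊆ U)
    {Z : α → Set Circle} (hZ : ∀ k, IsClosed (Z k)) (hZd : ∀ k, Dense (Z k)ᶜ) :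
    ∃ δ : ℂ → V, IsOpenEmbedding δ ∧ range δ ⊆ U ∧ K ⊆ δ '' ball 0 1 ∧
      ∃ (n : α → ℕ) (x : α → ℕ → ℝ) (η : α → ℝ), (∀ k, IsGaps (Z k) (n k) (x k) (η k)) ∧
      ∀ k w, (∃ i < n k, ∃ u ∈ Ioo (-1 : ℝ) 1, w = Circle.exp (x k i + η k * u)) ∨
        τ k (w, 0) ∈ δ '' ball 0 1 := by
  classical
  have := Fintype.ofFinite α
  have key : ∀ S : Finset α, ∃ K', IsCompact K' ∧ K ⊆ K' ∧ Engulfed U K' ∧ ∀ k ∈ S, ∃ n x η,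
      IsGaps (Z k) n x η ∧ ∀ w, (∃ i < n, ∃ u ∈ Ioo (-1 : ℝ) 1, w = Circle.exp (x i + η * u)) ∨
        τ k (w, 0) ∈ K' := by
    intro S
    induction S using Finset.induction_on with
    | empty => exact ⟨K, hK, Subset.rfl, h, by simp⟩
    | insert k S _ ih =>
      obtain ⟨K', hK', hKK', h', hS⟩ := ih
      obtain ⟨K'', hK'', hKK'', h'', hk⟩ :=
        h'.union_curve hV hUo hUc hK' (hτ k) (hτU k) (hZ k) (hZd k)
      refine ⟨K'', hK'', hKK'.trans hKK'', h'', fun l hl => ?_⟩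
      rcases Finset.mem_insert.1 hl with rfl | hl
      · exact hk
      · obtain ⟨n, x, η, hg, hc⟩ := hS l hl
        exact ⟨n, x, η, hg, fun w => (hc w).imp_right fun hw => hKK'' hw⟩
  obtain ⟨K', hK', hKK', ⟨δ, hδ, hδU, hKδ⟩, hS⟩ := key Finset.univ
  choose n x η hg hc using fun k => hS k (Finset.mem_univ k)
  obtain ⟨R, hR⟩ := (hδ.isInducing.isCompact_preimage' hK' hKδ).isBounded.subset_ball (0 : ℂ)
  obtain ⟨ρ, hρR, hρ0⟩ : ∃ ρ : ℝ, R ≤ ρ ∧ 0 < ρ := ⟨max R 1, le_max_left _ _, by positivity⟩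
  have hρc : (ρ : ℂ) ≠ 0 := by exact_mod_cast hρ0.ne'
  have hK'' : K' ⊆ (δ ∘ fun z => (ρ : ℂ) * z) '' ball 0 1 := by
    intro y hy
    obtain ⟨z, rfl⟩ := hKδ hy
    have hz := mem_ball_zero_iff.1 (hR hy)
    refine ⟨(ρ : ℂ)⁻¹ * z, ?_, ?_⟩
    · rw [mem_ball_zero_iff, norm_mul, norm_inv, Complex.norm_real, Real.norm_eq_abs,
        abs_of_pos hρ0, inv_mul_lt_iff₀ hρ0]
      linarith
    · simp only [Function.comp]
      rw [mul_inv_cancel_left₀ hρc]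
  refine ⟨δ ∘ fun z => (ρ : ℂ) * z, hδ.comp (Homeomorph.mulLeft₀ _ hρc).isOpenEmbedding,
    (range_comp_subset_range _ _).trans hδU, hKK'.trans hK'', n, x, η, hg, fun k w => ?_⟩
  exact (hc k w).imp_right fun h => hK'' h

/-- A nontrivial connected subset of the circle has nonempty interior. -/
theorem nonempty_interior_of_isPreconnected {S : Set Circle} (hS : IsPreconnected S)
    (hn : S.Nontrivial) : (interior S).Nonempty := by
  by_cases hu : S = univ
  · rw [hu, interior_univ]; exact univ_nonempty
  obtain ⟨p, hp⟩ := (ne_univ_iff_exists_notMem S).1 hu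
  let a : Circle → ℝ := fun w => Complex.arg (-(w / p : Circle) : ℂ)
  have ha : ContinuousOn a S := by
    intro w hw
    have h1 : (-(w / p : Circle) : ℂ) ∈ Complex.slitPlane := by
      rw [Complex.mem_slitPlane_iff_not_le_zero]
      intro h2
      have h3 := Complex.le_def.1 h2
      have h4 : (0 : ℝ) ≤ ((w / p : Circle) : ℂ).re := by simpa using h3.1
      have h5 : ((w / p : Circle) : ℂ).im = 0 := by simpa using h3.2
      have h6 := Circle.normSq_coe (w / p)
      rw [Complex.normSq_apply, h5] at h6
      have h7 : ((w / p : Circle) : ℂ).re = 1 := by nlinarith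
      have h8 : w / p = 1 := Circle.ext (Complex.ext (by simpa using h7) (by simpa using h5))
      exact hp ((div_eq_one.1 h8) ▸ hw)
    have h2 : ContinuousAt (fun w : Circle => (-(w / p : Circle) : ℂ)) w := by fun_prop
    exact (ContinuousAt.comp (f := fun w : Circle => (-(w / p : Circle) : ℂ))
      (Complex.continuousAt_arg h1) h2).continuousWithinAt
  have hexp : ∀ w, w = Circle.exp (a w + Real.pi) * p := by
    intro w
    have h1 : ((Circle.exp (a w + Real.pi) : Circle) : ℂ) = (w / p : Circle) := by
      rw [Circle.coe_exp]
      push_cast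
      rw [add_mul, Complex.exp_add, Complex.exp_pi_mul_I]
      have h2 := Complex.norm_mul_exp_arg_mul_I (-(w / p : Circle) : ℂ)
      rw [norm_neg, Circle.norm_coe] at h2
      rw [show ((a w : ℝ) : ℂ) = (Complex.arg (-(w / p : Circle) : ℂ) : ℂ) from rfl]
      rw [Complex.ofReal_one, one_mul] at h2
      rw [h2, mul_neg_one, neg_neg]
      exact (Circle.coe_div w p).symm
    rw [Circle.ext h1, div_mul_cancel]
  obtain ⟨w, hw, w', hw', hne⟩ := hn
  have key : ∀ w ∈ S, ∀ w' ∈ S, a w < a w' → (interior S).Nonempty := by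
    intro w hw w' hw' hlt
    have hI : Icc (a w) (a w') ⊆ a '' S := hS.intermediate_value hw hw' ha
    let g : ℝ → Circle := fun t => Circle.exp (t + Real.pi) * p
    have hg : IsOpenMap g := (Homeomorph.mulRight p).isOpenMap.comp
      (isLocalHomeomorph_circleExp.isOpenMap.comp (Homeomorph.addRight Real.pi).isOpenMap)
    have hsub : g '' Ioo (a w) (a w') ⊆ S := by
      rintro _ ⟨t, ht, rfl⟩
      obtain ⟨v, hv, rfl⟩ := hI (Ioo_subset_Icc_self ht)
      simp only [g]
      rw [← hexp]
      exact hv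
    exact ((nonempty_Ioo.2 hlt).image g).mono (interior_maximal hsub (hg _ isOpen_Ioo))
  rcases lt_trichotomy (a w) (a w') with h | h | h
  · exact key w hw w' hw' h
  · exact absurd (by rw [hexp w, hexp w', h]) hne
  · exact key w' hw' w hw h

/-- If a closed curve meets another one in a set with empty interior, the converse holds too. -/
theorem interior_eq_empty_symm [T2Space V] {σ σ' : Circle → V} (hσ : Continuous σ)
    (hσi : Function.Injective σ) (hσ' : Continuous σ') (hσi' : Function.Injective σ')
    (h : interior {w | σ w ∈ range σ'} = ∅) : interior {w | σ' w ∈ range σ} = ∅ := by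
  by_contra hne
  obtain ⟨w, hw⟩ := nonempty_iff_ne_empty.2 hne
  obtain ⟨θ, rfl⟩ := Circle.exp_surjective w
  have hO : IsOpen (Circle.exp ⁻¹' interior {w | σ' w ∈ range σ}) :=
    isOpen_interior.preimage Circle.exp.continuous
  obtain ⟨e, he, hball⟩ := Metric.isOpen_iff.1 hO θ hw
  obtain ⟨e', he'0, he', he'π⟩ : ∃ e', 0 < e' ∧ e' < e ∧ e' < Real.pi :=
    ⟨min e Real.pi / 2, by have := Real.pi_pos; positivity,
      by have := min_le_left e Real.pi; linarith [lt_min he Real.pi_pos],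
      by have := min_le_right e Real.pi; linarith [lt_min he Real.pi_pos]⟩
  have hsub : ∀ t ∈ Icc θ (θ + e'), σ' (Circle.exp t) ∈ range σ := by
    intro t ht
    have h1 : Circle.exp t ∈ interior {w | σ' w ∈ range σ} := by
      refine hball ?_
      rw [mem_ball, Real.dist_eq, abs_lt]
      constructor <;> linarith [ht.1, ht.2]
    have h2 : Circle.exp t ∈ {w | σ' w ∈ range σ} := interior_subset h1
    exact h2
  have hemb : IsClosedEmbedding σ := hσ.isClosedEmbedding hσi
  have hS : IsPreconnected (σ ⁻¹' ((fun t => σ' (Circle.exp t)) '' Icc θ (θ + e'))) := by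
    refine IsPreconnected.preimage_of_isClosedMap (isPreconnected_Icc.image _
      (hσ'.comp Circle.exp.continuous).continuousOn) hσi hemb.isClosedMap ?_
    rintro _ ⟨t, ht, rfl⟩
    exact hsub t ht
  have hnt : (σ ⁻¹' ((fun t => σ' (Circle.exp t)) '' Icc θ (θ + e'))).Nontrivial := by
    obtain ⟨v, hv⟩ := hsub θ ⟨le_rfl, by linarith⟩
    obtain ⟨v', hv'⟩ := hsub (θ + e') ⟨by linarith, le_rfl⟩
    refine ⟨v, ⟨θ, ⟨le_rfl, by linarith⟩, hv.symm⟩, v', ⟨θ + e', ⟨by linarith, le_rfl⟩, hv'.symm⟩,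
      fun hvv => ?_⟩
    have h1 : Circle.exp θ = Circle.exp (θ + e') := hσi' (by rw [← hv, ← hv', hvv])
    have h2 := Circle.exp_injOn_Icc (a := θ) (b := θ + e') (by linarith) ⟨le_rfl, by linarith⟩
      ⟨by linarith, le_rfl⟩ h1
    linarith
  obtain ⟨v, hv⟩ := nonempty_interior_of_isPreconnected hS hnt
  have : v ∈ interior {w | σ w ∈ range σ'} := by
    refine interior_mono ?_ hv
    rintro v ⟨t, _, ht⟩
    exact ⟨Circle.exp t, ht⟩
  rw [h] at this
  exact this

end

section

/-- Polar coordinates are an open embedding. -/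
theorem isOpenEmbedding_polar {r : ℝ} (hr : 0 < r) :
    IsOpenEmbedding fun q : Circle × ℝ => (r : ℂ) * Real.exp q.2 * q.1 := by
  have hrc : (r : ℂ) ≠ 0 := by exact_mod_cast hr.ne'
  refine IsOpenEmbedding.of_continuous_injective_isOpenMap (by fun_prop) ?_ ?_
  · rintro ⟨w, v⟩ ⟨w', v'⟩ h
    simp only [mul_assoc] at h
    have h1 := mul_left_cancel₀ hrc h
    have h2 := congrArg norm h1
    rw [norm_mul, norm_mul, Circle.norm_coe, Circle.norm_coe, mul_one, mul_one, Complex.norm_real,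
      Complex.norm_real, Real.norm_of_nonneg (Real.exp_pos _).le,
      Real.norm_of_nonneg (Real.exp_pos _).le] at h2
    have h3 := Real.exp_injective h2
    subst h3
    have h4 : ((Real.exp v : ℝ) : ℂ) ≠ 0 := by exact_mod_cast (Real.exp_pos v).ne'
    exact Prod.ext (Circle.ext (mul_left_cancel₀ h4 h1)) rfl
  · intro U hU
    have he : (fun q : Circle × ℝ => (r : ℂ) * Real.exp q.2 * q.1) '' U
        = (fun z => (r : ℂ) * z) '' (Complex.exp '' {z | (Circle.exp z.im, z.re) ∈ U}) := by
      have h1 : ∀ z : ℂ, Complex.exp z = Real.exp z.re * (Circle.exp z.im : Circle) := by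
        intro z
        rw [Circle.coe_exp, Complex.ofReal_exp, ← Complex.exp_add, Complex.re_add_im]
      ext y
      constructor
      · rintro ⟨⟨w, v⟩, hq, rfl⟩
        obtain ⟨θ, rfl⟩ := Circle.exp_surjective w
        refine ⟨_, ⟨⟨v, θ⟩, hq, rfl⟩, ?_⟩
        show (r : ℂ) * Complex.exp (⟨v, θ⟩ : ℂ) = r * Real.exp v * (Circle.exp θ : ℂ)
        rw [h1, mul_assoc]
      · rintro ⟨_, ⟨z, hz, rfl⟩, rfl⟩
        refine ⟨_, hz, ?_⟩
        show (r : ℂ) * Real.exp z.re * (Circle.exp z.im : ℂ) = r * Complex.exp z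
        rw [h1, mul_assoc]
    rw [he]
    refine (Homeomorph.mulLeft₀ _ hrc).isOpenMap _ (Complex.isOpenMap_exp _ (hU.preimage ?_))
    exact (Circle.exp.continuous.comp Complex.continuous_im).prodMk Complex.continuous_re

theorem exists_isOpenEmbedding_lt_one :
    ∃ j : ℝ → ℝ, IsOpenEmbedding j ∧ j 0 = 0 ∧ ∀ v, j v < 1 := by
  refine ⟨fun v => Real.arctan v / 2, ?_, by simp, fun v => ?_⟩
  · have h1 : IsOpenEmbedding Real.arctan :=
      (isOpen_Ioo.isOpenEmbedding_subtypeVal).comp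
        Real.tanOrderIso.symm.toHomeomorph.isOpenEmbedding
    exact (Homeomorph.mulRight₀ (2⁻¹ : ℝ) (by norm_num)).isOpenEmbedding.comp h1
  · have := Real.arctan_lt_pi_div_two v
    have := Real.pi_lt_four
    show Real.arctan v / 2 < 1
    linarith

variable {V : Type*} [TopologicalSpace V]

/-- Concentric circles in finitely many discs can be chosen to meet each other, and given closed
curves, in sets without interior. -/
theorem exists_radii [T2Space V] {ι : Type*} [Finite ι] {σ : ι → Circle → V}
    (hσ : ∀ i, Continuous (σ i)) (hσi : ∀ i, Function.Injective (σ i)) {α : Type*} [Finite α]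
    {ψ : α → ℂ → V} (hψ : ∀ k, Continuous (ψ k)) (hψi : ∀ k, Function.Injective (ψ k)) :
    ∃ r : α → ℝ, (∀ k, r k ∈ Ioo (1 : ℝ) 2) ∧
      (∀ k l, k ≠ l → interior {w : Circle | ψ k (r k * w) ∈
        range fun v : Circle => ψ l (r l * v)} = ∅) ∧
      ∀ i k, interior {w | σ i w ∈ range fun v : Circle => ψ k (r k * v)} = ∅ := by
  classical
  have := Fintype.ofFinite α
  have hcirc : ∀ k (r : ℝ), Continuous fun w : Circle => ψ k (r * w) := fun k r =>
    (hψ k).comp (by fun_prop)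
  have hcirci : ∀ k (r : ℝ), 0 < r → Function.Injective fun w : Circle => ψ k (r * w) := by
    intro k r hr w w' h
    have h1 := hψi k h
    exact Circle.ext (mul_left_cancel₀ (by exact_mod_cast hr.ne') h1)
  have hcount : ∀ (k : α) (ρ : Circle → V), Continuous ρ → Function.Injective ρ →
      {r ∈ Ioo (1 : ℝ) 2 |
        (interior {w | ρ w ∈ range fun v : Circle => ψ k (r * v)}).Nonempty}.Countable := by
    intro k ρ hρ hρi
    refine Set.PairwiseDisjoint.countable_of_nonempty_interior
      (s := fun r : ℝ => {w | ρ w ∈ range fun v : Circle => ψ k (r * v)}) ?_ fun r hr => hr.2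
    intro r hr r' hr' hne
    refine Set.disjoint_left.2 ?_
    rintro w ⟨v, hv⟩ ⟨v', hv'⟩
    have h1 := congrArg norm (hψi k (hv.trans hv'.symm))
    simp only [norm_mul, Circle.norm_coe, mul_one, Complex.norm_real] at h1
    rw [Real.norm_of_nonneg (by linarith [hr.1.1]),
      Real.norm_of_nonneg (by linarith [hr'.1.1])] at h1
    exact hne h1
  have key : ∀ S : Finset α, ∃ r : α → ℝ, (∀ k, r k ∈ Ioo (1 : ℝ) 2) ∧
      (∀ k ∈ S, ∀ l ∈ S, k ≠ l → interior {w : Circle | ψ k (r k * w) ∈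
        range fun v : Circle => ψ l (r l * v)} = ∅) ∧
      ∀ i, ∀ k ∈ S, interior {w | σ i w ∈ range fun v : Circle => ψ k (r k * v)} = ∅ := by
    intro S
    induction S using Finset.induction_on with
    | empty => exact ⟨fun _ => 3 / 2, fun _ => by constructor <;> norm_num, by simp, by simp⟩
    | insert k S hkS ih =>
      obtain ⟨r, hr, h1, h2⟩ := ih
      have hr0 : ∀ k, 0 < r k := fun k => by linarith [(hr k).1]
      have hc := (countable_iUnion fun i => hcount k (σ i) (hσ i) (hσi i)).union
        (countable_iUnion fun l => hcount k _ (hcirc l (r l)) (hcirci l _ (hr0 l)))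
      obtain ⟨r₀, hr₀, hr₀c⟩ :=
        (hc.dense_compl ℝ).exists_mem_open (isOpen_Ioo (a := (1 : ℝ)) (b := 2))
        (nonempty_Ioo.2 (by norm_num))
      simp only [mem_compl_iff, mem_union, mem_iUnion, not_or, not_exists, mem_ofPred_eq, not_and,
        not_nonempty_iff_eq_empty] at hr₀
      have hupd : ∀ l ∈ S, Function.update r k r₀ l = r l := fun l hl =>
        Function.update_of_ne (by rintro rfl; exact hkS hl) _ _
      have hnew : ∀ l, interior {w : Circle | ψ l (r l * w) ∈
          range fun v : Circle => ψ k (r₀ * v)} = ∅ := fun l => hr₀.2 l hr₀c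
      refine ⟨Function.update r k r₀, fun l => ?_, ?_, ?_⟩
      · by_cases h : l = k
        · rw [h, Function.update_self]; exact hr₀c
        · rw [Function.update_of_ne h]; exact hr l
      · intro l hl m hm hlm
        rcases Finset.mem_insert.1 hl with rfl | hl'
        · rcases Finset.mem_insert.1 hm with hm | hm
          · exact absurd hm.symm hlm
          · rw [hupd m hm, Function.update_self]
            exact interior_eq_empty_symm (hcirc m (r m)) (hcirci m _ (hr0 m)) (hcirc l r₀)
              (hcirci l r₀ (by linarith [hr₀c.1])) (hnew m)
        · rcases Finset.mem_insert.1 hm with rfl | hm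
          · rw [hupd l hl', Function.update_self]
            exact hnew l
          · rw [hupd l hl', hupd m hm]
            exact h1 l hl' m hm hlm
      · intro i l hl
        rcases Finset.mem_insert.1 hl with rfl | hl
        · rw [Function.update_self]
          exact hr₀.1 i hr₀c
        · rw [hupd l hl]
          exact h2 i l hl
  obtain ⟨r, h1, h2, h3⟩ := key Finset.univ
  exact ⟨r, h1, fun k l => h2 k (Finset.mem_univ k) l (Finset.mem_univ l),
    fun i k => h3 i k (Finset.mem_univ k)⟩

/-- Plane embeddings of relatively open pieces can be put side by side. -/
theorem exists_injOn_of_pieces {α : Type*} [Finite α] {N : Set V} {P : α → Set V} {F : α → V → ℂ}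
    (hcover : ∀ x ∈ N, ∃ a, x ∈ P a) (hdisj : ∀ x a b, x ∈ P a → x ∈ P b → a = b)
    (hopen : ∀ a, ∀ x ∈ N, x ∈ P a → P a ∈ 𝓝[N] x) (hF : ∀ a, ContinuousOn (F a) (P a))
    (hFi : ∀ a, InjOn (F a) (P a)) (hF1 : ∀ a, ∀ x ∈ P a, ‖F a x‖ ≤ 1) :
    ∃ f : V → ℂ, ContinuousOn f N ∧ InjOn f N := by
  classical
  obtain ⟨m, ⟨e⟩⟩ := Finite.exists_equiv_fin α
  let f : V → ℂ := fun x => if h : ∃ a, x ∈ P a then ((4 * (e h.choose : ℕ) : ℝ) : ℂ) + F h.choose x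
    else 0
  have hf : ∀ a, ∀ x ∈ P a, f x = ((4 * (e a : ℕ) : ℝ) : ℂ) + F a x := by
    intro a x hx
    have h : ∃ a, x ∈ P a := ⟨a, hx⟩
    have h1 : h.choose = a := hdisj x _ _ h.choose_spec hx
    simp only [f, dif_pos h, h1]
  refine ⟨f, fun x hx => ?_, fun x hx y hy hxy => ?_⟩
  · obtain ⟨a, ha⟩ := hcover x hx
    have h1 : ContinuousWithinAt (fun x => ((4 * (e a : ℕ) : ℝ) : ℂ) + F a x) N x :=
      ((continuousOn_const.add (hF a)) x ha).mono_of_mem_nhdsWithin (hopen a x hx ha)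
    refine h1.congr_of_eventuallyEq ?_ (hf a x ha)
    filter_upwards [hopen a x hx ha] with y hy using hf a y hy
  · obtain ⟨a, ha⟩ := hcover x hx
    obtain ⟨b, hb⟩ := hcover y hy
    rw [hf a x ha, hf b y hb] at hxy
    have h1 : (4 * (e a : ℕ) : ℝ) - 4 * (e b : ℕ) = (F b y - F a x).re := by
      have := congrArg Complex.re hxy
      simp only [Complex.add_re, Complex.ofReal_re] at this
      rw [Complex.sub_re]; linarith
    have h2 := (abs_le.1 (Complex.abs_re_le_norm (F b y - F a x)))
    have h3 := norm_sub_le (F b y) (F a x)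
    have h4 := hF1 a x ha
    have h5 := hF1 b y hb
    have h6 : (e a : ℕ) = e b := by
      have h7 : (e a : ℝ) < (e b : ℕ) + 1 := by linarith
      have h8 : (e b : ℝ) < (e a : ℕ) + 1 := by linarith
      have h9 : (e a : ℕ) < e b + 1 := by exact_mod_cast h7
      have h10 : (e b : ℕ) < e a + 1 := by exact_mod_cast h8
      omega
    have h7 : a = b := e.injective (Fin.ext h6)
    subst h7
    exact hFi a ha hb (add_left_cancel hxy)

end

section

variable {V : Type} [TopologicalSpace V] {β : Type} {ht : V → ℝ} {c : β → Circle → ℝ → V}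

/-- The part of a collar band lying away from a short gap around `1`. -/
def offGap (c : β → Circle → ℝ → V) (κ : ℝ) (b : β) : Set V :=
  (fun p : Circle × ℝ => c b p.1 p.2) ''
    {p | p.2 ∈ Icc (1 : ℝ) 2 ∧ ((p.1 : ℂ).re ≤ 0 ∨ κ ≤ |(p.1 : ℂ).im|)}

theorem isCompact_offGap_dom (κ : ℝ) : IsCompact
    {p : Circle × ℝ | p.2 ∈ Icc (1 : ℝ) 2 ∧ ((p.1 : ℂ).re ≤ 0 ∨ κ ≤ |(p.1 : ℂ).im|)} := by
  refine (isCompact_univ.prod (isCompact_Icc (a := (1 : ℝ)) (b := 2))).of_isClosed_subset ?_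
    fun p hp => ⟨mem_univ _, hp.1⟩
  refine (isClosed_Icc.preimage continuous_snd).inter (IsClosed.union ?_ ?_)
  · exact isClosed_le (f := fun p : Circle × ℝ => (p.1 : ℂ).re) (by fun_prop) continuous_const
  · exact isClosed_le (g := fun p : Circle × ℝ => |(p.1 : ℂ).im|) continuous_const (by fun_prop)

theorem Cuffed.ht_c_of_pos (h : Cuffed ht c) (b : β) (w : Circle) {s : ℝ} (hs : 0 ≤ s) :
    ht (c b w s) = s := by
  rw [h.ht_c, max_eq_left hs]

theorem Cuffed.isOpen_lt (h : Cuffed ht c) (r : ℝ) : IsOpen {x | ht x < r} :=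
  _root_.isOpen_lt h.continuous_ht continuous_const

theorem Cuffed.engulfed_empty (h : Cuffed ht c) [Nonempty V] : Engulfed {x | ht x < 3} ∅ := by
  obtain ⟨x, hx⟩ : ∃ x, ht x < 3 := by
    obtain ⟨x⟩ := ‹Nonempty V›
    rcases le_or_gt (ht x) 0 with h0 | h0
    · exact ⟨x, by linarith⟩
    · obtain ⟨b, w, -⟩ := h.surj x h0
      exact ⟨c b w 0, by rw [h.ht_c]; norm_num⟩
  obtain ⟨ψ, hψ, -, hr⟩ := h.locallyPlane.exists_range_subset (h.isOpen_lt 3) hx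
  exact ⟨ψ, hψ, hr, empty_subset _⟩

theorem Cuffed.engulfed_offGap (h : Cuffed ht c) [T2Space V] [Nonempty V] {κ : ℝ} (hκ : 0 < κ)
    (S : Finset β) : Engulfed {x | ht x < 3} (⋃ b ∈ S, offGap c κ b) := by
  classical
  have hD : ∀ b, IsCompact (offGap c κ b) := fun b =>
    (isCompact_offGap_dom κ).image (h.continuous_c b)
  induction S using Finset.induction_on with
  | empty => simpa using h.engulfed_empty
  | insert b S hb ih =>
    rw [Finset.set_biUnion_insert, union_comm]
    let σ : ℝ × ℝ → V := fun p => c b (Circle.exp p.1) (Real.exp p.2)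
    have hσo : IsOpenMap σ := (h.isOpenEmbedding_c b).isOpenMap.comp
      (isLocalHomeomorph_circleExp.isOpenMap.prodMap IsOpenMap.id)
    have hσc : Continuous σ := by
      have := (h.isOpenEmbedding_c b).continuous
      exact this.comp (by fun_prop : Continuous fun p : ℝ × ℝ => (Circle.exp p.1, p.2))
    obtain ⟨J, hJ, hJr⟩ := exists_isOpenEmbedding_rectangle (a := -(2 * Real.pi)) (b := 0)
      (by linarith [Real.pi_pos]) (Real.log_pos (by norm_num : (1 : ℝ) < 3))
    have hJm : ∀ z, J z ∈ Ioo (-(2 * Real.pi)) 0 ×ˢ Ioo (-(Real.log 3)) (Real.log 3) :=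
      fun z => hJr ▸ mem_range_self z
    have hlt : ∀ z, ht (σ (J z)) < 3 := by
      intro z
      rw [h.ht_c_of_pos b _ (Real.exp_pos _).le]
      calc Real.exp (J z).2 < Real.exp (Real.log 3) := Real.exp_lt_exp.2 (hJm z).2.2
        _ = 3 := Real.exp_log (by norm_num)
    have hψ : IsOpenEmbedding (σ ∘ J) := by
      refine IsOpenEmbedding.of_continuous_injective_isOpenMap (hσc.comp hJ.continuous) ?_
        (hσo.comp hJ.isOpenMap)
      intro z w hzw
      apply hJ.injective
      obtain ⟨-, h1, h2⟩ := h.inj _ _ _ _ _ _ (Real.exp_pos _) hzw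
      refine Prod.ext ?_ (Real.exp_injective h2)
      have hz := (hJm z).1
      have hw := (hJm w).1
      obtain ⟨m, hm⟩ := Circle.exp_eq_exp.1 h1
      have hpi := Real.pi_pos
      have h3 : (m : ℝ) < 1 := by
        simp only [mem_Ioo] at hz hw
        by_contra hcon
        push Not at hcon
        nlinarith
      have h4 : (-1 : ℝ) < m := by
        simp only [mem_Ioo] at hz hw
        by_contra hcon
        push Not at hcon
        nlinarith
      have h5 : m = 0 := by
        have h3' : m < 1 := by exact_mod_cast h3
        have h4' : -1 < m := by exact_mod_cast h4
        omega
      simpa [h5] using hm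
    have hsub : offGap c κ b ⊆ range (σ ∘ J) := by
      rintro _ ⟨⟨w, s⟩, ⟨hs, hw⟩, rfl⟩
      simp only at hs hw ⊢
      have hw1 : w ≠ 1 := by
        rintro rfl
        rcases hw with hw | hw
        · simp at hw
          linarith
        · simp at hw
          linarith
      obtain ⟨θ, hθ, hθw⟩ : ∃ θ ∈ Ioo (-(2 * Real.pi)) 0, Circle.exp θ = w := by
        have hpi := Real.pi_pos
        have h1 := Complex.neg_pi_lt_arg (w : ℂ)
        have h2 := Complex.arg_le_pi (w : ℂ)
        rcases lt_trichotomy (Complex.arg (w : ℂ)) 0 with hneg | h0 | hpos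
        · exact ⟨Complex.arg w, ⟨by linarith, hneg⟩, Circle.exp_arg w⟩
        · exact absurd (by rw [← Circle.exp_arg w, h0, Circle.exp_zero]) hw1
        · refine ⟨Complex.arg w - 2 * Real.pi, ⟨by linarith, by linarith⟩, ?_⟩
          rw [Circle.exp_sub_two_pi, Circle.exp_arg]
      have hs0 : 0 < s := by linarith [hs.1]
      have hmem : (θ, Real.log s) ∈ range J := by
        rw [hJr]
        refine ⟨hθ, ?_, Real.log_lt_log hs0 (by linarith [hs.2])⟩
        have := Real.log_nonneg hs.1
        have := Real.log_pos (by norm_num : (1 : ℝ) < 3)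
        simp only
        linarith
      obtain ⟨z, hz⟩ := hmem
      refine ⟨z, ?_⟩
      simp only [Function.comp, hz, σ]
      rw [hθw, Real.exp_log hs0]
    have hS : IsCompact ((σ ∘ J) ⁻¹' offGap c κ b) :=
      hψ.isInducing.isCompact_preimage' (hD b) hsub
    have hK : IsClosed (⋃ b ∈ S, offGap c κ b) :=
      (S.finite_toSet.isCompact_biUnion fun b _ => hD b).isClosed
    have := ih.union_image h.locallyPlane (h.isOpen_lt 3) h.isPreconnected_lt hK hψ ?_ ?_ hS
    · rwa [image_preimage_eq_of_subset hsub] at this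
    · rintro _ ⟨z, rfl⟩
      exact hlt z
    · intro z hz
      simp only [mem_iUnion] at hz
      obtain ⟨b', hb', ⟨w, s⟩, ⟨hs, -⟩, hws⟩ := hz
      obtain ⟨h1, -, -⟩ := h.inj _ _ _ _ _ _ (by linarith [hs.1]) hws
      exact hb (h1 ▸ hb')

end

section

theorem exists_continuousOn_leftInverse {P V : Type*} [TopologicalSpace P] [TopologicalSpace V]
    [Nonempty P] {ψ : P → V} (hψ : IsOpenEmbedding ψ) :
    ∃ g : V → P, ContinuousOn g (range ψ) ∧ ∀ z, g (ψ z) = z := by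
  refine ⟨(hψ.toOpenPartialHomeomorph ψ).symm, ?_, fun z => ?_⟩
  · have := (hψ.toOpenPartialHomeomorph ψ).continuousOn_symm
    simpa using this
  · exact (hψ.toOpenPartialHomeomorph ψ).left_inv (by simp)

variable {V : Type} [TopologicalSpace V] {β : Type} {ht : V → ℝ} {c : β → Circle → ℝ → V}

/-- Finitely many closed curves in general position cut the part of a cuffed surface below
height `1` into planar pieces. -/
theorem Cuffed.exists_curves (h : Cuffed ht c) [Finite β] [T2Space V] :
    ∃ (α : Type) (_ : Finite α) (τ : α → Circle × ℝ → V), (∀ k, IsOpenEmbedding (τ k)) ∧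
      (∀ k q, ht (τ k q) < 1) ∧
      (∀ k l, k ≠ l →
        interior {w : Circle | τ k (w, 0) ∈ range fun v : Circle => τ l (v, 0)} = ∅) ∧
      ∃ f : V → ℂ,
        ContinuousOn f ({x | ht x ≤ 1} \ ⋃ k, range fun w : Circle => τ k (w, 0)) ∧
        InjOn f ({x | ht x ≤ 1} \ ⋃ k, range fun w : Circle => τ k (w, 0)) := by
  classical
  obtain ⟨N, ψ, hψ, hψlt, hψcov⟩ : ∃ (N : ℕ) (ψ : Fin N → ℂ → V), (∀ k, IsOpenEmbedding (ψ k)) ∧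
      (∀ k z, ht (ψ k z) < 1 / 2) ∧ ∀ x, ht x ≤ 1 / 4 → ∃ k, x ∈ ψ k '' ball 0 1 := by
    have hx : ∀ x : {x // ht x ≤ 1 / 4}, ∃ ψ : ℂ → V, IsOpenEmbedding ψ ∧ ψ 0 = x ∧
        range ψ ⊆ {x | ht x < 1 / 2} := fun x =>
      h.locallyPlane.exists_range_subset (h.isOpen_lt _)
        (show ht x < 1 / 2 by linarith [x.2])
    choose ψ h1 h2 h3 using hx
    obtain ⟨t, ht⟩ := (h.isCompact_le (1 / 4)).elim_finite_subcover
      (fun x => ψ x '' ball 0 1) (fun x => (h1 x).isOpenMap _ isOpen_ball) fun x hx =>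
        mem_iUnion.2 ⟨⟨x, hx⟩, 0, by simp, h2 _⟩
    refine ⟨_, fun k => ψ (t.equivFin.symm k), fun k => h1 _, fun k z => h3 _ ⟨z, rfl⟩, ?_⟩
    intro x hx
    have := ht hx
    simp only [mem_iUnion] at this
    obtain ⟨i, hi, hxi⟩ := this
    exact ⟨t.equivFin ⟨i, hi⟩, by simpa using hxi⟩
  have hσ : ∀ b, Continuous fun w : Circle => c b w (1 / 4) := fun b =>
    (h.continuous_c b).comp (by fun_prop : Continuous fun w : Circle => (w, (1 / 4 : ℝ)))
  have hσi : ∀ b, Function.Injective fun w : Circle => c b w (1 / 4) := fun b w w' hw =>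
    (h.inj _ _ _ _ _ _ (by norm_num) hw).2.1
  obtain ⟨r, hr, hr1, hr2⟩ := exists_radii hσ hσi (fun k => (hψ k).continuous)
    fun k => (hψ k).injective
  have hr0 : ∀ k, 0 < r k := fun k => by linarith [(hr k).1]
  obtain ⟨j, hj, hj0, hj1⟩ := exists_isOpenEmbedding_lt_one
  have hlog : Real.exp (0 - Real.log 4) = 1 / 4 := by
    rw [zero_sub, Real.exp_neg, Real.exp_log (by norm_num)]; norm_num
  let τ : β ⊕ Fin N → Circle × ℝ → V := Sum.elim
    (fun b q => c b q.1 (Real.exp (j q.2 - Real.log 4)))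
    (fun k q => ψ k (r k * Real.exp q.2 * q.1))
  have hτb : ∀ b (w : Circle), τ (Sum.inl b) (w, 0) = c b w (1 / 4) := fun b w => by
    simp only [τ, Sum.elim_inl, hj0, hlog]
  have hτk : ∀ k (w : Circle), τ (Sum.inr k) (w, 0) = ψ k (r k * w) := fun k w => by
    simp [τ]
  have hτbr : ∀ b, (range fun w : Circle => τ (Sum.inl b) (w, 0)) =
      range fun w : Circle => c b w (1 / 4) := fun b => by simp only [hτb]
  have hτkr : ∀ k, (range fun w : Circle => τ (Sum.inr k) (w, 0)) =
      range fun w : Circle => ψ k (r k * w) := fun k => by simp only [hτk]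
  choose gb hgb hgb' using fun b => exists_continuousOn_leftInverse (h.isOpenEmbedding_c b)
  choose gk hgk hgk' using fun k => exists_continuousOn_leftInverse (hψ k)
  refine ⟨β ⊕ Fin N, inferInstance, τ, ?_, ?_, ?_, ?_⟩
  · rintro (b | k)
    · have h1 : IsOpenEmbedding fun v : ℝ => j v - Real.log 4 :=
        (Homeomorph.subRight (Real.log 4)).isOpenEmbedding.comp hj
      exact (h.isOpenEmbedding_c b).comp (IsOpenEmbedding.id.prodMap h1)
    · exact (hψ k).comp (isOpenEmbedding_polar (hr0 k))
  · rintro (b | k) q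
    · simp only [τ, Sum.elim_inl]
      rw [h.ht_c_of_pos _ _ (Real.exp_pos _).le, Real.exp_lt_one_iff]
      have h1 := hj1 q.2
      have h2 : (1 : ℝ) < Real.log 4 := by
        rw [Real.lt_log_iff_exp_lt (by norm_num)]
        linarith [Real.exp_one_lt_d9]
      linarith
    · have := hψlt k (r k * Real.exp q.2 * q.1)
      simp only [τ, Sum.elim_inr]
      linarith
  · have hψσ : ∀ k, Continuous fun w : Circle => ψ k (r k * w) := fun k =>
      (hψ k).continuous.comp (by fun_prop)
    have hψσi : ∀ k, Function.Injective fun w : Circle => ψ k (r k * w) := fun k w w' hw =>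
      Circle.ext (mul_left_cancel₀ (by exact_mod_cast (hr0 k).ne') ((hψ k).injective hw))
    rintro (b | k) (b' | k') hne
    · convert interior_empty
      rw [eq_empty_iff_forall_notMem]
      rintro w ⟨v, hv⟩
      simp only [hτb] at hv
      exact hne (congrArg _ (h.inj _ _ _ _ _ _ (by norm_num) hv).1.symm)
    · simp only [hτb, hτk]
      exact hr2 b k'
    · simp only [hτb, hτk]
      exact interior_eq_empty_symm (hσ b') (hσi b') (hψσ k) (hψσi k) (hr2 b' k)
    · simp only [hτk]
      exact hr1 k k' fun hk => hne (by rw [hk])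
  · let P : β ⊕ Fin N → Set V := Sum.elim
      (fun b => {x | 1 / 4 < ht x ∧ ht x ≤ 1 ∧
        x ∈ range fun q : Circle × ℝ => c b q.1 (Real.exp q.2)})
      (fun k => {x | ht x ≤ 1 / 4 ∧ x ∈ ψ k '' closedBall 0 (r k) ∧
        ∀ l < k, x ∉ ψ l '' closedBall 0 (r l)})
    let F : β ⊕ Fin N → V → ℂ := Sum.elim
      (fun b x => (Real.exp (gb b x).2 : ℝ) * ((gb b x).1 : ℂ)) (fun k x => gk k x / 2)
    refine exists_injOn_of_pieces (P := P) (F := F) ?_ ?_ ?_ ?_ ?_ ?_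
    · rintro x ⟨hx1, -⟩
      rcases le_or_gt (ht x) (1 / 4) with hx | hx
      · have hex : ∃ k, x ∈ ψ k '' closedBall 0 (r k) := by
          obtain ⟨k, hk⟩ := hψcov x hx
          exact ⟨k, image_mono (ball_subset_closedBall.trans
            (closedBall_subset_closedBall (hr k).1.le)) hk⟩
        obtain ⟨k, hk, hmin⟩ := wellFounded_lt.has_min {k | x ∈ ψ k '' closedBall 0 (r k)} hex
        exact ⟨Sum.inr k, hx, hk, fun l hl hl' => hmin l hl' hl⟩
      · obtain ⟨b, w, hw⟩ := h.surj x (by linarith)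
        refine ⟨Sum.inl b, hx, hx1, (w, Real.log (ht x)), ?_⟩
        simp only
        rw [Real.exp_log (by linarith), hw]
    · rintro x (b | k) (b' | k') ha hb
      · obtain ⟨-, -, q, hq⟩ := ha
        obtain ⟨-, -, q', hq'⟩ := hb
        rw [(h.inj _ _ _ _ _ _ (Real.exp_pos _) (hq.trans hq'.symm)).1]
      · exact absurd hb.1 (not_le.2 ha.1)
      · exact absurd ha.1 (not_le.2 hb.1)
      · rcases lt_trichotomy k k' with hlt | heq | hlt
        · exact absurd ha.2.1 (hb.2.2 k hlt)
        · rw [heq]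
        · exact absurd hb.2.1 (ha.2.2 k' hlt)
    · rintro (b | k) x ⟨hx1, hxC⟩ hx
      · have h1 : {x | 1 / 4 < ht x} ∩ (range fun q : Circle × ℝ => c b q.1 (Real.exp q.2)) ∈ 𝓝 x :=
          ((_root_.isOpen_lt continuous_const h.continuous_ht).inter
            (h.isOpenEmbedding_c b).isOpen_range).mem_nhds ⟨hx.1, hx.2.2⟩
        filter_upwards [mem_nhdsWithin_of_mem_nhds h1, self_mem_nhdsWithin] with y hy hyN
        exact ⟨hy.1, hyN.1, hy.2⟩
      · have hx4 : ht x < 1 / 4 := by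
          refine lt_of_le_of_ne hx.1 fun heq => ?_
          obtain ⟨b, w, hw⟩ := h.surj x (by rw [heq]; norm_num)
          refine hxC (mem_iUnion.2 ⟨Sum.inl b, w, ?_⟩)
          simp only
          rw [hτb, ← heq, hw]
        have hxk : x ∈ ψ k '' ball 0 (r k) := by
          obtain ⟨z, hz, hzx⟩ := hx.2.1
          refine ⟨z, mem_ball.2 (lt_of_le_of_ne hz fun heq => ?_), hzx⟩
          rw [dist_zero_right] at heq
          have hrk : (r k : ℂ) ≠ 0 := by exact_mod_cast (hr0 k).ne'
          obtain ⟨w, hw⟩ : ∃ w : Circle, (w : ℂ) = z / r k := by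
            refine ⟨⟨z / r k, ?_⟩, rfl⟩
            rw [← SetLike.mem_coe]
            show _ ∈ sphere (0 : ℂ) 1
            rw [mem_sphere_zero_iff_norm, norm_div, heq, Complex.norm_real,
              Real.norm_of_nonneg (hr0 k).le, div_self (hr0 k).ne']
          refine hxC (mem_iUnion.2 ⟨Sum.inr k, w, ?_⟩)
          simp only
          rw [hτk, ← hzx, hw, mul_div_cancel₀ _ hrk]
        have h1 : {x | ht x < 1 / 4} ∩ ψ k '' ball 0 (r k) ∩
            (⋃ l ∈ {l | l < k}, ψ l '' closedBall 0 (r l))ᶜ ∈ 𝓝 x := by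
          refine (((h.isOpen_lt _).inter ((hψ k).isOpenMap _ isOpen_ball)).inter
            (IsCompact.isClosed ?_).isOpen_compl).mem_nhds ⟨⟨hx4, hxk⟩, ?_⟩
          · exact (toFinite _).isCompact_biUnion fun l _ =>
              (isCompact_closedBall _ _).image (hψ l).continuous
          · intro hmem
            obtain ⟨l, hl, hxl⟩ := mem_iUnion₂.1 hmem
            exact hx.2.2 l hl hxl
        filter_upwards [mem_nhdsWithin_of_mem_nhds h1] with y hy
        exact ⟨(show ht y < 1 / 4 from hy.1.1).le, image_mono ball_subset_closedBall hy.1.2,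
          fun l hl hyl => hy.2 (mem_iUnion₂.2 ⟨l, hl, hyl⟩)⟩
    · rintro (b | k)
      · have h1 : ContinuousOn (gb b) (P (Sum.inl b)) := (hgb b).mono fun x hx => hx.2.2
        have h2 : Continuous fun q : Circle × ℝ => ((Real.exp q.2 : ℝ) : ℂ) * (q.1 : ℂ) := by
          fun_prop
        exact h2.comp_continuousOn h1
      · have h1 : ContinuousOn (gk k) (P (Sum.inr k)) := (hgk k).mono fun x hx =>
          image_subset_range _ _ hx.2.1
        exact h1.div_const 2
    · rintro (b | k)
      · rintro _ ⟨-, -, q, rfl⟩ _ ⟨-, -, q', rfl⟩ hqq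
        simp only [F, Sum.elim_inl, hgb'] at hqq
        have := (isOpenEmbedding_polar one_pos).injective (a₁ := q) (a₂ := q')
          (by simpa using hqq)
        rw [this]
      · rintro _ ⟨-, ⟨z, -, rfl⟩, -⟩ _ ⟨-, ⟨z', -, rfl⟩, -⟩ hqq
        simp only [F, Sum.elim_inr, hgk'] at hqq
        rw [(div_left_inj' (by norm_num : (2 : ℂ) ≠ 0)).1 hqq]
    · rintro (b | k)
      · rintro _ ⟨-, hle, q, rfl⟩
        rw [h.ht_c_of_pos _ _ (Real.exp_pos _).le] at hle
        simp only [F, Sum.elim_inl, hgb']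
        rw [norm_mul, Circle.norm_coe, mul_one, Complex.norm_real,
          Real.norm_of_nonneg (Real.exp_pos _).le]
        exact hle
      · rintro _ ⟨-, ⟨z, hz, rfl⟩, -⟩
        simp only [F, Sum.elim_inr, hgk']
        rw [norm_div, Complex.norm_two]
        rw [mem_closedBall, dist_zero_right] at hz
        linarith [(hr k).2]

end

section

/-- A handle decomposition of the part of a cuffed surface below height `1`: a disc `δ`, bands `ρ`
crossing a system of curves `Γ`, and an injective planar map `f` off the curves. The disc contains
all but a short gap of each collar band between heights `1` and `2`. -/
structure IsHub {V : Type*} [TopologicalSpace V] {β : Type*} (ht : V → ℝ) (c : β → Circle → ℝ → V)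
    (κ : ℝ) (δ : ℂ → V) {ι : Type*} (ρ : ι → ℝ × ℝ → V) (f : V → ℂ) (Γ : Set V) : Prop where
  isOpenEmbedding : IsOpenEmbedding δ
  disc_lt : ∀ z, ht (δ z) < 3
  mem_disc : ∀ b (w : Circle) s, s ∈ Icc (1 : ℝ) 2 → ((w : ℂ).re ≤ 0 ∨ κ ≤ |(w : ℂ).im|) →
    c b w s ∈ δ '' ball 0 1
  continuous_ρ : ∀ i, Continuous (ρ i)
  ρ_inj : ∀ i, ∀ p ∈ Icc (-1 : ℝ) 1 ×ˢ Icc (-1 : ℝ) 1, ∀ j, ∀ q ∈ Icc (-1 : ℝ) 1 ×ˢ Icc (-1 : ℝ) 1,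
    ρ i p = ρ j q → i = j ∧ p = q
  ρ_open : ∀ i, IsOpen (ρ i '' Ioo (-1 : ℝ) 1 ×ˢ Ioo (-1 : ℝ) 1)
  ρ_end : ∀ i, ∀ u, |u| = 1 → ∀ v ∈ Icc (-1 : ℝ) 1, ρ i (u, v) ∈ δ '' ball 0 1
  ρ_lt : ∀ i p, ht (ρ i p) < 1
  continuousOn_f : ContinuousOn f ({x | ht x ≤ 1} \ Γ)
  injOn_f : InjOn f ({x | ht x ≤ 1} \ Γ)
  Γ_subset : Γ ⊆ δ '' ball 0 1 ∪ ⋃ i, ρ i '' Ioo (-1 : ℝ) 1 ×ˢ Ioo (-1 : ℝ) 1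
  Γ_lt : ∀ x ∈ Γ, ht x < 1
  ρ_edge : ∀ i, ∀ u ∈ Icc (-1 : ℝ) 1, ∀ v, |v| = 1 → ρ i (u, v) ∉ Γ

variable {V : Type} [TopologicalSpace V] {β : Type} {ht : V → ℝ} {c : β → Circle → ℝ → V}

theorem Cuffed.exists_hub (h : Cuffed ht c) [Finite β] [Nonempty V] [T2Space V] {κ : ℝ}
    (hκ : 0 < κ) : ∃ (δ : ℂ → V) (ι : Type) (_ : Finite ι) (ρ : ι → ℝ × ℝ → V) (f : V → ℂ)
      (Γ : Set V), IsHub ht c κ δ ρ f Γ := by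
  classical
  have := Fintype.ofFinite β
  obtain ⟨α, hα, τ, hτ, hτlt, hτi, f, hfc, hfi⟩ := h.exists_curves
  let C : α → Set V := fun k => range fun w : Circle => τ k (w, 0)
  have hτ0 : ∀ k, Continuous fun w : Circle => τ k (w, 0) := fun k =>
    (hτ k).continuous.comp (by fun_prop)
  have hC : ∀ k, IsClosed (C k) := fun k => (isCompact_range (hτ0 k)).isClosed
  let Z : α → Set Circle := fun k => ⋃ l ∈ {l | k ≠ l}, {w | τ k (w, 0) ∈ C l}
  have hZ : ∀ k, IsClosed (Z k) := fun k =>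
    (toFinite _).isClosed_biUnion fun l _ => (hC l).preimage (hτ0 k)
  have hZd : ∀ k, Dense (Z k)ᶜ := by
    intro k
    have : (Z k)ᶜ = ⋂ l ∈ {l | k ≠ l}, {w | τ k (w, 0) ∈ C l}ᶜ := by
      simp only [Z, compl_iUnion]
    rw [this]
    refine dense_biInter_of_isOpen (fun l _ => ((hC l).preimage (hτ0 k)).isOpen_compl)
      (to_countable _) fun l hl => ?_
    rw [← interior_eq_empty_iff_dense_compl]
    exact hτi k l hl
  have hK : IsCompact (⋃ b ∈ (Finset.univ : Finset β), offGap c κ b) :=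
    (Finset.univ : Finset β).finite_toSet.isCompact_biUnion fun b _ =>
      (isCompact_offGap_dom κ).image (h.continuous_c b)
  obtain ⟨δ, hδ, hδU, hKδ, n, x, η, hg, hcov⟩ := (h.engulfed_offGap hκ Finset.univ).exists_disc
    h.locallyPlane (h.isOpen_lt 3) h.isPreconnected_lt hK hτ
    (fun k => by
      rintro _ ⟨q, rfl⟩
      exact lt_trans (hτlt k q) (by norm_num)) hZ hZd
  have hopen : IsOpen (δ '' ball 0 1) := hδ.isOpenMap _ isOpen_ball
  let ι := Σ k, Fin (n k)
  let σ : ι → ℝ × ℝ → V := fun i p => τ i.1 (Circle.exp (x i.1 i.2 + η i.1 * p.1), p.2)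
  have hσc : ∀ i, Continuous (σ i) := fun i => (hτ i.1).continuous.comp (by fun_prop)
  have hσC : ∀ (i : ι) l, i.1 ≠ l → ∀ u ∈ Icc (-1 : ℝ) 1, σ i (u, 0) ∉ C l := by
    rintro ⟨k, i⟩ l hl u hu hmem
    exact (hg k).2.2 i i.2 u hu (mem_iUnion₂.2 ⟨l, hl, hmem⟩)
  have hend : ∀ (i : ι) u, |u| = 1 → σ i (u, 0) ∈ δ '' ball 0 1 := by
    rintro ⟨k, i⟩ u hu
    rcases hcov k (Circle.exp (x k i + η k * u)) with ⟨j, hj, v, hv, hw⟩ | hw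
    · have := ((hg k).2.1 i i.2 j hj u (abs_le.1 hu.le) v (Ioo_subset_Icc_self hv) hw).2
      rw [← this] at hv
      exact absurd (abs_lt.2 hv) (by rw [hu]; exact lt_irrefl _)
    · exact hw
  have E1 : ∀ i : ι, ∀ᶠ v in 𝓝 (0 : ℝ), ∀ u ∈ ({u | |u| = 1} : Set ℝ),
      σ i (u, v) ∈ δ '' ball 0 1 := by
    intro i
    refine IsCompact.eventually_forall_of_forall_eventually ?_ fun u hu => ?_
    · have : ({u | |u| = 1} : Set ℝ) = sphere 0 1 := by
        ext u; simp
      rw [this]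
      exact isCompact_sphere _ _
    · exact ((hσc i).comp continuous_swap).continuousAt.eventually
        (hopen.mem_nhds (hend i u hu) : _ ∈ 𝓝 ((σ i ∘ Prod.swap) (0, u)))
  have E2 : ∀ i : ι, ∀ᶠ v in 𝓝 (0 : ℝ), ∀ u ∈ Icc (-1 : ℝ) 1, ∀ l, i.1 ≠ l → σ i (u, v) ∉ C l := by
    intro i
    refine isCompact_Icc.eventually_forall_of_forall_eventually fun u hu => ?_
    refine Filter.eventually_all.2 fun l => ?_
    by_cases hl : i.1 = l
    · exact Filter.Eventually.of_forall fun _ h => absurd hl h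
    · filter_upwards [((hσc i).comp continuous_swap).continuousAt.eventually
        ((hC l).isOpen_compl.mem_nhds (hσC i l hl u hu) :
          _ ∈ 𝓝 ((σ i ∘ Prod.swap) (0, u)))] with p hp _
      exact hp
  have E3 : ∀ i j : ι, i.1 ≠ j.1 → ∀ᶠ v in 𝓝 ((0, 0) : ℝ × ℝ),
      ∀ u ∈ Icc (-1 : ℝ) 1 ×ˢ Icc (-1 : ℝ) 1, σ i (u.1, v.1) ≠ σ j (u.2, v.2) := by
    intro i j hij
    refine (isCompact_Icc.prod isCompact_Icc).eventually_forall_of_forall_eventually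
      fun u hu => ?_
    have hne : σ i (u.1, 0) ≠ σ j (u.2, 0) := fun heq =>
      hσC i j.1 hij u.1 hu.1 ⟨_, heq.symm⟩
    have hi := hσc i
    have hj := hσc j
    exact (isOpen_ne_fun (f := fun p : (ℝ × ℝ) × (ℝ × ℝ) => σ i (p.2.1, p.1.1))
      (g := fun p => σ j (p.2.2, p.1.2)) (by fun_prop) (by fun_prop)).mem_nhds hne
  obtain ⟨ε, hε, H1, H2, H3⟩ : ∃ ε > 0,
      (∀ i u, |u| = 1 → ∀ v, |v| ≤ ε → σ i (u, v) ∈ δ '' ball 0 1) ∧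
      (∀ (i : ι), ∀ u ∈ Icc (-1 : ℝ) 1, ∀ v, |v| ≤ ε → ∀ l, i.1 ≠ l → σ i (u, v) ∉ C l) ∧
      ∀ (i j : ι), i.1 ≠ j.1 → ∀ u ∈ Icc (-1 : ℝ) 1, ∀ u' ∈ Icc (-1 : ℝ) 1, ∀ v, |v| ≤ ε →
        ∀ v', |v'| ≤ ε → σ i (u, v) ≠ σ j (u', v') := by
    have E3' : ∀ᶠ v in 𝓝 ((0, 0) : ℝ × ℝ), ∀ i j : ι, i.1 ≠ j.1 →
        ∀ u ∈ Icc (-1 : ℝ) 1 ×ˢ Icc (-1 : ℝ) 1, σ i (u.1, v.1) ≠ σ j (u.2, v.2) := by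
      refine Filter.eventually_all.2 fun i => Filter.eventually_all.2 fun j => ?_
      by_cases hij : i.1 = j.1
      · exact Filter.Eventually.of_forall fun _ h => absurd hij h
      · filter_upwards [E3 i j hij] with v hv _
        exact hv
    obtain ⟨e1, he1, h1⟩ := Metric.eventually_nhds_iff.1 (Filter.eventually_all.2 E1)
    obtain ⟨e2, he2, h2⟩ := Metric.eventually_nhds_iff.1 (Filter.eventually_all.2 E2)
    obtain ⟨e3, he3, h3⟩ := Metric.eventually_nhds_iff.1 E3'
    have hm : 0 < min e1 (min e2 e3) := lt_min he1 (lt_min he2 he3)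
    have hm1 : min e1 (min e2 e3) ≤ e1 := min_le_left _ _
    have hm2 : min e1 (min e2 e3) ≤ e2 := (min_le_right _ _).trans (min_le_left _ _)
    have hm3 : min e1 (min e2 e3) ≤ e3 := (min_le_right _ _).trans (min_le_right _ _)
    refine ⟨min e1 (min e2 e3) / 2, by linarith, ?_, ?_, ?_⟩
    · intro i u hu v hv
      exact h1 (by rw [dist_zero_right, Real.norm_eq_abs]; linarith) i u hu
    · intro i u hu v hv
      exact h2 (by rw [dist_zero_right, Real.norm_eq_abs]; linarith) i u hu
    · intro i j hij u hu u' hu' v hv v' hv'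
      refine h3 (y := (v, v')) ?_ i j hij (u, u') ⟨hu, hu'⟩
      rw [Prod.dist_eq, max_lt_iff, dist_zero_right, dist_zero_right, Real.norm_eq_abs,
        Real.norm_eq_abs]
      constructor <;> linarith
  have habs : ∀ v ∈ Icc (-1 : ℝ) 1, |ε * v| ≤ ε := fun v hv => by
    rw [abs_mul, abs_of_pos hε]
    exact mul_le_of_le_one_right hε.le (abs_le.2 hv)
  refine ⟨δ, ι, inferInstance, fun i p => σ i (p.1, ε * p.2), f, ⋃ k, C k, ?_⟩
  refine ⟨hδ, fun z => hδU ⟨z, rfl⟩, ?_, ?_, ?_, ?_, ?_, ?_, hfc, hfi, ?_, ?_, ?_⟩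
  · intro b w s hs hw
    exact hKδ (mem_iUnion₂.2 ⟨b, Finset.mem_univ _, ⟨(w, s), ⟨hs, hw⟩, rfl⟩⟩)
  · intro i
    exact (hσc i).comp (by fun_prop)
  · rintro ⟨k, i⟩ ⟨u, v⟩ ⟨hu, hv⟩ ⟨l, j⟩ ⟨u', v'⟩ ⟨hu', hv'⟩ heq
    by_cases hkl : k = l
    · subst hkl
      have h1 := (hτ k).injective heq
      rw [Prod.mk.injEq] at h1
      obtain ⟨h2, h3⟩ := (hg k).2.1 i i.2 j j.2 u hu u' hu' h1.1
      have h4 : v = v' := mul_left_cancel₀ hε.ne' h1.2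
      exact ⟨by rw [Fin.ext h2], Prod.ext h3 h4⟩
    · exact absurd heq (H3 _ _ hkl u hu u' hu' _ (habs v hv) _ (habs v' hv'))
  · rintro ⟨k, i⟩
    refine IsOpenMap.comp (g := τ k) (hτ k).isOpenMap
      (f := Prod.map (fun u => Circle.exp (x k i + η k * u)) (fun v => ε * v))
      (IsOpenMap.prodMap ?_ (Homeomorph.mulLeft₀ ε hε.ne').isOpenMap) _ (isOpen_Ioo.prod isOpen_Ioo)
    exact isLocalHomeomorph_circleExp.isOpenMap.comp
      ((Homeomorph.addLeft (x k i)).isOpenMap.comp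
        (Homeomorph.mulLeft₀ (η k) (hg k).1.ne').isOpenMap)
  · intro i u hu v hv
    exact H1 i u hu _ (habs v hv)
  · intro i p
    exact hτlt _ _
  · intro y hy
    obtain ⟨k, w, rfl⟩ := mem_iUnion.1 hy
    rcases hcov k w with ⟨i, hi, u, hu, rfl⟩ | hw
    · refine Or.inr (mem_iUnion.2 ⟨⟨k, i, hi⟩, (u, 0), ⟨hu, by simp⟩, ?_⟩)
      simp [σ]
    · exact Or.inl hw
  · intro y hy
    obtain ⟨k, w, rfl⟩ := mem_iUnion.1 hy
    exact hτlt _ _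
  · rintro ⟨k, i⟩ u hu v hv hmem
    obtain ⟨l, hl⟩ := mem_iUnion.1 hmem
    have hv1 : v ∈ Icc (-1 : ℝ) 1 := abs_le.1 hv.le
    by_cases hkl : k = l
    · subst hkl
      obtain ⟨w, hw⟩ := hl
      have h1 := (hτ k).injective hw
      rw [Prod.mk.injEq] at h1
      have h2 : v = 0 := by
        have := h1.2.symm
        simpa [hε.ne'] using this
      simp [h2] at hv
    · exact H2 ⟨k, i⟩ u hu _ (habs v hv1) l hkl hl

end

section

/-- Two families of arcs in the plane, parametrized by `[-1, 1]`, are joined by a homotopy through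
families of disjoint simple arcs. -/
def Movable {α : Type*} (γ γ' : α → ℝ → ℂ) : Prop :=
  ∃ H : α → ℝ → ℝ → ℂ, (∀ a, Continuous fun p : ℝ × ℝ => H a p.1 p.2) ∧
    (∀ a, ∀ u ∈ Icc (-1 : ℝ) 1, H a u 0 = γ a u) ∧ (∀ a, ∀ u ∈ Icc (-1 : ℝ) 1, H a u 1 = γ' a u) ∧
    ∀ s ∈ Icc (0 : ℝ) 1, ∀ a, ∀ u ∈ Icc (-1 : ℝ) 1, ∀ b, ∀ v ∈ Icc (-1 : ℝ) 1,
      H a u s = H b v s → a = b ∧ u = v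

variable {α : Type*} {γ γ' γ'' : α → ℝ → ℂ}

theorem Movable.trans (h : Movable γ γ') (h' : Movable γ' γ'') : Movable γ γ'' := by
  obtain ⟨H, hc, h0, h1, hi⟩ := h
  obtain ⟨H', hc', h0', h1', hi'⟩ := h'
  have hcl : ∀ u : ℝ, max (-1) (min u 1) ∈ Icc (-1 : ℝ) 1 := fun u =>
    ⟨le_max_left _ _, max_le (by norm_num) (min_le_right _ _)⟩
  have hcl' : ∀ u ∈ Icc (-1 : ℝ) 1, max (-1) (min u 1) = u := fun u hu => by
    rw [min_eq_left hu.2, max_eq_right hu.1]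
  refine ⟨fun a u s => if s ≤ 1 / 2 then H a (max (-1) (min u 1)) (2 * s)
    else H' a (max (-1) (min u 1)) (2 * s - 1), fun a => ?_, fun a u hu => ?_, fun a u hu => ?_, ?_⟩
  · refine Continuous.if_le (f := fun p : ℝ × ℝ => p.2) (g := fun _ => (1 / 2 : ℝ))
      ((hc a).comp (by fun_prop : Continuous fun p : ℝ × ℝ => (max (-1) (min p.1 1), 2 * p.2)))
      ((hc' a).comp (by fun_prop : Continuous fun p : ℝ × ℝ => (max (-1) (min p.1 1), 2 * p.2 - 1)))
      continuous_snd continuous_const fun p hp => ?_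
    have e1 : 2 * p.2 = 1 := by linarith
    have e2 : 2 * p.2 - 1 = 0 := by linarith
    simp only [e2]
    rw [e1, h1 a _ (hcl _), h0' a _ (hcl _)]
  · simp only
    rw [if_pos (by norm_num), mul_zero, h0 a _ (hcl _), hcl' u hu]
  · simp only
    rw [if_neg (by norm_num), show (2 * 1 - 1 : ℝ) = 1 by norm_num, h1' a _ (hcl _), hcl' u hu]
  · intro s hs a u hu b v hv heq
    simp only [hcl' u hu, hcl' v hv] at heq
    rcases le_or_gt s (1 / 2) with h | h
    · rw [if_pos h, if_pos h] at heq
      exact hi _ ⟨by linarith [hs.1], by linarith⟩ a u hu b v hv heq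
    · rw [if_neg (not_le.2 h), if_neg (not_le.2 h)] at heq
      exact hi' _ ⟨by linarith, by linarith [hs.2]⟩ a u hu b v hv heq

/-- Disjoint simple arcs can be shrunk to subarcs. -/
theorem movable_subarc (hγ : ∀ a, Continuous (γ a))
    (hi : ∀ a, ∀ u ∈ Icc (-1 : ℝ) 1, ∀ b, ∀ v ∈ Icc (-1 : ℝ) 1, γ a u = γ b v → a = b ∧ u = v)
    {m l : α → ℝ} (hl : ∀ a, 0 < l a) (hml : ∀ a, |m a| + l a ≤ 1) :
    Movable γ fun a u => γ a (m a + l a * u) := by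
  refine ⟨fun a u s => γ a (s * m a + (1 - s + s * l a) * u), fun a => ?_, fun a u _ => ?_,
    fun a u _ => ?_, ?_⟩
  · have := hγ a
    fun_prop
  · simp only
    congr 1
    ring
  · simp only
    congr 1
    ring
  · intro s hs a u hu b v hv heq
    have hpos : ∀ a, 0 < 1 - s + s * l a := fun a => by
      rcases eq_or_lt_of_le hs.1 with h | h
      · rw [← h]; norm_num
      · have := mul_pos h (hl a)
        linarith [hs.2]
    have hmem : ∀ a, ∀ u ∈ Icc (-1 : ℝ) 1,
        s * m a + (1 - s + s * l a) * u ∈ Icc (-1 : ℝ) 1 := by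
      intro a u hu
      rw [mem_Icc, ← abs_le] at hu ⊢
      calc |s * m a + (1 - s + s * l a) * u| ≤ s * |m a| + (1 - s + s * l a) * |u| := by
            refine (abs_add_le _ _).trans ?_
            rw [abs_mul, abs_mul, abs_of_nonneg hs.1, abs_of_pos (hpos a)]
        _ ≤ s * |m a| + (1 - s + s * l a) * 1 := by
            gcongr
            exact (hpos a).le
        _ = 1 - s + s * (|m a| + l a) := by ring
        _ ≤ 1 - s + s * 1 := by
            gcongr
            · exact hs.1
            · exact hml a
        _ = 1 := by ring
    obtain ⟨rfl, h2⟩ := hi _ _ (hmem a u hu) _ _ (hmem b v hv) heq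
    exact ⟨rfl, mul_left_cancel₀ (hpos a).ne' (by linarith)⟩

/-- Disjoint straight segments can be moved as long as their directions are shorter than the
distances between their centers. -/
theorem movable_segments {P d : α → ℝ → ℂ} (hP : ∀ a, Continuous (P a))
    (hd : ∀ a, Continuous (d a)) (hd0 : ∀ a, ∀ s ∈ Icc (0 : ℝ) 1, d a s ≠ 0)
    (hPd : ∀ a b, a ≠ b → ∀ s ∈ Icc (0 : ℝ) 1, ‖d a s‖ + ‖d b s‖ < ‖P a s - P b s‖) :
    Movable (fun a u => P a 0 + d a 0 * u) fun a u => P a 1 + d a 1 * u := by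
  refine ⟨fun a u s => P a s + d a s * u, fun a => ?_, fun _ _ _ => rfl, fun _ _ _ => rfl, ?_⟩
  · have := hP a
    have := hd a
    fun_prop
  · intro s hs a u hu b v hv heq
    by_cases hab : a = b
    · subst hab
      refine ⟨rfl, ?_⟩
      have := mul_left_cancel₀ (hd0 a s hs) (add_left_cancel heq)
      exact_mod_cast this
    · exfalso
      have h1 : P a s - P b s = d b s * v - d a s * u := by
        linear_combination heq
      have h2 := hPd a b hab s hs
      rw [h1] at h2
      have h3 : ∀ (z : ℂ) (t : ℝ), t ∈ Icc (-1 : ℝ) 1 → ‖z * t‖ ≤ ‖z‖ := fun z t ht => by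
        rw [norm_mul, Complex.norm_real, Real.norm_eq_abs]
        exact mul_le_of_le_one_right (norm_nonneg _) (abs_le.2 ht)
      have h4 := norm_sub_le (d b s * v) (d a s * u)
      linarith [h3 (d b s) v hv, h3 (d a s) u hu]

theorem exists_extremal_start {g : ℝ → ℝ} (hg : Continuous g) :
    ∃ w ∈ Ico (-1 : ℝ) 1, ∃ e : ℝ, |e| = 1 ∧ ∀ u ∈ Icc w 1, e * g u ≤ e * g w := by
  obtain ⟨w, hw, hmax⟩ := (isCompact_Icc (a := (-1 : ℝ)) (b := 1)).exists_isMaxOn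
    (nonempty_Icc.2 (by norm_num)) hg.continuousOn
  obtain ⟨w', hw', hmin⟩ := (isCompact_Icc (a := (-1 : ℝ)) (b := 1)).exists_isMinOn
    (nonempty_Icc.2 (by norm_num)) hg.continuousOn
  rw [isMaxOn_iff] at hmax
  rw [isMinOn_iff] at hmin
  rcases lt_or_eq_of_le hw.2 with h | h
  · refine ⟨w, ⟨hw.1, h⟩, 1, by simp, fun u hu => ?_⟩
    rw [one_mul, one_mul]
    exact hmax u ⟨hw.1.trans hu.1, hu.2⟩
  rcases lt_or_eq_of_le hw'.2 with h' | h'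
  · refine ⟨w', ⟨hw'.1, h'⟩, -1, by simp, fun u hu => ?_⟩
    have := hmin u ⟨hw'.1.trans hu.1, hu.2⟩
    linarith
  · subst h
    subst h'
    refine ⟨-1, by norm_num, 1, by simp, fun u hu => ?_⟩
    have h1 := hmax u hu
    have h2 := hmin (-1) (by norm_num)
    linarith

/-- Disjoint simple arcs can be straightened. -/
theorem exists_movable_straight [Finite α] (hγ : ∀ a, Continuous (γ a))
    (hi : ∀ a, ∀ u ∈ Icc (-1 : ℝ) 1, ∀ b, ∀ v ∈ Icc (-1 : ℝ) 1, γ a u = γ b v → a = b ∧ u = v)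
    {e : α → ℝ} (he : ∀ a, |e a| = 1)
    (hmax : ∀ a, ∀ u ∈ Icc (-1 : ℝ) 1, e a * (γ a u).re ≤ e a * (γ a (-1)).re) :
    ∃ (P d : α → ℂ) , (∀ a, d a ≠ 0) ∧ Movable γ fun a u => P a + d a * u := by
  classical
  have := Fintype.ofFinite α
  obtain ⟨k, hk, hdist⟩ : ∃ k > 0, ∀ a b, a ≠ b → ∀ u ∈ Icc (-1 : ℝ) 1, ∀ v ∈ Icc (-1 : ℝ) 1,
      2 * k < dist (γ a u) (γ b v) := by
    have h1 : ∀ a b, ∃ k > 0, a ≠ b → ∀ u ∈ Icc (-1 : ℝ) 1, ∀ v ∈ Icc (-1 : ℝ) 1,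
        k ≤ dist (γ a u) (γ b v) := by
      intro a b
      by_cases hab : a = b
      · exact ⟨1, one_pos, fun h => absurd hab h⟩
      have hpos : ∀ p ∈ Icc (-1 : ℝ) 1 ×ˢ Icc (-1 : ℝ) 1, 0 < dist (γ a p.1) (γ b p.2) := by
        rintro ⟨u, v⟩ ⟨hu, hv⟩
        exact dist_pos.2 fun h => hab (hi a u hu b v hv h).1
      have hγa := hγ a
      have hγb := hγ b
      obtain ⟨p, hp, hmin⟩ := ((isCompact_Icc (a := (-1 : ℝ)) (b := 1)).prod
        (isCompact_Icc (a := (-1 : ℝ)) (b := 1))).exists_isMinOn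
        ⟨((0 : ℝ), (0 : ℝ)), by norm_num, by norm_num⟩
        (f := fun p : ℝ × ℝ => dist (γ a p.1) (γ b p.2)) (by fun_prop)
      exact ⟨_, hpos p hp, fun _ u hu v hv => isMinOn_iff.1 hmin (u, v) ⟨hu, hv⟩⟩
    choose k hk hk' using h1
    obtain ⟨k₀, hk₀, hle⟩ : ∃ k₀ > 0, ∀ q : α × α, k₀ ≤ k q.1 q.2 := by
      rcases isEmpty_or_nonempty (α × α) with hE | hE
      · exact ⟨1, one_pos, fun q => (hE.false q).elim⟩
      · obtain ⟨q, hq⟩ := Finite.exists_min fun q : α × α => k q.1 q.2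
        exact ⟨_, hk q.1 q.2, hq⟩
    refine ⟨k₀ / 3, by linarith, fun a b hab u hu v hv => ?_⟩
    have := hk' a b hab u hu v hv
    have := hle (a, b)
    simp only at this
    linarith
  let Γ : α → ℝ → ℂ := fun a t => γ a (max t (-1)) + (e a * max (-1 - t) 0 : ℝ)
  have hΓc : ∀ a, Continuous (Γ a) := fun a => by
    have := hγ a
    fun_prop
  have hΓ1 : ∀ a t, -1 ≤ t → Γ a t = γ a t := fun a t ht => by
    simp only [Γ, max_eq_left ht, max_eq_right (by linarith : -1 - t ≤ 0)]
    simp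
  have hΓ2 : ∀ a t, t ≤ -1 → Γ a t = γ a (-1) + (e a * (-1 - t) : ℝ) := fun a t ht => by
    simp only [Γ, max_eq_right ht, max_eq_left (by linarith : 0 ≤ -1 - t)]
  have hee : ∀ a, e a * e a = 1 := fun a => by
    rw [← abs_mul_abs_self, he a, one_mul]
  have he0 : ∀ a, e a ≠ 0 := fun a h => by
    have := he a
    simp [h] at this
  have hΓinj : ∀ a t t', t ≤ 1 → t' ≤ 1 → Γ a t = Γ a t' → t = t' := by
    have hx : ∀ a t t', t < -1 → -1 ≤ t' → t' ≤ 1 → Γ a t ≠ Γ a t' := by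
      intro a t t' ht ht' ht1 heq
      rw [hΓ1 a t' ht', hΓ2 a t ht.le] at heq
      have h1 := hmax a t' ⟨ht', ht1⟩
      rw [← heq, Complex.add_re, Complex.ofReal_re, mul_add, ← mul_assoc, hee] at h1
      linarith
    intro a t t' ht ht' heq
    rcases lt_or_ge t (-1) with h | h <;> rcases lt_or_ge t' (-1) with h' | h'
    · rw [hΓ2 a t h.le, hΓ2 a t' h'.le] at heq
      have := add_left_cancel heq
      have := mul_left_cancel₀ (he0 a) (Complex.ofReal_injective this)
      linarith
    · exact absurd heq (hx a t t' h h' ht')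
    · exact absurd heq.symm (hx a t' t h' h ht)
    · rw [hΓ1 a t h, hΓ1 a t' h'] at heq
      exact (hi a t ⟨h, ht⟩ a t' ⟨h', ht'⟩ heq).2
  have hΓdist : ∀ a t, -1 - k ≤ t → t ≤ 1 → ∃ u ∈ Icc (-1 : ℝ) 1, dist (γ a u) (Γ a t) ≤ k := by
    intro a t ht ht1
    rcases le_total (-1) t with h | h
    · exact ⟨t, ⟨h, ht1⟩, by rw [hΓ1 a t h, dist_self]; exact hk.le⟩
    · refine ⟨-1, by norm_num, ?_⟩
      rw [hΓ2 a t h, dist_self_add_right, Complex.norm_real, Real.norm_eq_abs, abs_mul, he a,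
        one_mul, abs_of_nonneg (by linarith)]
      linarith
  refine ⟨fun a => γ a (-1) + (e a * (k / 2) : ℝ), fun a => (e a * (-k / 2) : ℝ), fun a => ?_,
    fun a u s => Γ a ((1 - s) * u + s * (-1 - k + k * (u + 1) / 2)), fun a => ?_, fun a u hu => ?_,
    fun a u hu => ?_, ?_⟩
  · have : e a * (-k / 2) ≠ 0 := mul_ne_zero (he0 a) (by linarith)
    exact Complex.ofReal_ne_zero.2 this
  · have := hΓc a
    fun_prop
  · simp only
    rw [← hΓ1 a u hu.1]
    congr 1
    ring
  · simp only
    have h1 := hu.2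
    rw [hΓ2 a _ (by nlinarith), add_assoc, ← Complex.ofReal_mul, ← Complex.ofReal_add]
    congr 2
    ring
  · intro s hs a u hu b v hv heq
    have hpos : 0 < 1 - s + s * (k / 2) := by
      rcases eq_or_lt_of_le hs.1 with h | h
      · rw [← h]; norm_num
      · have := mul_pos h (half_pos hk)
        linarith [hs.2]
    have hr : ∀ u ∈ Icc (-1 : ℝ) 1, -1 - k ≤ (1 - s) * u + s * (-1 - k + k * (u + 1) / 2) ∧
        (1 - s) * u + s * (-1 - k + k * (u + 1) / 2) ≤ 1 := by
      intro u hu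
      obtain ⟨hu1, hu2⟩ := hu
      obtain ⟨hs1, hs2⟩ := hs
      have h1 : (1 - s) * u + s * (-1 - k + k * (u + 1) / 2) =
        (1 - s + s * (k / 2)) * u + s * (-1 - k / 2) := by ring
      rw [h1]
      constructor <;> nlinarith [mul_nonneg hs1 hk.le]
    obtain ⟨hu1, hu2⟩ := hr u hu
    obtain ⟨hv1, hv2⟩ := hr v hv
    by_cases hab : a = b
    · subst hab
      have := hΓinj a _ _ hu2 hv2 heq
      refine ⟨rfl, mul_left_cancel₀ hpos.ne' ?_⟩
      linarith
    · exfalso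
      obtain ⟨x, hx, hx'⟩ := hΓdist a _ hu1 hu2
      obtain ⟨y, hy, hy'⟩ := hΓdist b _ hv1 hv2
      have h1 := hdist a b hab x hx y hy
      simp only at heq
      rw [← heq] at hy'
      have h2 := dist_triangle_right (γ a x) (γ b y)
        (Γ a ((1 - s) * u + s * (-1 - k + k * (u + 1) / 2)))
      linarith

/-- Injective families of points are joined through a third one by straight lines along which
points never meet. -/
theorem exists_generic_points [Finite α] {P Q : α → ℂ} (hP : Function.Injective P)
    (hQ : Function.Injective Q) : ∃ T : α → ℂ, ∀ a b, a ≠ b → ∀ s : ℝ,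
      (1 - s) * P a + s * T a ≠ (1 - s) * P b + s * T b ∧
      (1 - s) * Q a + s * T a ≠ (1 - s) * Q b + s * T b := by
  classical
  obtain ⟨m, ⟨n⟩⟩ := Finite.exists_equiv_fin α
  obtain ⟨y, hy⟩ := ((finite_range fun p : α × α => (P p.1 - P p.2).im / (P p.1 - P p.2).re).union
    (finite_range fun p : α × α => (Q p.1 - Q p.2).im / (Q p.1 - Q p.2).re)).exists_notMem
  have key : ∀ R : α → ℂ, Function.Injective R →
      (∀ p : α × α, y ≠ (R p.1 - R p.2).im / (R p.1 - R p.2).re) → ∀ a b, a ≠ b → ∀ s : ℝ,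
      (1 - s) * R a + s * (((n a : ℕ) : ℝ) * (⟨1, y⟩ : ℂ)) ≠
        (1 - s) * R b + s * (((n b : ℕ) : ℝ) * (⟨1, y⟩ : ℂ)) := by
    intro R hR hyR a b hab s heq
    have hn : ((n a : ℕ) : ℝ) ≠ ((n b : ℕ) : ℝ) := fun h =>
      hab (n.injective (Fin.ext (Nat.cast_injective h)))
    have hne : R a - R b ≠ 0 := sub_ne_zero.2 fun h => hab (hR h)
    have hyab := hyR (a, b)
    have e1 := congrArg Complex.re heq
    have e2 := congrArg Complex.im heq
    simp only [Complex.add_re, Complex.mul_re, Complex.sub_re, Complex.one_re, Complex.ofReal_re,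
      Complex.sub_im, Complex.one_im, Complex.ofReal_im, Complex.add_im, Complex.mul_im] at e1 e2
    simp only [Complex.sub_re, Complex.sub_im] at hyab
    have f1 : (1 - s) * ((R a).re - (R b).re) + s * (((n a : ℕ) : ℝ) - ((n b : ℕ) : ℝ)) = 0 := by
      linarith
    have f2 : (1 - s) * ((R a).im - (R b).im)
        + s * (((n a : ℕ) : ℝ) - ((n b : ℕ) : ℝ)) * y = 0 := by
      linarith
    have hs1 : 1 - s ≠ 0 := by
      intro h
      have hs : s = 1 := by linarith
      rw [hs] at f1
      exact hn (by linarith)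
    have f3 : (1 - s) * (((R a).im - (R b).im) - ((R a).re - (R b).re) * y) = 0 := by
      linear_combination f2 - y * f1
    have f4 : (R a).im - (R b).im = ((R a).re - (R b).re) * y := by
      linarith [(mul_eq_zero.1 f3).resolve_left hs1]
    by_cases h0 : (R a).re - (R b).re = 0
    · rw [h0, zero_mul] at f4
      exact hne (Complex.ext h0 f4)
    · exact hyab (by rw [f4, mul_div_cancel_left₀ _ h0])
  refine ⟨fun a => ((n a : ℕ) : ℝ) * (⟨1, y⟩ : ℂ), fun a b hab s => ⟨?_, ?_⟩⟩
  · exact key P hP (fun p h => hy (Or.inl ⟨p, h.symm⟩)) a b hab s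
  · exact key Q hQ (fun p h => hy (Or.inr ⟨p, h.symm⟩)) a b hab s

theorem exists_separation [Finite α] {P : α → ℝ → ℂ} (hP : ∀ a, Continuous (P a))
    (hne : ∀ a b, a ≠ b → ∀ s ∈ Icc (0 : ℝ) 1, P a s ≠ P b s) :
    ∃ k > 0, ∀ a b, a ≠ b → ∀ s ∈ Icc (0 : ℝ) 1, k ≤ ‖P a s - P b s‖ := by
  classical
  have h1 : ∀ q : α × α, ∃ k > 0, q.1 ≠ q.2 → ∀ s ∈ Icc (0 : ℝ) 1, k ≤ ‖P q.1 s - P q.2 s‖ := by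
    rintro ⟨a, b⟩
    by_cases hab : a = b
    · exact ⟨1, one_pos, fun h => absurd hab h⟩
    have hPa := hP a
    have hPb := hP b
    obtain ⟨s, hs, hmin⟩ := (isCompact_Icc (a := (0 : ℝ)) (b := 1)).exists_isMinOn
      (nonempty_Icc.2 (by norm_num)) (f := fun s => ‖P a s - P b s‖) (by fun_prop)
    exact ⟨_, norm_pos_iff.2 (sub_ne_zero.2 (hne a b hab s hs)), fun _ t ht =>
      isMinOn_iff.1 hmin t ht⟩
  choose k hk hk' using h1
  rcases isEmpty_or_nonempty (α × α) with hE | hE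
  · exact ⟨1, one_pos, fun a b => (hE.false (a, b)).elim⟩
  · obtain ⟨q, hq⟩ := Finite.exists_min k
    exact ⟨_, hk q, fun a b hab s hs => (hq (a, b)).trans (hk' (a, b) hab s hs)⟩

/-- Disjoint straight segments can be made parallel, of given length, with given centers. -/
theorem movable_segments_standard [Finite α] {P d Q : α → ℂ} {r : ℝ} (hd : ∀ a, d a ≠ 0)
    (hi : ∀ a, ∀ u ∈ Icc (-1 : ℝ) 1, ∀ b, ∀ v ∈ Icc (-1 : ℝ) 1,
      P a + d a * u = P b + d b * v → a = b ∧ u = v)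
    (hr : 0 < r) (hQ : ∀ a b, a ≠ b → 2 * r < ‖Q a - Q b‖) :
    Movable (fun a u => P a + d a * u) fun a u => Q a + r * u := by
  classical
  have hPi : Function.Injective P := fun a b hab =>
    (hi a 0 (by norm_num) b 0 (by norm_num) (by simpa using hab)).1
  have hQi : Function.Injective Q := fun a b hab => by
    by_contra h
    have := hQ a b h
    rw [hab, sub_self, norm_zero] at this
    linarith
  obtain ⟨T, hT⟩ := exists_generic_points hPi hQi
  obtain ⟨k, hk, hPT⟩ := exists_separation (P := fun a s => (1 - s) * P a + s * T a)
    (fun a => by fun_prop) fun a b hab s _ => (hT a b hab s).1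
  obtain ⟨k', hk', hQT⟩ := exists_separation (P := fun a s => (1 - s) * Q a + s * T a)
    (fun a => by fun_prop) fun a b hab s _ => (hT a b hab s).2
  obtain ⟨D, hD0, hD⟩ : ∃ D > 0, ∀ a, D ≤ ‖d a‖ := by
    rcases isEmpty_or_nonempty α with hE | hE
    · exact ⟨1, one_pos, fun a => (hE.false a).elim⟩
    · obtain ⟨a, ha⟩ := Finite.exists_min fun a => ‖d a‖
      exact ⟨_, norm_pos_iff.2 (hd a), ha⟩
  obtain ⟨ρ, hρ, hρD, hρk, hρk', hρr⟩ :
      ∃ ρ > 0, ρ ≤ D ∧ 2 * ρ < k ∧ 2 * ρ < k' ∧ ρ ≤ r := by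
    refine ⟨min (min D r) (min (k / 3) (k' / 3)), by positivity, ?_, ?_, ?_, ?_⟩
    · exact (min_le_left _ _).trans (min_le_left _ _)
    · have := (min_le_right (min D r) (min (k / 3) (k' / 3))).trans (min_le_left _ _)
      linarith
    · have := (min_le_right (min D r) (min (k / 3) (k' / 3))).trans (min_le_right _ _)
      linarith
    · exact (min_le_left _ _).trans (min_le_right _ _)
  let ω : α → ℝ → ℂ := fun a s => Complex.exp (((1 - s) * Complex.arg (d a) : ℝ) * Complex.I)
  have hω : ∀ a s, ‖ω a s‖ = 1 := fun a s => Complex.norm_exp_ofReal_mul_I _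
  have hω0 : ∀ a s, ω a s ≠ 0 := fun a s h => by
    have := hω a s
    simp [h] at this
  have hρω : ∀ a, ‖(ρ : ℂ) * ω a 0‖ = ρ := fun a => by
    rw [norm_mul, hω, mul_one, Complex.norm_real, Real.norm_of_nonneg hρ.le]
  have hρ0 : (ρ : ℂ) ≠ 0 := by exact_mod_cast hρ.ne'
  have m1 : Movable (fun a u => P a + d a * u) fun a u => P a + (ρ * ω a 0) * u := by
    have := movable_subarc (γ := fun a u => P a + d a * u) (fun a => by fun_prop) hi
      (m := fun _ => 0) (l := fun a => ρ / ‖d a‖)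
      (fun a => div_pos hρ (norm_pos_iff.2 (hd a))) (fun a => by
        rw [abs_zero, zero_add]
        exact div_le_one_of_le₀ (hρD.trans (hD a)) (norm_nonneg _))
    convert this using 3 with a u
    have h1 := Complex.norm_mul_exp_arg_mul_I (d a)
    have h2 : (‖d a‖ : ℂ) ≠ 0 := by exact_mod_cast (norm_pos_iff.2 (hd a)).ne'
    have h3 : ω a 0 = d a / ‖d a‖ := by
      simp only [ω, sub_zero, one_mul]
      rw [eq_div_iff h2, mul_comm]
      exact h1
    rw [h3]
    push_cast
    field_simp
    ring
  have m2 : Movable (fun a u => P a + (ρ * ω a 0) * u) fun a u => T a + (ρ * ω a 0) * u := by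
    have := movable_segments (P := fun a s => (1 - s) * P a + s * T a)
      (d := fun a _ => ρ * ω a 0) (fun a => by fun_prop) (fun a => by fun_prop)
      (fun a s _ => mul_ne_zero hρ0 (hω0 _ _)) fun a b hab s hs => by
        rw [hρω, hρω]
        linarith [hPT a b hab s hs]
    simpa using this
  have m3 : Movable (fun a u => T a + (ρ * ω a 0) * u) fun a u => Q a + (ρ * ω a 0) * u := by
    have := movable_segments (P := fun a s => (1 - (1 - s : ℝ)) * Q a + (1 - s : ℝ) * T a)
      (d := fun a _ => ρ * ω a 0) (fun a => by fun_prop) (fun a => by fun_prop)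
      (fun a s _ => mul_ne_zero hρ0 (hω0 _ _)) fun a b hab s hs => by
        rw [hρω, hρω]
        linarith [hQT a b hab (1 - s) ⟨by linarith [hs.2], by linarith [hs.1]⟩]
    simpa using this
  have m4 : Movable (fun a u => Q a + (ρ * ω a 0) * u) fun a u => Q a + r * u := by
    have hn : ∀ s ∈ Icc (0 : ℝ) 1, 0 < (1 - s) * ρ + s * r ∧ (1 - s) * ρ + s * r ≤ r := by
      rintro s ⟨hs0, hs1⟩
      constructor
      · nlinarith
      · nlinarith
    have := movable_segments (P := fun a _ => Q a)
      (d := fun a s => (((1 - s) * ρ + s * r : ℝ) : ℂ) * ω a s) (fun a => by fun_prop)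
      (fun a => by fun_prop)
      (fun a s hs => mul_ne_zero (by exact_mod_cast (hn s hs).1.ne') (hω0 _ _))
      fun a b hab s hs => by
        rw [norm_mul, norm_mul, hω, hω, Complex.norm_real, Real.norm_of_nonneg (hn s hs).1.le]
        linarith [hQ a b hab, (hn s hs).2]
    have hω1 : ∀ a, ω a 1 = 1 := fun a => by simp [ω]
    simpa [hω1] using this
  exact ((m1.trans m2).trans m3).trans m4

/-- Any finite family of disjoint simple arcs can be moved to parallel straight segments. -/
theorem movable_standard [Finite α] (hγ : ∀ a, ContinuousOn (γ a) (Icc (-1) 1))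
    (hi : ∀ a, ∀ u ∈ Icc (-1 : ℝ) 1, ∀ b, ∀ v ∈ Icc (-1 : ℝ) 1, γ a u = γ b v → a = b ∧ u = v)
    {Q : α → ℂ} {r : ℝ} (hr : 0 < r) (hQ : ∀ a b, a ≠ b → 2 * r < ‖Q a - Q b‖) :
    Movable γ fun a u => Q a + r * u := by
  have hcl : ∀ u : ℝ, max (-1) (min u 1) ∈ Icc (-1 : ℝ) 1 := fun u =>
    ⟨le_max_left _ _, max_le (by norm_num) (min_le_right _ _)⟩
  have hcl' : ∀ u ∈ Icc (-1 : ℝ) 1, max (-1) (min u 1) = u := fun u hu => by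
    rw [min_eq_left hu.2, max_eq_right hu.1]
  let g : α → ℝ → ℂ := fun a u => γ a (max (-1) (min u 1))
  have hg : ∀ a, Continuous (g a) := fun a => (hγ a).comp_continuous (by fun_prop) hcl
  have hgi : ∀ a, ∀ u ∈ Icc (-1 : ℝ) 1, ∀ b, ∀ v ∈ Icc (-1 : ℝ) 1,
      g a u = g b v → a = b ∧ u = v := by
    intro a u hu b v hv h
    simp only [g, hcl' u hu, hcl' v hv] at h
    exact hi a u hu b v hv h
  choose w hw e he hmax using fun a => exists_extremal_start (g := fun u => (g a u).re)
    (Complex.continuous_re.comp (hg a))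
  have hmem : ∀ a, ∀ u ∈ Icc (-1 : ℝ) 1, (1 + w a) / 2 + (1 - w a) / 2 * u ∈ Icc (w a) 1 := by
    intro a u hu
    have h1 := (hw a).2
    constructor <;> nlinarith [hu.1, hu.2]
  have h1 := movable_subarc hg hgi (m := fun a => (1 + w a) / 2) (l := fun a => (1 - w a) / 2)
    (fun a => by linarith [(hw a).2]) (fun a => by
      rw [abs_of_nonneg (by linarith [(hw a).1])]
      linarith)
  have hi' : ∀ a, ∀ u ∈ Icc (-1 : ℝ) 1, ∀ b, ∀ v ∈ Icc (-1 : ℝ) 1,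
      g a ((1 + w a) / 2 + (1 - w a) / 2 * u) = g b ((1 + w b) / 2 + (1 - w b) / 2 * v) →
        a = b ∧ u = v := by
    intro a u hu b v hv h
    obtain ⟨rfl, h2⟩ := hgi a _ ⟨(hw a).1.trans (hmem a u hu).1, (hmem a u hu).2⟩ b _
      ⟨(hw b).1.trans (hmem b v hv).1, (hmem b v hv).2⟩ h
    have : 0 < (1 - w a) / 2 := by linarith [(hw a).2]
    exact ⟨rfl, mul_left_cancel₀ this.ne' (by linarith)⟩
  obtain ⟨P, d, hd, h2⟩ := exists_movable_straight
    (γ := fun a u => g a ((1 + w a) / 2 + (1 - w a) / 2 * u))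
    (fun a => (hg a).comp (by fun_prop)) hi' he (fun a u hu => by
      have := hmax a _ (hmem a u hu)
      have e1 : (1 + w a) / 2 + (1 - w a) / 2 * -1 = w a := by ring
      simp only [e1]
      exact this)
  have h3 : ∀ a, ∀ u ∈ Icc (-1 : ℝ) 1, ∀ b, ∀ v ∈ Icc (-1 : ℝ) 1,
      P a + d a * u = P b + d b * v → a = b ∧ u = v := by
    obtain ⟨H, -, -, hH1, hHi⟩ := h2
    intro a u hu b v hv h
    exact hHi 1 (by norm_num) a u hu b v hv (by rw [hH1 a u hu, hH1 b v hv]; exact h)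
  obtain ⟨H, hHc, hH0, hH1, hHi⟩ := (h1.trans h2).trans (movable_segments_standard hd h3 hr hQ)
  exact ⟨H, hHc, fun a u hu => by rw [hH0 a u hu]; simp only [g, hcl' u hu], hH1, hHi⟩

end

/-- Define a map on the union of a finite family of compact pieces by its values on parameters. -/
theorem exists_factor_of_family {β P V Y : Type*} [Finite β] [TopologicalSpace P]
    [TopologicalSpace V] [T2Space V] [TopologicalSpace Y] [Nonempty Y] {K : Set P}
    (hK : IsCompact K) {c : β → P → V} (hc : ∀ b, ContinuousOn (c b) K) {g : β → P → Y}
    (hg : ∀ b, ContinuousOn (g b) K)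
    (hcg : ∀ b, ∀ p ∈ K, ∀ b', ∀ p' ∈ K, c b p = c b' p' → g b p = g b' p') :
    ∃ F : V → Y, ContinuousOn F (⋃ b, c b '' K) ∧ ∀ b, ∀ p ∈ K, F (c b p) = g b p := by
  let _ : TopologicalSpace β := ⊥
  have : DiscreteTopology β := ⟨rfl⟩
  have hc' : ContinuousOn (fun q : β × P => c q.1 q.2) (univ ×ˢ K) :=
    continuousOn_prod_of_discrete_left.2 fun b => (hc b).mono fun p hp => hp.2
  have hg' : ContinuousOn (fun q : β × P => g q.1 q.2) (univ ×ˢ K) :=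
    continuousOn_prod_of_discrete_left.2 fun b => (hg b).mono fun p hp => hp.2
  obtain ⟨F, hF, hF'⟩ := exists_factor_of_isCompact (K := (univ : Set β) ×ˢ K)
    (ρ := fun q => c q.1 q.2) (g := fun q => g q.1 q.2) (isCompact_univ.prod hK) hc' hg'
    fun q hq q' hq' h => hcg _ _ hq.2 _ _ hq'.2 h
  refine ⟨F, hF.mono ?_, fun b p hp => hF' (b, p) ⟨mem_univ _, hp⟩⟩
  intro x hx
  obtain ⟨b, p, hp, rfl⟩ := mem_iUnion.1 hx
  exact ⟨(b, p), ⟨mem_univ _, hp⟩, rfl⟩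

/-- Euclidean coordinates adapted to the hub: `p` is the planar position and `z` the depth. -/
def hubPoint (K : ℝ) (p : ℂ) (z : ℝ) : ℂ × ℝ := (⟨K - z, p.im⟩, p.re)

theorem hubPoint_inj {K : ℝ} {p p' : ℂ} {z z' : ℝ} (h : hubPoint K p z = hubPoint K p' z') :
    p = p' ∧ z = z' := by
  simp only [hubPoint, Prod.mk.injEq, Complex.ext_iff] at h
  exact ⟨Complex.ext h.2 h.1.2, by linarith [h.1.1]⟩

theorem continuous_hubPoint (K : ℝ) : Continuous fun q : ℂ × ℝ => hubPoint K q.1 q.2 := by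
  have h : (fun q : ℂ × ℝ => hubPoint K q.1 q.2) =
      fun q : ℂ × ℝ => (((K - q.2 : ℝ) : ℂ) + (q.1.im : ℂ) * Complex.I, q.1.re) := by
    funext q
    simp only [hubPoint, Prod.mk.injEq, and_true]
    rw [Complex.mk_eq_add_mul_I]
  rw [h]
  fun_prop

/-- The sign of an end of a band. -/
def endSign (ε : Bool) : ℝ := if ε then 1 else -1

/-- Extend a pair of legs by an arch. -/
noncomputable def archPath (H : Bool → ℝ → ℝ → ℂ) (n r u v : ℝ) : ℂ :=
  if v ≤ -1 / 2 then H false u (2 + 2 * v) else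
    if 1 / 2 ≤ v then H true u (2 - 2 * v) else n + r * u + (2 * v : ℝ) * Complex.I

theorem archPath_outer {H : Bool → ℝ → ℝ → ℂ} {n r u v : ℝ} (hv : 1 / 2 ≤ |v|) :
    archPath H n r u v = H (decide (0 ≤ v)) u (2 - 2 * |v|) := by
  rcases le_abs.1 hv with h | h
  · rw [archPath, if_neg (by linarith), if_pos h, abs_of_nonneg (by linarith)]
    simp [show 0 ≤ v by linarith]
  · rw [archPath, if_pos (by linarith), abs_of_neg (by linarith)]
    simp [show ¬ 0 ≤ v by linarith]

theorem archPath_inner {H : Bool → ℝ → ℝ → ℂ} {n r u v : ℝ} (hv : |v| < 1 / 2) :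
    archPath H n r u v = n + r * u + (2 * v : ℝ) * Complex.I := by
  rw [abs_lt] at hv
  rw [archPath, if_neg (by linarith), if_neg (by linarith)]

theorem continuousOn_archPath {H : Bool → ℝ → ℝ → ℂ}
    (hH : ∀ ε, Continuous fun p : ℝ × ℝ => H ε p.1 p.2) {n r : ℝ}
    (h1 : ∀ ε, ∀ u ∈ Icc (-1 : ℝ) 1, H ε u 1 = n + endSign ε * Complex.I + r * u) :
    ContinuousOn (fun p : ℝ × ℝ => archPath H n r p.1 p.2)
      (Icc (-1 : ℝ) 1 ×ˢ Icc (-1 : ℝ) 1) := by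
  have hcl : ∀ u : ℝ, max (-1) (min u 1) ∈ Icc (-1 : ℝ) 1 := fun u =>
    ⟨le_max_left _ _, max_le (by norm_num) (min_le_right _ _)⟩
  have hcl' : ∀ u ∈ Icc (-1 : ℝ) 1, max (-1) (min u 1) = u := fun u hu => by
    rw [min_eq_left hu.2, max_eq_right hu.1]
  have hc : Continuous fun p : ℝ × ℝ => archPath H n r (max (-1) (min p.1 1)) p.2 := by
    have hf := hH false
    have ht := hH true
    refine Continuous.if_le (f := fun p : ℝ × ℝ => p.2) (g := fun _ => (-1 / 2 : ℝ))
      (hf.comp (by fun_prop : Continuous fun p : ℝ × ℝ => (max (-1) (min p.1 1), 2 + 2 * p.2)))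
      (Continuous.if_le (f := fun _ => (1 / 2 : ℝ)) (g := fun p : ℝ × ℝ => p.2)
        (ht.comp (by fun_prop : Continuous fun p : ℝ × ℝ => (max (-1) (min p.1 1), 2 - 2 * p.2)))
        (by fun_prop) continuous_const continuous_snd ?_)
      continuous_snd continuous_const ?_
    · intro p hp
      have e1 : 2 - 2 * p.2 = 1 := by linarith
      have e2 : 2 * p.2 = 1 := by linarith
      simp only [e1]
      rw [h1 true _ (hcl _), e2]
      simp [endSign]
      ring
    · intro p hp
      have e1 : 2 + 2 * p.2 = 1 := by linarith
      have e2 : 2 * p.2 = -1 := by linarith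
      simp only [e1]
      rw [h1 false _ (hcl _), e2, if_neg (by linarith)]
      simp [endSign]
      ring
  refine hc.continuousOn.congr fun p hp => ?_
  simp only
  rw [hcl' _ hp.1]

theorem archPath_re_pos {H : Bool → ℝ → ℝ → ℂ} {n r : ℝ} (hn : 1 ≤ n) (hr : 0 < r)
    (hr1 : r ≤ 1 / 8)
    (h1 : ∀ ε, ∀ u ∈ Icc (-1 : ℝ) 1, H ε u 1 = n + endSign ε * Complex.I + r * u) {u v : ℝ}
    (hu : u ∈ Icc (-1 : ℝ) 1) (hv : |v| ≤ 1 / 2) : 0 < (archPath H n r u v).re := by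
  have h2 : (archPath H n r u v).re = n + r * u := by
    rcases lt_or_eq_of_le hv with h | h
    · rw [archPath_inner h]; simp
    · rw [archPath_outer h.ge, h, show (2 - 2 * (1 / 2) : ℝ) = 1 by norm_num, h1 _ u hu]; simp
  rw [h2]
  nlinarith [hu.1, hu.2]

theorem archPath_injective {ι : Type*} {H : ι × Bool → ℝ → ℝ → ℂ} {n : ι → ℝ} {r : ℝ}
    (hHi : ∀ s ∈ Icc (0 : ℝ) 1, ∀ a, ∀ u ∈ Icc (-1 : ℝ) 1, ∀ b, ∀ v ∈ Icc (-1 : ℝ) 1,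
      H a u s = H b v s → a = b ∧ u = v)
    (hn : ∀ i j, i ≠ j → 1 ≤ |n i - n j|) (hr : 0 < r) (hr1 : r ≤ 1 / 8) {K : ℝ} {i j : ι}
    {u v u' v' : ℝ} (hu : u ∈ Icc (-1 : ℝ) 1) (hv : v ∈ Icc (-1 : ℝ) 1)
    (hu' : u' ∈ Icc (-1 : ℝ) 1)
    (h : hubPoint K (archPath (fun ε => H (i, ε)) (n i) r u v) (2 - 2 * |v|) =
      hubPoint K (archPath (fun ε => H (j, ε)) (n j) r u' v') (2 - 2 * |v'|)) :
    i = j ∧ u = u' ∧ v = v' := by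
  obtain ⟨h1, h2⟩ := hubPoint_inj h
  have h3 : |v| = |v'| := by linarith
  rcases le_or_gt (1 / 2) |v| with hv2 | hv2
  · rw [archPath_outer hv2, archPath_outer (h3 ▸ hv2), h3] at h1
    have h5 : |v'| ≤ 1 := h3 ▸ abs_le.2 hv
    obtain ⟨h4, h4'⟩ := hHi (2 - 2 * |v'|) ⟨by linarith, by linarith⟩ _ u hu _ u' hu' h1
    rw [Prod.mk.injEq, decide_eq_decide] at h4
    refine ⟨h4.1, h4', ?_⟩
    rcases le_or_gt 0 v with h0 | h0
    · rwa [abs_of_nonneg h0, abs_of_nonneg (h4.2.1 h0)] at h3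
    · have h0' : v' < 0 := not_le.1 fun hh => not_le.2 h0 (h4.2.2 hh)
      rw [abs_of_neg h0, abs_of_neg h0'] at h3
      linarith
  · rw [archPath_inner hv2, archPath_inner (h3 ▸ hv2)] at h1
    have e1 := congrArg Complex.re h1
    have e2 := congrArg Complex.im h1
    simp at e1 e2
    have hij : i = j := by
      by_contra hij
      have h6 := hn i j hij
      have h7 : n i - n j = r * (u' - u) := by linarith
      rw [h7, abs_mul, abs_of_pos hr] at h6
      have h8 : |u' - u| ≤ 2 := abs_le.2 ⟨by linarith [hu.2, hu'.1], by linarith [hu.1, hu'.2]⟩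
      nlinarith
    subst hij
    exact ⟨rfl, mul_left_cancel₀ hr.ne' (by linarith), e2⟩

section

variable {V : Type} [TopologicalSpace V] {β : Type} {ht : V → ℝ} {c : β → Circle → ℝ → V}
  {κ : ℝ} {δ : ℂ → V} {ι : Type} {ρ : ι → ℝ × ℝ → V} {f : V → ℂ} {Γ : Set V}

/-- Embed the part of a hub below height `1` in space by lifting the bands along arches. -/
theorem IsHub.exists_core (hh : IsHub ht c κ δ ρ f Γ) (hht : Continuous ht) [T2Space V] [Finite ι]
    {H : ι × Bool → ℝ → ℝ → ℂ} (hHc : ∀ a, Continuous fun p : ℝ × ℝ => H a p.1 p.2)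
    {n : ι → ℝ} {r : ℝ}
    (hH0 : ∀ a, ∀ u ∈ Icc (-1 : ℝ) 1, H a u 0 = f (ρ a.1 (u, endSign a.2)))
    (hH1 : ∀ a, ∀ u ∈ Icc (-1 : ℝ) 1, H a u 1 = n a.1 + endSign a.2 * Complex.I + r * u)
    (hHi : ∀ s ∈ Icc (0 : ℝ) 1, ∀ a, ∀ u ∈ Icc (-1 : ℝ) 1, ∀ b, ∀ v ∈ Icc (-1 : ℝ) 1,
      H a u s = H b v s → a = b ∧ u = v)
    (hn1 : ∀ i, 1 ≤ n i) (hn : ∀ i j, i ≠ j → 1 ≤ |n i - n j|) (hr : 0 < r) (hr1 : r ≤ 1 / 8)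
    (K : ℝ) :
    ∃ q : V → ℂ × ℝ, ContinuousOn q ({x | ht x ≤ 1} \ δ '' ball 0 1) ∧
      InjOn q ({x | ht x ≤ 1} \ δ '' ball 0 1) ∧
      (∀ x ∉ δ '' ball 0 1, ht x = 1 → q x = hubPoint K (f x) 0) ∧
      ∀ x ∉ δ '' ball 0 1, ht x ≤ 1 → (x ∉ Γ ∧ q x = hubPoint K (f x) 0) ∨
        (∃ a, ∃ u ∈ Icc (-1 : ℝ) 1, ∃ z ∈ Icc (0 : ℝ) 1, q x = hubPoint K (H a u z) z) ∨
        ∃ p z, 1 ≤ z ∧ 0 < Complex.re p ∧ q x = hubPoint K p z := by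
  set J := Icc (-1 : ℝ) 1 with hJ
  have hδo : IsOpen (δ '' ball 0 1) := hh.isOpenEmbedding.isOpenMap _ isOpen_ball
  let G : ι → ℝ × ℝ → ℂ × ℝ := fun i p =>
    hubPoint K (archPath (fun ε => H (i, ε)) (n i) r p.1 p.2) (2 - 2 * |p.2|)
  have hG : ∀ i, ContinuousOn (G i) (J ×ˢ J) := fun i =>
    (continuous_hubPoint K).comp_continuousOn
      ((continuousOn_archPath (fun ε => hHc (i, ε)) fun ε => hH1 (i, ε)).prodMk
        (by fun_prop : Continuous fun p : ℝ × ℝ => 2 - 2 * |p.2|).continuousOn)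
  have hGi : ∀ i, ∀ p ∈ J ×ˢ J, ∀ j, ∀ p' ∈ J ×ˢ J, G i p = G j p' → i = j ∧ p = p' := by
    rintro i ⟨u, v⟩ hp j ⟨u', v'⟩ hp' he
    obtain ⟨h1, h2, h3⟩ := archPath_injective hHi hn hr hr1 hp.1 hp.2 hp'.1 he
    exact ⟨h1, Prod.ext h2 h3⟩
  obtain ⟨g, hgc, hgv⟩ := exists_factor_of_family
    (isCompact_Icc.prod isCompact_Icc : IsCompact (J ×ˢ J))
    (fun i => (hh.continuous_ρ i).continuousOn) hG fun i p hp j p' hp' he => by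
      obtain ⟨rfl, rfl⟩ := hh.ρ_inj i p hp j p' hp' he
      rfl
  let B : Set V := ⋃ i, ρ i '' J ×ˢ J
  let U : Set V := δ '' ball 0 1 ∪ ⋃ i, ρ i '' Ioo (-1 : ℝ) 1 ×ˢ Ioo (-1 : ℝ) 1
  have hU : IsOpen U := hδo.union (isOpen_iUnion hh.ρ_open)
  let A : Set V := {x | ht x ≤ 1} \ U
  have hA : IsClosed A := (isClosed_le hht continuous_const).inter hU.isClosed_compl
  have hB : IsClosed B := isClosed_iUnion_of_finite fun i =>
    ((isCompact_Icc.prod isCompact_Icc).image (hh.continuous_ρ i)).isClosed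
  have hAΓ : A ⊆ {x | ht x ≤ 1} \ Γ := fun x hx => ⟨hx.1, fun h => hx.2 (hh.Γ_subset h)⟩
  have hedge : ∀ i, ∀ u ∈ J, ∀ v, |v| = 1 → G i (u, v) = hubPoint K (f (ρ i (u, v))) 0 := by
    intro i u hu v hv
    simp only [G]
    rw [archPath_outer (by rw [hv]; norm_num), hv, show (2 - 2 * 1 : ℝ) = 0 by norm_num,
      hH0 (i, _) u hu]
    rcases abs_eq (by norm_num : (0 : ℝ) ≤ 1) |>.1 hv with rfl | rfl
    · simp [endSign]
    · simp [endSign, show ¬ (1 : ℝ) ≤ 0 by norm_num]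
  have hkK : Continuous fun p : ℂ => hubPoint K p 0 :=
    (continuous_hubPoint K).comp (by fun_prop : Continuous fun p : ℂ => (p, (0 : ℝ)))
  have hABv : ∀ i, ∀ p ∈ J ×ˢ J, ρ i p ∉ U → |p.2| = 1 := by
    rintro i ⟨u, v⟩ ⟨hu, hv⟩ hx
    by_contra hv1
    have hv' : v ∈ Ioo (-1 : ℝ) 1 := abs_lt.1 (lt_of_le_of_ne (abs_le.2 hv) hv1)
    rcases eq_or_ne |u| 1 with hu1 | hu1
    · exact hx (Or.inl (hh.ρ_end i u hu1 v hv))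
    · exact hx (Or.inr (mem_iUnion.2
        ⟨i, _, ⟨abs_lt.1 (lt_of_le_of_ne (abs_le.2 hu) hu1), hv'⟩, rfl⟩))
  obtain ⟨q, hqc, hqi, hqA, hqB⟩ := exists_glue (f := fun x => hubPoint K (f x) 0) (g := g) hA hB
    (hkK.comp_continuousOn (hh.continuousOn_f.mono hAΓ)) hgc
    (fun x hx y hy he => hh.injOn_f (hAΓ hx) (hAΓ hy) (hubPoint_inj he).1)
    (by
      intro x hx y hy he
      obtain ⟨i, p, hp, rfl⟩ := mem_iUnion.1 hx
      obtain ⟨j, p', hp', rfl⟩ := mem_iUnion.1 hy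
      rw [hgv i p hp, hgv j p' hp'] at he
      obtain ⟨rfl, rfl⟩ := hGi i p hp j p' hp' he
      rfl)
    (by
      intro x hx hxB
      obtain ⟨i, p, hp, rfl⟩ := mem_iUnion.1 hxB
      rw [hgv i p hp, hedge i p.1 hp.1 p.2 (hABv i p hp hx.2)])
    (by
      intro x hx y hy he
      obtain ⟨i, p, hp, rfl⟩ := mem_iUnion.1 hy
      have he' := he
      rw [hgv i p hp] at he
      have hv : |p.2| = 1 := by linarith [(hubPoint_inj he).2]
      rw [hedge i p.1 hp.1 p.2 hv] at he
      exact hh.injOn_f (hAΓ hx) ⟨(hh.ρ_lt i p).le, hh.ρ_edge i p.1 hp.1 p.2 hv⟩ (hubPoint_inj he).1)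
  have hsub : {x | ht x ≤ 1} \ δ '' ball 0 1 ⊆ A ∪ B := by
    intro x hx
    by_cases hxU : x ∈ U
    · rcases hxU with h | h
      · exact absurd h hx.2
      · obtain ⟨i, p, hp, rfl⟩ := mem_iUnion.1 h
        exact Or.inr (mem_iUnion.2
          ⟨i, p, ⟨Ioo_subset_Icc_self hp.1, Ioo_subset_Icc_self hp.2⟩, rfl⟩)
    · exact Or.inl ⟨hx.1, hxU⟩
  refine ⟨q, hqc.mono hsub, hqi.mono hsub, fun x hx hx1 => ?_, fun x hx hx1 => ?_⟩
  · refine hqA ((hsub ⟨hx1.le, hx⟩).resolve_right fun h => ?_)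
    obtain ⟨i, p, hp, rfl⟩ := mem_iUnion.1 h
    exact absurd hx1 (hh.ρ_lt i p).ne
  · rcases hsub ⟨hx1, hx⟩ with h | h
    · exact Or.inl ⟨(hAΓ h).2, hqA h⟩
    · refine Or.inr ?_
      have hqx := hqB h
      obtain ⟨i, p, hp, rfl⟩ := mem_iUnion.1 h
      rw [hgv i p hp] at hqx
      rcases le_total |p.2| (1 / 2) with hv | hv
      · exact Or.inr ⟨_, _, by linarith,
          archPath_re_pos (hn1 i) hr hr1 (fun ε => hH1 (i, ε)) hp.1 hv, hqx⟩
      · refine Or.inl ⟨(i, decide (0 ≤ p.2)), p.1, hp.1, 2 - 2 * |p.2|,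
          ⟨by linarith [abs_le.2 hp.2], by linarith⟩, ?_⟩
        rw [hqx]
        simp only [G]
        rw [archPath_outer hv]

end

/-- A short arc of the circle around `1`, parametrized by rescaled height. -/
noncomputable def gapArc (κ u : ℝ) : Circle := Circle.exp (Real.arcsin (κ * u))

theorem continuous_gapArc (κ : ℝ) : Continuous (gapArc κ) :=
  Circle.exp.continuous.comp (Real.continuous_arcsin.comp (by fun_prop))

theorem gapArc_re (κ u : ℝ) : (gapArc κ u : ℂ).re = √(1 - (κ * u) ^ 2) := by
  rw [gapArc, Circle.coe_exp, Complex.exp_ofReal_mul_I_re, Real.cos_arcsin]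

theorem gapArc_im {κ u : ℝ} (h : |κ * u| ≤ 1) : (gapArc κ u : ℂ).im = κ * u := by
  rw [gapArc, Circle.coe_exp, Complex.exp_ofReal_mul_I_im,
    Real.sin_arcsin (abs_le.1 h).1 (abs_le.1 h).2]

theorem Circle.re_sq_add_im_sq (w : Circle) : (w : ℂ).re ^ 2 + (w : ℂ).im ^ 2 = 1 := by
  have h := Circle.normSq_coe w
  rw [Complex.normSq_apply] at h
  linarith

theorem exists_gapArc_eq {κ : ℝ} {w : Circle} (hκ : 0 < κ) (hre : 0 < (w : ℂ).re)
    (him : |(w : ℂ).im| < κ) : ∃ u ∈ Icc (-1 : ℝ) 1, gapArc κ u = w := by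
  have h1 : κ * ((w : ℂ).im / κ) = (w : ℂ).im := by field_simp
  have h2 := Circle.re_sq_add_im_sq w
  refine ⟨(w : ℂ).im / κ, ?_, Circle.ext (Complex.ext ?_ ?_)⟩
  · refine abs_le.1 ?_
    rw [abs_div, abs_of_pos hκ, div_le_one hκ]
    exact him.le
  · rw [gapArc_re, h1, show 1 - (w : ℂ).im ^ 2 = (w : ℂ).re ^ 2 by linarith, Real.sqrt_sq hre.le]
  · rw [gapArc_im, h1]
    rw [h1, ← sq_le_one_iff_abs_le_one]
    nlinarith [sq_nonneg (w : ℂ).re]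

theorem abs_mul_le_one_of_mem {κ u : ℝ} (hκ0 : 0 < κ) (hκ1 : κ ≤ 1) (hu : u ∈ Icc (-1 : ℝ) 1) :
    |κ * u| ≤ 1 := by
  rw [abs_mul, abs_of_pos hκ0]
  exact mul_le_one₀ hκ1 (abs_nonneg _) (abs_le.2 hu)

/-- A thin torus around a circle of radius `R`, wound along `φ` and scaled by `μ`. -/
noncomputable def rib (R h : ℝ) (φ : Circle → Circle) (w : Circle) (μ : ℝ) : ℂ × ℝ :=
  ((R + μ * (w : ℂ).re / 8 : ℝ) * φ w, h + μ * (w : ℂ).im / 8)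

theorem Circle.abs_re_le (w : Circle) : |(w : ℂ).re| ≤ 1 :=
  (Complex.abs_re_le_norm _).trans (Circle.norm_coe w).le

theorem Circle.abs_im_le (w : Circle) : |(w : ℂ).im| ≤ 1 :=
  (Complex.abs_im_le_norm _).trans (Circle.norm_coe w).le

theorem continuous_rib (R h : ℝ) {φ : Circle → Circle} (hφ : Continuous φ) :
    Continuous fun p : Circle × ℝ => rib R h φ p.1 p.2 := by
  unfold rib
  have h1 : Continuous fun p : Circle × ℝ => ((p.1 : Circle) : ℂ) :=
    continuous_induced_dom.comp continuous_fst
  have h2 : Continuous fun p : Circle × ℝ => ((φ p.1 : Circle) : ℂ) :=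
    continuous_induced_dom.comp (hφ.comp continuous_fst)
  have h3 := Complex.continuous_re.comp h1
  have h4 := Complex.continuous_im.comp h1
  exact ((Complex.continuous_ofReal.comp (continuous_const.add
    ((continuous_snd.mul h3).div_const 8))).mul h2).prodMk
      (continuous_const.add ((continuous_snd.mul h4).div_const 8))

theorem norm_rib_fst {R h : ℝ} {φ : Circle → Circle} {w : Circle} {μ : ℝ} (hR : 1 ≤ R)
    (hμ : μ ∈ Icc (0 : ℝ) 1) : ‖(rib R h φ w μ).1‖ = R + μ * (w : ℂ).re / 8 := by
  have := abs_le.1 (Circle.abs_re_le w)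
  rw [rib, norm_mul, Circle.norm_coe, mul_one, Complex.norm_real, Real.norm_of_nonneg]
  nlinarith [hμ.1, hμ.2]

theorem norm_rib_fst_le {R h : ℝ} {φ : Circle → Circle} {w : Circle} {μ : ℝ} (hR : 1 ≤ R)
    (hμ : μ ∈ Icc (0 : ℝ) 1) : ‖(rib R h φ w μ).1‖ ≤ R + 1 / 8 := by
  rw [norm_rib_fst hR hμ]
  have := abs_le.1 (Circle.abs_re_le w)
  nlinarith [hμ.1, hμ.2]

theorem abs_rib_snd_sub_le {R h : ℝ} {φ : Circle → Circle} {w : Circle} {μ : ℝ}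
    (hμ : μ ∈ Icc (0 : ℝ) 1) : |(rib R h φ w μ).2 - h| ≤ 1 / 8 := by
  have := abs_le.1 (Circle.abs_im_le w)
  simp only [rib]
  rw [abs_le]
  constructor <;> nlinarith [hμ.1, hμ.2]

theorem eq_of_abs_sub_le {β : Type*} {h : β → ℝ} (hsep : ∀ b b', b ≠ b' → 1 ≤ |h b - h b'|)
    {b b' : β} {x : ℝ} (h1 : |x - h b| ≤ 1 / 8) (h2 : |x - h b'| ≤ 1 / 8) : b = b' := by
  by_contra hb
  have h3 := hsep b b' hb
  rw [abs_le] at h1 h2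
  rcases le_abs.1 h3 with h | h <;> linarith [h1.1, h1.2, h2.1, h2.2]

theorem rib_inj {R h : ℝ} {φ : Circle → Circle} (hR : 1 ≤ R) {w w' : Circle} {μ μ' : ℝ}
    (hμ : μ ∈ Ioc (0 : ℝ) 1) (hμ' : μ' ∈ Ioc (0 : ℝ) 1)
    (he : rib R h φ w μ = rib R h φ w' μ') : w = w' ∧ μ = μ' := by
  have h1 : μ * (w : ℂ).re = μ' * (w' : ℂ).re := by
    have h0 := congrArg (fun p : ℂ × ℝ => ‖p.1‖) he
    simp only [norm_rib_fst hR (Ioc_subset_Icc_self hμ),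
      norm_rib_fst hR (Ioc_subset_Icc_self hμ')] at h0
    linarith
  have h2 : μ * (w : ℂ).im = μ' * (w' : ℂ).im := by
    have h0 := congrArg Prod.snd he
    simp only [rib] at h0
    linarith
  have h3 : (μ : ℂ) * w = μ' * w' := Complex.ext (by simpa using h1) (by simpa using h2)
  have h4 : μ = μ' := by
    have h0 := congrArg norm h3
    rwa [norm_mul, norm_mul, Circle.norm_coe, Circle.norm_coe, mul_one, mul_one, Complex.norm_real,
      Complex.norm_real, Real.norm_of_nonneg hμ.1.le, Real.norm_of_nonneg hμ'.1.le] at h0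
  subst h4
  exact ⟨Circle.ext (mul_left_cancel₀ (by exact_mod_cast hμ.1.ne') h3), rfl⟩

/-- A strip crossing a gap: a leg descending from the hub, then a tab leading to a thin torus. -/
noncomputable def gapStrip (K κ R h : ℝ) (φ : Circle → Circle) (H : ℝ → ℝ → ℂ) (u s : ℝ) : ℂ × ℝ :=
  if s ≤ 3 / 2 then hubPoint K (H u (2 * (s - 1))) (2 * (s - 1)) else
    (((4 - 2 * s) * (K - 1) : ℝ) + ((2 * s - 3) * (R + (gapArc κ u : ℂ).re / 8) : ℝ) *
      φ (gapArc κ u), h + κ * u / 8)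

theorem continuousOn_gapStrip {K κ R h : ℝ} {φ : Circle → Circle} (hφ : Continuous φ)
    {H : ℝ → ℝ → ℂ} (hH : Continuous fun p : ℝ × ℝ => H p.1 p.2)
    (h1 : ∀ u ∈ Icc (-1 : ℝ) 1, H u 1 = h + (κ / 8 : ℝ) * u) :
    ContinuousOn (fun p : ℝ × ℝ => gapStrip K κ R h φ H p.1 p.2)
      (Icc (-1 : ℝ) 1 ×ˢ Icc (1 : ℝ) 2) := by
  have hcl : ∀ u : ℝ, max (-1) (min u 1) ∈ Icc (-1 : ℝ) 1 := fun u =>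
    ⟨le_max_left _ _, max_le (by norm_num) (min_le_right _ _)⟩
  have hcl' : ∀ u ∈ Icc (-1 : ℝ) 1, max (-1) (min u 1) = u := fun u hu => by
    rw [min_eq_left hu.2, max_eq_right hu.1]
  have hc : Continuous fun p : ℝ × ℝ => gapStrip K κ R h φ H (max (-1) (min p.1 1)) p.2 := by
    have hu : Continuous fun p : ℝ × ℝ => max (-1) (min p.1 1) := by fun_prop
    have hg : Continuous fun p : ℝ × ℝ => gapArc κ (max (-1) (min p.1 1)) :=
      (continuous_gapArc κ).comp hu
    have hg1 : Continuous fun p : ℝ × ℝ => ((gapArc κ (max (-1) (min p.1 1)) : Circle) : ℂ).re :=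
      Complex.continuous_re.comp (continuous_induced_dom.comp hg)
    have hg2 : Continuous fun p : ℝ × ℝ => ((φ (gapArc κ (max (-1) (min p.1 1))) : Circle) : ℂ) :=
      continuous_induced_dom.comp (hφ.comp hg)
    refine Continuous.if_le (f := fun p : ℝ × ℝ => p.2) (g := fun _ => (3 / 2 : ℝ))
      ((continuous_hubPoint K).comp
        ((hH.comp (hu.prodMk (by fun_prop : Continuous fun p : ℝ × ℝ => 2 * (p.2 - 1)))).prodMk
          (by fun_prop : Continuous fun p : ℝ × ℝ => 2 * (p.2 - 1))))
      (by fun_prop) continuous_snd continuous_const ?_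
    intro p hp
    have e1 : 2 * (p.2 - 1) = 1 := by linarith
    have e2 : 2 * p.2 - 3 = 0 := by linarith
    have e3 : 4 - 2 * p.2 = 1 := by linarith
    rw [e1, e2, e3, h1 _ (hcl _), hubPoint, Prod.mk.injEq]
    constructor
    · apply Complex.ext <;> simp
    · simp; ring
  refine hc.continuousOn.congr fun p hp => ?_
  simp only
  rw [hcl' _ hp.1]

theorem gapStrip_two {K κ R h : ℝ} {φ : Circle → Circle} {H : ℝ → ℝ → ℂ} {u : ℝ}
    (hu : |κ * u| ≤ 1) : gapStrip K κ R h φ H u 2 = rib R h φ (gapArc κ u) 1 := by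
  rw [gapStrip, if_neg (by norm_num), rib, gapArc_im hu]
  norm_num

section

/-- Compatible data for placing gap strips and thin tori in space. -/
structure IsLayout {β : Type*} (K κ : ℝ) (R h : β → ℝ) (φ : β → Circle → Circle)
    (H : β → ℝ → ℝ → ℂ) : Prop where
  κ_pos : 0 < κ
  κ_le : κ ≤ 1
  one_le : ∀ b, 1 ≤ R b
  lt_K : ∀ b, 2 * (R b + 1) < K - 1
  h_le : ∀ b, h b ≤ -1
  sep : ∀ b b', b ≠ b' → 1 ≤ |h b - h b'|
  continuous_φ : ∀ b, Continuous (φ b)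
  half_le : ∀ b, ∀ u ∈ Icc (-1 : ℝ) 1, 1 / 2 ≤ ((φ b (gapArc κ u) : Circle) : ℂ).re
  continuous_H : ∀ b, Continuous fun p : ℝ × ℝ => H b p.1 p.2
  H_one : ∀ b, ∀ u ∈ Icc (-1 : ℝ) 1, H b u 1 = h b + (κ / 8 : ℝ) * u
  H_inj : ∀ s ∈ Icc (0 : ℝ) 1, ∀ a, ∀ u ∈ Icc (-1 : ℝ) 1, ∀ b, ∀ v ∈ Icc (-1 : ℝ) 1,
    H a u s = H b v s → a = b ∧ u = v

namespace IsLayout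

variable {β : Type*} {K κ : ℝ} {R h : β → ℝ} {φ : β → Circle → Circle} {H : β → ℝ → ℝ → ℂ}

/-- The strip of a layout with index `b`. -/
noncomputable abbrev strip (_ : IsLayout K κ R h φ H) (b : β) (u s : ℝ) : ℂ × ℝ :=
  gapStrip K κ (R b) (h b) (φ b) (H b) u s

theorem abs_mul_le (hl : IsLayout K κ R h φ H) {u : ℝ} (hu : u ∈ Icc (-1 : ℝ) 1) : |κ * u| ≤ 1 :=
  abs_mul_le_one_of_mem hl.κ_pos hl.κ_le hu

theorem strip_of_le (hl : IsLayout K κ R h φ H) (b : β) (u : ℝ) {s : ℝ} (hs : s ≤ 3 / 2) :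
    hl.strip b u s = hubPoint K (H b u (2 * (s - 1))) (2 * (s - 1)) := if_pos hs

theorem strip_of_lt (hl : IsLayout K κ R h φ H) (b : β) (u : ℝ) {s : ℝ} (hs : 3 / 2 < s) :
    hl.strip b u s = (((4 - 2 * s) * (K - 1) : ℝ) +
      ((2 * s - 3) * (R b + (gapArc κ u : ℂ).re / 8) : ℝ) * ((φ b (gapArc κ u) : Circle) : ℂ),
        h b + κ * u / 8) :=
  if_neg hs.not_ge

theorem abs_strip_sub_le (hl : IsLayout K κ R h φ H) (b : β) {u s : ℝ} (hs : 3 / 2 < s)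
    (hu : u ∈ Icc (-1 : ℝ) 1) : |(hl.strip b u s).2 - h b| ≤ 1 / 8 := by
  have := abs_le.1 (hl.abs_mul_le hu)
  rw [hl.strip_of_lt b u hs, abs_le]
  constructor <;> linarith

theorem strip_re_lt (hl : IsLayout K κ R h φ H) (b : β) {u s : ℝ} (hs : s ∈ Ioc (3 / 2 : ℝ) 2) :
    (hl.strip b u s).1.re < K - 1 := by
  rw [hl.strip_of_lt b u hs.1]
  have h1 := abs_le.1 (Circle.abs_re_le (gapArc κ u))
  have h2 := abs_le.1 (Circle.abs_re_le (φ b (gapArc κ u)))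
  simp only [Complex.add_re, Complex.ofReal_re, Complex.re_ofReal_mul]
  have h3 := hl.one_le b
  have h4 := hl.lt_K b
  have h5 : (R b + (gapArc κ u : ℂ).re / 8) * ((φ b (gapArc κ u) : Circle) : ℂ).re
      ≤ R b + 1 / 8 := by
    nlinarith
  nlinarith [hs.1, hs.2]

theorem lt_norm_strip (hl : IsLayout K κ R h φ H) (b : β) {u s : ℝ} (hs : s ∈ Ioo (3 / 2 : ℝ) 2)
    (hu : u ∈ Icc (-1 : ℝ) 1) : R b + (gapArc κ u : ℂ).re / 8 < ‖(hl.strip b u s).1‖ := by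
  set A := R b + (gapArc κ u : ℂ).re / 8 with hA
  set ψ := φ b (gapArc κ u) with hψ
  have h1 : ‖(hl.strip b u s).1‖ = ‖(hl.strip b u s).1 * (starRingEnd ℂ) ψ‖ := by
    rw [norm_mul, Complex.norm_conj, Circle.norm_coe, mul_one]
  have h2 : (hl.strip b u s).1 * (starRingEnd ℂ) ψ =
      ((4 - 2 * s) * (K - 1) : ℝ) * (starRingEnd ℂ) ψ + ((2 * s - 3) * A : ℝ) := by
    rw [hl.strip_of_lt b u hs.1, add_mul, mul_assoc, Complex.mul_conj, Circle.normSq_coe,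
      Complex.ofReal_one, mul_one]
  rw [h1, h2]
  refine lt_of_lt_of_le ?_ (Complex.re_le_norm _)
  simp only [Complex.add_re, Complex.re_ofReal_mul, Complex.ofReal_re, Complex.conj_re]
  have h3 := hl.half_le b u hu
  have h4 := hl.lt_K b
  have h5 := abs_le.1 (Circle.abs_re_le (gapArc κ u))
  have h6 : A < (K - 1) * (ψ : ℂ).re := by
    have := hl.one_le b
    nlinarith
  nlinarith [hs.1, hs.2]

theorem strip_inj (hl : IsLayout K κ R h φ H) {b b' : β} {u u' s s' : ℝ}
    (hu : u ∈ Icc (-1 : ℝ) 1) (hu' : u' ∈ Icc (-1 : ℝ) 1) (hs : s ∈ Icc (1 : ℝ) 2)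
    (hs' : s' ∈ Icc (1 : ℝ) 2) (he : hl.strip b u s = hl.strip b' u' s') :
    b = b' ∧ u = u' ∧ s = s' := by
  have hleg : ∀ {b u s}, s ≤ 3 / 2 → K - 1 ≤ (hl.strip b u s).1.re := by
    intro b u s hs
    rw [hl.strip_of_le b u hs]
    simp only [hubPoint]
    linarith
  rcases le_or_gt s (3 / 2) with h1 | h1 <;> rcases le_or_gt s' (3 / 2) with h2 | h2
  · rw [hl.strip_of_le b u h1, hl.strip_of_le b' u' h2] at he
    obtain ⟨h3, h4⟩ := hubPoint_inj he
    obtain rfl : s = s' := by linarith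
    obtain ⟨h5, h6⟩ := hl.H_inj _ ⟨by linarith [hs.1], by linarith⟩ _ _ hu _ _ hu' h3
    exact ⟨h5, h6, rfl⟩
  · exact absurd (hleg h1) (not_le.2 (he ▸ hl.strip_re_lt b' ⟨h2, hs'.2⟩))
  · exact absurd (hleg h2) (not_le.2 (he ▸ hl.strip_re_lt b ⟨h1, hs.2⟩))
  · obtain rfl := eq_of_abs_sub_le hl.sep (hl.abs_strip_sub_le b h1 hu)
      (he ▸ hl.abs_strip_sub_le b' h2 hu')
    rw [hl.strip_of_lt b u h1, hl.strip_of_lt b u' h2, Prod.mk.injEq] at he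
    obtain rfl : u = u' := mul_left_cancel₀ hl.κ_pos.ne' (by linarith [he.2])
    refine ⟨rfl, rfl, ?_⟩
    by_contra hne
    have h3 : ((s - s' : ℝ) : ℂ) *
        (((R b + (gapArc κ u : ℂ).re / 8 : ℝ) : ℂ) * ((φ b (gapArc κ u) : Circle) : ℂ) -
        (K - 1 : ℝ)) = 0 := by
      have := he.1
      push_cast at this ⊢
      linear_combination this / 2
    have h4 := sub_eq_zero.1 ((mul_eq_zero.1 h3).resolve_left
      (by exact_mod_cast sub_ne_zero.2 hne))
    have h5 := congrArg norm h4
    have h6 := abs_le.1 (Circle.abs_re_le (gapArc κ u))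
    have h7 := hl.one_le b
    have h8 := hl.lt_K b
    rw [norm_mul, Circle.norm_coe, Complex.norm_real, Complex.norm_real,
      Real.norm_of_nonneg (by linarith), Real.norm_of_nonneg (by linarith)] at h5
    linarith

theorem strip_eq_rib (hl : IsLayout K κ R h φ H) {b b' : β} {u s μ : ℝ} {w : Circle}
    (hu : u ∈ Icc (-1 : ℝ) 1) (hs : s ∈ Icc (1 : ℝ) 2) (hμ : μ ∈ Ioc (0 : ℝ) 1)
    (he : hl.strip b u s = rib (R b') (h b') (φ b') w μ) :
    b = b' ∧ gapArc κ u = w ∧ s = 2 ∧ μ = 1 := by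
  have hμ' := Ioc_subset_Icc_self hμ
  rcases le_or_gt s (3 / 2) with h1 | h1
  · have h2 : K - 1 ≤ ‖(hl.strip b u s).1‖ := by
      refine le_trans ?_ (Complex.re_le_norm _)
      rw [hl.strip_of_le b u h1]
      simp only [hubPoint]
      linarith
    rw [he] at h2
    have := norm_rib_fst_le (h := h b') (φ := φ b') (w := w) (hl.one_le b') hμ'
    linarith [hl.lt_K b', hl.one_le b']
  · obtain rfl := eq_of_abs_sub_le hl.sep (hl.abs_strip_sub_le b h1 hu)
      (he ▸ abs_rib_snd_sub_le hμ')
    rcases lt_or_eq_of_le hs.2 with h2 | rfl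
    · exfalso
      have h3 := hl.lt_norm_strip b ⟨h1, h2⟩ hu
      rw [he, norm_rib_fst (hl.one_le b) hμ'] at h3
      have h4 : κ * u = μ * (w : ℂ).im := by
        have := congrArg Prod.snd he
        rw [hl.strip_of_lt b u h1] at this
        simp only [rib] at this
        linarith
      have h5 : μ * (w : ℂ).re ≤ (gapArc κ u : ℂ).re := by
        rw [gapArc_re, h4]
        refine Real.le_sqrt_of_sq_le ?_
        have := Circle.re_sq_add_im_sq w
        have h6 : (μ * (w : ℂ).re) ^ 2 = μ ^ 2 * (1 - (w : ℂ).im ^ 2) := by rw [← this]; ring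
        rw [h6]
        nlinarith [hμ.1, hμ.2]
      linarith
    · rw [show hl.strip b u 2 = _ from gapStrip_two (hl.abs_mul_le hu)] at he
      obtain ⟨h3, h4⟩ := rib_inj (hl.one_le b) ⟨one_pos, le_rfl⟩ hμ he
      exact ⟨rfl, h3, rfl, h4.symm⟩

end IsLayout

end

section

theorem gapArc_inj {κ u u' : ℝ} (hκ : 0 < κ) (hu : |κ * u| ≤ 1) (hu' : |κ * u'| ≤ 1)
    (he : gapArc κ u = gapArc κ u') : u = u' := by
  have h1 := gapArc_im hu
  rw [he, gapArc_im hu'] at h1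
  exact mul_left_cancel₀ hκ.ne' h1.symm

variable {V : Type} [TopologicalSpace V] {β : Type} {ht : V → ℝ} {c : β → Circle → ℝ → V}
  {K κ : ℝ} {δ : ℂ → V} {ι : Type} {ρ : ι → ℝ × ℝ → V} {f : V → ℂ} {Γ : Set V}
  {R h : β → ℝ} {φ : β → Circle → Circle}

/-- Embed the collars above height `1`, away from the disc of a hub, by strips and thin tori. -/
theorem IsHub.exists_outer (hh : IsHub ht c κ δ ρ f Γ) (hc : Cuffed ht c) [T2Space V] [Finite β]
    {H : β → ℝ → ℝ → ℂ} (hl : IsLayout K κ R h φ H) :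
    ∃ g : V → ℂ × ℝ, ContinuousOn g ({x | 1 ≤ ht x ∧ ht x ≤ 3} \ δ '' ball 0 1) ∧
      InjOn g ({x | 1 ≤ ht x ∧ ht x ≤ 3} \ δ '' ball 0 1) ∧
      (∀ b w, ∀ s ∈ Icc (2 : ℝ) 3, g (c b w s) = rib (R b) (h b) (φ b) w ((4 - s) / 2)) ∧
      ∀ x ∉ δ '' ball 0 1, 1 ≤ ht x → ht x ≤ 3 →
        (∃ b, ∃ u ∈ Icc (-1 : ℝ) 1, ∃ z ∈ Icc (0 : ℝ) 1, x = c b (gapArc κ u) (1 + z / 2) ∧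
          g x = hubPoint K (H b u z) z) ∨
        (1 < ht x ∧ (g x).1.re ≤ K - 1 ∧ (g x).2 < 0) := by
  set J := Icc (-1 : ℝ) 1 with hJ
  obtain ⟨g₁, hg₁c, hg₁⟩ := exists_factor_of_family
    (isCompact_Icc.prod isCompact_Icc : IsCompact (J ×ˢ Icc (1 : ℝ) 2))
    (c := fun b p => c b (gapArc κ p.1) p.2) (g := fun b p => hl.strip b p.1 p.2)
    (fun b => ((hc.continuous_c b).comp (((continuous_gapArc κ).comp continuous_fst).prodMk
      continuous_snd)).continuousOn)
    (fun b => continuousOn_gapStrip (hl.continuous_φ b) (hl.continuous_H b) (hl.H_one b))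
    fun b p hp b' p' hp' he => by
      obtain ⟨rfl, h2, h3⟩ := hc.inj _ _ _ _ _ _ (by linarith [hp.2.1]) he
      rw [gapArc_inj hl.κ_pos (hl.abs_mul_le hp.1) (hl.abs_mul_le hp'.1) h2, h3]
  obtain ⟨g₂, hg₂c, hg₂⟩ := exists_factor_of_family
    (isCompact_univ.prod isCompact_Icc : IsCompact ((univ : Set Circle) ×ˢ Icc (2 : ℝ) 3))
    (c := fun b p => c b p.1 p.2) (g := fun b p => rib (R b) (h b) (φ b) p.1 ((4 - p.2) / 2))
    (fun b => (hc.continuous_c b).continuousOn)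
    (fun b => ((continuous_rib (R b) (h b) (hl.continuous_φ b)).comp
      (by fun_prop : Continuous fun p : Circle × ℝ => (p.1, (4 - p.2) / 2))).continuousOn)
    fun b p hp b' p' hp' he => by
      obtain ⟨rfl, h2, h3⟩ := hc.inj _ _ _ _ _ _ (by linarith [hp.2.1]) he
      rw [h2, h3]
  set S : Set V := ⋃ b, (fun p : ℝ × ℝ => c b (gapArc κ p.1) p.2) '' J ×ˢ Icc (1 : ℝ) 2 with hS
  set T : Set V := ⋃ b, (fun p : Circle × ℝ => c b p.1 p.2) '' univ ×ˢ Icc (2 : ℝ) 3 with hT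
  have hSc : IsClosed S := isClosed_iUnion_of_finite fun b =>
    ((isCompact_Icc.prod isCompact_Icc).image ((hc.continuous_c b).comp
      (((continuous_gapArc κ).comp continuous_fst).prodMk continuous_snd))).isClosed
  have hTc : IsClosed T := isClosed_iUnion_of_finite fun b =>
    ((isCompact_univ.prod isCompact_Icc).image (hc.continuous_c b)).isClosed
  have hμ : ∀ s ∈ Icc (2 : ℝ) 3, (4 - s) / 2 ∈ Ioc (0 : ℝ) 1 := fun s hs =>
    ⟨by linarith [hs.2], by linarith [hs.1]⟩
  have hcross : ∀ x ∈ S, ∀ y ∈ T, g₁ x = g₂ y → x = y := by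
    intro x hx y hy he
    obtain ⟨b, p, hp, rfl⟩ := mem_iUnion.1 hx
    obtain ⟨b', p', hp', rfl⟩ := mem_iUnion.1 hy
    rw [hg₁ b p hp, hg₂ b' p' hp'] at he
    obtain ⟨rfl, h2, h3, h4⟩ := hl.strip_eq_rib hp.1 hp.2 (hμ _ hp'.2) he
    simp only [h2, h3, show p'.2 = 2 by linarith]
  obtain ⟨g, hgc, hgi, hgS, hgT⟩ := exists_glue hSc hTc hg₁c hg₂c
    (by
      intro x hx y hy he
      obtain ⟨b, p, hp, rfl⟩ := mem_iUnion.1 hx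
      obtain ⟨b', p', hp', rfl⟩ := mem_iUnion.1 hy
      rw [hg₁ b p hp, hg₁ b' p' hp'] at he
      obtain ⟨rfl, h2, h3⟩ := hl.strip_inj hp.1 hp'.1 hp.2 hp'.2 he
      simp only [h2, h3])
    (by
      intro x hx y hy he
      obtain ⟨b, p, hp, rfl⟩ := mem_iUnion.1 hx
      obtain ⟨b', p', hp', rfl⟩ := mem_iUnion.1 hy
      rw [hg₂ b p hp, hg₂ b' p' hp'] at he
      obtain rfl := eq_of_abs_sub_le hl.sep
        (abs_rib_snd_sub_le (h := h b) (Ioc_subset_Icc_self (hμ _ hp.2)))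
        (he ▸ abs_rib_snd_sub_le (h := h b') (Ioc_subset_Icc_self (hμ _ hp'.2)))
      obtain ⟨h2, h3⟩ := rib_inj (hl.one_le b) (hμ _ hp.2) (hμ _ hp'.2) he
      simp only [h2, show p.2 = p'.2 by linarith])
    (by
      intro x hx hx'
      obtain ⟨b, p, hp, rfl⟩ := mem_iUnion.1 hx
      obtain ⟨b', p', hp', he⟩ := mem_iUnion.1 hx'
      obtain ⟨rfl, h2, h3⟩ := hc.inj _ _ _ _ _ _ (by linarith [hp'.2.1]) he
      have h4 : p.2 = 2 := le_antisymm hp.2.2 (h3 ▸ hp'.2.1)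
      rw [hg₁ b' p hp, ← he, hg₂ b' p' hp', h3, h2, h4,
        show hl.strip b' p.1 2 = _ from gapStrip_two (hl.abs_mul_le hp.1)]
      norm_num)
    hcross
  have hst : ∀ x ∉ δ '' ball 0 1, 1 ≤ ht x → ht x ≤ 2 →
      ∃ b, ∃ u ∈ J, c b (gapArc κ u) (ht x) = x := by
    intro x hx h1 h2
    obtain ⟨b, w, hw⟩ := hc.surj x (by linarith)
    have h3 : ¬ ((w : ℂ).re ≤ 0 ∨ κ ≤ |(w : ℂ).im|) := fun h =>
      hx (hw ▸ hh.mem_disc b w (ht x) ⟨h1, h2⟩ h)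
    push Not at h3
    obtain ⟨u, hu, rfl⟩ := exists_gapArc_eq hl.κ_pos h3.1 h3.2
    exact ⟨b, u, hu, hw⟩
  have hsub : {x | 1 ≤ ht x ∧ ht x ≤ 3} \ δ '' ball 0 1 ⊆ S ∪ T := by
    rintro x ⟨⟨h1, h2⟩, h3⟩
    rcases le_total (ht x) 2 with h4 | h4
    · obtain ⟨b, u, hu, he⟩ := hst x h3 h1 h4
      exact Or.inl (mem_iUnion.2 ⟨b, (u, ht x), ⟨hu, h1, h4⟩, he⟩)
    · obtain ⟨b, w, hw⟩ := hc.surj x (by linarith)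
      exact Or.inr (mem_iUnion.2 ⟨b, (w, ht x), ⟨mem_univ _, h4, h2⟩, hw⟩)
  refine ⟨g, hgc.mono hsub, hgi.mono hsub, fun b w s hs => ?_, fun x hx h1 h3 => ?_⟩
  · rw [hgT (mem_iUnion.2 ⟨b, (w, s), ⟨mem_univ _, hs⟩, rfl⟩)]
    exact hg₂ b (w, s) ⟨mem_univ _, hs⟩
  · have hneg : ∀ (y : ℂ × ℝ) b, |y.2 - h b| ≤ 1 / 8 → y.2 < 0 := fun y b hy => by
      linarith [(abs_le.1 hy).2, hl.h_le b]
    rcases le_total (ht x) 2 with h4 | h4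
    · obtain ⟨b, u, hu, he⟩ := hst x hx h1 h4
      have hgx : g x = hl.strip b u (ht x) := by
        have hxS : x ∈ S := mem_iUnion.2 ⟨b, (u, ht x), ⟨hu, h1, h4⟩, he⟩
        rw [hgS hxS, ← hg₁ b (u, ht x) ⟨hu, h1, h4⟩, he]
      rcases le_or_gt (ht x) (3 / 2) with h5 | h5
      · rw [hl.strip_of_le b u h5] at hgx
        refine Or.inl ⟨b, u, hu, 2 * (ht x - 1), ⟨by linarith, by linarith⟩, ?_, hgx⟩
        rw [show 1 + 2 * (ht x - 1) / 2 = ht x by ring, he]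
      · rw [hgx]
        exact Or.inr ⟨by linarith, (hl.strip_re_lt b ⟨h5, h4⟩).le,
          hneg _ b (hl.abs_strip_sub_le b h5 hu)⟩
    · obtain ⟨b, w, hw⟩ := hc.surj x (by linarith)
      have hgx : g x = rib (R b) (h b) (φ b) w ((4 - ht x) / 2) := by
        have hxT : x ∈ T := mem_iUnion.2 ⟨b, (w, ht x), ⟨mem_univ _, h4, h3⟩, hw⟩
        rw [hgT hxT, ← hg₂ b (w, ht x) ⟨mem_univ _, h4, h3⟩, hw]
      rw [hgx]
      have h5 := Ioc_subset_Icc_self (hμ _ ⟨h4, h3⟩)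
      refine Or.inr ⟨by linarith, ?_, hneg _ b (abs_rib_snd_sub_le h5)⟩
      have h6 := (Complex.re_le_norm _).trans
        (norm_rib_fst_le (h := h b) (φ := φ b) (w := w) (hl.one_le b) h5)
      linarith [hl.lt_K b, hl.one_le b]

end

section

variable {V : Type} [TopologicalSpace V] {β : Type} {ht : V → ℝ} {c : β → Circle → ℝ → V}
  {K κ : ℝ} {δ : ℂ → V} {ι : Type} {ρ : ι → ℝ × ℝ → V} {f : V → ℂ} {Γ : Set V}
  {R h : β → ℝ} {φ : β → Circle → Circle}

/-- Embed a cuffed surface below height `3`, minus the disc of a hub, in space. -/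
theorem IsHub.exists_sheet (hh : IsHub ht c κ δ ρ f Γ) (hc : Cuffed ht c) [T2Space V] [Finite β]
    [Finite ι] {H : (ι × Bool) ⊕ β → ℝ → ℝ → ℂ}
    (hl : IsLayout K κ R h φ fun b => H (.inr b))
    (hHc : ∀ a, Continuous fun p : ℝ × ℝ => H a p.1 p.2) {n : ι → ℝ}
    (hH0 : ∀ a : ι × Bool, ∀ u ∈ Icc (-1 : ℝ) 1, H (.inl a) u 0 = f (ρ a.1 (u, endSign a.2)))
    (hH0' : ∀ b, ∀ u ∈ Icc (-1 : ℝ) 1, H (.inr b) u 0 = f (c b (gapArc κ u) 1))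
    (hH1 : ∀ a : ι × Bool, ∀ u ∈ Icc (-1 : ℝ) 1,
      H (.inl a) u 1 = n a.1 + endSign a.2 * Complex.I + (κ / 8 : ℝ) * u)
    (hHi : ∀ s ∈ Icc (0 : ℝ) 1, ∀ a, ∀ u ∈ Icc (-1 : ℝ) 1, ∀ b, ∀ v ∈ Icc (-1 : ℝ) 1,
      H a u s = H b v s → a = b ∧ u = v)
    (hn1 : ∀ i, 1 ≤ n i) (hn : ∀ i j, i ≠ j → 1 ≤ |n i - n j|) :
    ∃ q : V → ℂ × ℝ, ContinuousOn q ({x | ht x ≤ 3} \ δ '' ball 0 1) ∧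
      InjOn q ({x | ht x ≤ 3} \ δ '' ball 0 1) ∧
      ∀ b w, q (c b w 3) = rib (R b) (h b) (φ b) w (1 / 2) := by
  have hht := hc.continuous_ht
  have hκ := hl.κ_pos
  have hκ1 := hl.κ_le
  have hδo : IsOpen (δ '' ball 0 1) := hh.isOpenEmbedding.isOpenMap _ isOpen_ball
  obtain ⟨q₁, hq₁c, hq₁i, hq₁b, hq₁⟩ := hh.exists_core hht (H := fun a => H (.inl a))
    (fun a => hHc _) hH0 hH1 (fun s hs a u hu b v hv he => by
      obtain ⟨h1, h2⟩ := hHi s hs _ u hu _ v hv he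
      exact ⟨Sum.inl_injective h1, h2⟩) hn1 hn (by linarith) (by linarith) K
  obtain ⟨q₂, hq₂c, hq₂i, hq₂r, hq₂⟩ := hh.exists_outer hc hl
  have hcl : IsClosed ({x | ht x ≤ 1} \ δ '' ball 0 1) :=
    (isClosed_le hht continuous_const).inter hδo.isClosed_compl
  have hcl' : IsClosed ({x | 1 ≤ ht x ∧ ht x ≤ 3} \ δ '' ball 0 1) :=
    ((isClosed_le continuous_const hht).inter (isClosed_le hht continuous_const)).inter
      hδo.isClosed_compl
  have hnegre : ∀ b, ∀ u ∈ Icc (-1 : ℝ) 1, (H (.inr b) u 1).re < 0 := by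
    intro b u hu
    have := hl.h_le b
    rw [show H (.inr b) u 1 = _ from hl.H_one b u hu]
    simp only [Complex.add_re, Complex.ofReal_re, Complex.re_ofReal_mul]
    nlinarith [hu.1, hu.2]
  have hposre : ∀ a : ι × Bool, ∀ u ∈ Icc (-1 : ℝ) 1, 0 < (H (.inl a) u 1).re := by
    intro a u hu
    have := hn1 a.1
    rw [hH1 a u hu]
    simp
    nlinarith [hu.1, hu.2]
  have hcross : ∀ x ∈ {x | ht x ≤ 1} \ δ '' ball 0 1,
      ∀ y ∈ {x | 1 ≤ ht x ∧ ht x ≤ 3} \ δ '' ball 0 1,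
      q₁ x = q₂ y → x = y := by
    rintro x ⟨hx1, hx⟩ y ⟨⟨hy1, hy3⟩, hy⟩ he
    rcases hq₂ y hy hy1 hy3 with ⟨b, u, hu, z, hz, rfl, hb⟩ | ⟨-, hre, hneg⟩
    · rw [hb] at he
      rcases hq₁ x hx hx1 with ⟨hxΓ, ha⟩ | ⟨a, v, hv, z', hz', ha⟩ | ⟨p, z', hz', hp, ha⟩
      · rw [ha] at he
        obtain ⟨h1, rfl⟩ := hubPoint_inj he
        rw [hH0' b u hu] at h1
        have h2 : ht (c b (gapArc κ u) 1) = 1 := hc.ht_c_of_pos b _ zero_le_one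
        rw [zero_div, add_zero]
        exact hh.injOn_f ⟨hx1, hxΓ⟩ ⟨h2.le, fun h => absurd h2 (hh.Γ_lt _ h).ne⟩ h1
      · rw [ha] at he
        obtain ⟨h1, rfl⟩ := hubPoint_inj he
        exact absurd (hHi _ hz _ v hv _ u hu h1).1 Sum.inl_ne_inr
      · rw [ha] at he
        obtain ⟨rfl, rfl⟩ := hubPoint_inj he
        obtain rfl : z' = 1 := le_antisymm hz.2 hz'
        exact absurd hp (hnegre b u hu).not_gt
    · rw [← he] at hre hneg
      rcases hq₁ x hx hx1 with ⟨hxΓ, ha⟩ | ⟨a, v, hv, z', hz', ha⟩ | ⟨p, z', hz', hp, ha⟩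
      · rw [ha] at hre
        simp only [hubPoint] at hre
        linarith
      · rw [ha] at hre hneg
        simp only [hubPoint] at hre hneg
        obtain rfl : z' = 1 := le_antisymm hz'.2 (by linarith)
        exact absurd hneg (hposre a v hv).not_gt
      · rw [ha] at hneg
        exact absurd hneg hp.not_gt
  obtain ⟨q, hqc, hqi, hqe₁, hqe₂⟩ := exists_glue hcl hcl' hq₁c hq₂c hq₁i hq₂i
    (by
      rintro x ⟨hx1, hx⟩ ⟨⟨hx2, -⟩, -⟩
      have hx1' : ht x = 1 := le_antisymm hx1 hx2
      rw [hq₁b x hx hx1']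
      rcases hq₂ x hx hx2 (by linarith) with ⟨b, u, hu, z, hz, hxe, hb⟩ | ⟨h, -⟩
      · have h2 := congrArg ht hxe
        rw [hx1', hc.ht_c_of_pos b _ (by linarith [hz.1])] at h2
        obtain rfl : z = 0 := by linarith
        rw [hb, hH0' b u hu, hxe, zero_div, add_zero]
      · linarith)
    hcross
  have hsub : {x | ht x ≤ 3} \ δ '' ball 0 1 ⊆ ({x | ht x ≤ 1} \ δ '' ball 0 1) ∪
      ({x | 1 ≤ ht x ∧ ht x ≤ 3} \ δ '' ball 0 1) := by
    rintro x ⟨h1, h2⟩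
    rcases le_total (ht x) 1 with h3 | h3
    · exact Or.inl ⟨h3, h2⟩
    · exact Or.inr ⟨⟨h3, h1⟩, h2⟩
  refine ⟨q, hqc.mono hsub, hqi.mono hsub, fun b w => ?_⟩
  have h3 : ht (c b w 3) = 3 := hc.ht_c_of_pos b w (by norm_num)
  have h4 : c b w 3 ∉ δ '' ball 0 1 := by
    rintro ⟨z, -, hz⟩
    exact absurd (hz ▸ hh.disc_lt z) (not_lt.2 h3.ge)
  rw [hqe₂ ⟨⟨by rw [h3]; norm_num, h3.le⟩, h4⟩, hq₂r b w 3 ⟨by norm_num, le_rfl⟩]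
  norm_num

end

section

variable {V : Type} [TopologicalSpace V] {β : Type} {ht : V → ℝ} {c : β → Circle → ℝ → V}

theorem exists_spread (ι : Type*) [Finite ι] :
    ∃ n : ι → ℝ, (∀ i, 1 ≤ n i) ∧ ∀ i j, i ≠ j → 1 ≤ |n i - n j| := by
  obtain ⟨k, ⟨e⟩⟩ := Finite.exists_equiv_fin ι
  refine ⟨fun i => ((e i : ℕ) : ℝ) + 1, fun i => by simp, fun i j hij => ?_⟩
  have h1 : ((e i : ℕ) : ℤ) - (e j : ℕ) ≠ 0 := by
    intro h
    exact hij (e.injective (Fin.ext (by exact_mod_cast sub_eq_zero.1 h)))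
  have h2 : (1 : ℝ) ≤ |(((e i : ℕ) : ℤ) - (e j : ℕ) : ℤ)| := by
    exact_mod_cast Int.one_le_abs h1
  simpa using h2

theorem exists_gap_width [Finite β] {φ : β → Circle → Circle} (hφ : ∀ b, Continuous (φ b))
    (hφ1 : ∀ b, φ b 1 = 1) : ∃ κ : ℝ, 0 < κ ∧ κ ≤ 1 ∧
      ∀ b, ∀ u ∈ Icc (-1 : ℝ) 1, 1 / 2 ≤ ((φ b (gapArc κ u) : Circle) : ℂ).re := by
  have h1 : ∀ᶠ t in 𝓝 (0 : ℝ), ∀ b, 1 / 2 < ((φ b (gapArc 1 t) : Circle) : ℂ).re := by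
    refine Filter.eventually_all.2 fun b => ?_
    have hc : Continuous fun t : ℝ => ((φ b (gapArc 1 t) : Circle) : ℂ).re :=
      Complex.continuous_re.comp (continuous_induced_dom.comp ((hφ b).comp (continuous_gapArc 1)))
    refine hc.continuousAt.eventually_const_lt ?_
    have h0 : gapArc 1 0 = 1 := by simp [gapArc]
    have h1 : ((φ b (gapArc 1 0) : Circle) : ℂ).re = 1 := by
      rw [h0, hφ1, Circle.coe_one, Complex.one_re]
    show 1 / 2 < ((φ b (gapArc 1 0) : Circle) : ℂ).re
    rw [h1]
    norm_num
  obtain ⟨ε, hε, hb⟩ := Metric.eventually_nhds_iff.1 h1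
  refine ⟨min 1 (ε / 2), by positivity, min_le_left _ _, fun b u hu => ?_⟩
  have h2 : gapArc (min 1 (ε / 2)) u = gapArc 1 (min 1 (ε / 2) * u) := by
    simp [gapArc]
  rw [h2]
  refine (hb ?_ b).le
  have h3 : 0 < min 1 (ε / 2) := by positivity
  rw [dist_zero_right, Real.norm_eq_abs, abs_mul, abs_of_pos h3]
  have h4 := abs_le.2 hu
  have h5 := min_le_right 1 (ε / 2)
  nlinarith [abs_nonneg u]

/-- The standard positions of the feet of bands and of gap strips. -/
noncomputable def legBase {ι β : Type*} (n : ι → ℝ) (m : β → ℝ) : (ι × Bool) ⊕ β → ℂ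
  | .inl a => n a.1 + endSign a.2 * Complex.I
  | .inr b => (-m b : ℝ)

theorem legBase_sep {ι β : Type*} {n : ι → ℝ} {m : β → ℝ} (hn1 : ∀ i, 1 ≤ n i)
    (hn : ∀ i j, i ≠ j → 1 ≤ |n i - n j|) (hm1 : ∀ b, 1 ≤ m b)
    (hm : ∀ b b', b ≠ b' → 1 ≤ |m b - m b'|) {a a' : (ι × Bool) ⊕ β} (ha : a ≠ a') :
    1 ≤ ‖legBase n m a - legBase n m a'‖ := by
  rcases a with ⟨i, ε⟩ | b <;> rcases a' with ⟨j, ε'⟩ | b'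
  · by_cases hij : i = j
    · refine le_trans ?_ (Complex.abs_im_le_norm _)
      have him : (legBase n m (.inl (i, ε)) - legBase n m (.inl (j, ε'))).im =
        endSign ε - endSign ε' := by simp [legBase]
      rw [him]
      rcases ε with _ | _ <;> rcases ε' with _ | _
      · exact absurd (by rw [hij]) ha
      · norm_num [endSign]
      · norm_num [endSign]
      · exact absurd (by rw [hij]) ha
    · refine le_trans ?_ (Complex.abs_re_le_norm _)
      have hre : (legBase n m (.inl (i, ε)) - legBase n m (.inl (j, ε'))).re = n i - n j := by
        simp [legBase]
      exact hre ▸ hn i j hij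
  · refine le_trans ?_ (Complex.re_le_norm _)
    have hre : (legBase n m (.inl (i, ε)) - legBase n m (.inr b')).re = n i + m b' := by
      simp [legBase]
    linarith [hn1 i, hm1 b']
  · rw [norm_sub_rev]
    refine le_trans ?_ (Complex.re_le_norm _)
    have hre : (legBase n m (.inl (j, ε')) - legBase n m (.inr b)).re = n j + m b := by
      simp [legBase]
    linarith [hn1 j, hm1 b]
  · have hb : b ≠ b' := fun h => ha (by rw [h])
    refine le_trans ?_ (Complex.abs_re_le_norm _)
    have hre : (legBase n m (.inr b) - legBase n m (.inr b')).re = m b' - m b := by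
      simp [legBase]; ring
    exact hre ▸ hm b' b hb.symm

theorem Cuffed.exists_sheet (hc : Cuffed ht c) [T2Space V] [Nonempty V] [Finite β] {R : β → ℝ}
    (hR : ∀ b, 1 ≤ R b) {φ : β → Circle → Circle} (hφ : ∀ b, Continuous (φ b))
    (hφ1 : ∀ b, φ b 1 = 1) :
    ∃ (δ : ℂ → V) (h : β → ℝ) (q : V → ℂ × ℝ), IsOpenEmbedding δ ∧ (∀ z, ht (δ z) < 3) ∧
      (∀ b b', b ≠ b' → 1 ≤ |h b - h b'|) ∧
      ContinuousOn q ({x | ht x ≤ 3} \ δ '' ball 0 1) ∧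
      InjOn q ({x | ht x ≤ 3} \ δ '' ball 0 1) ∧
      ∀ b w, q (c b w 3) = rib (R b) (h b) (φ b) w (1 / 2) := by
  obtain ⟨κ, hκ, hκ1, hhalf⟩ := exists_gap_width hφ hφ1
  obtain ⟨δ, ι, hι, ρ, f, Γ, hh⟩ := hc.exists_hub hκ
  obtain ⟨n, hn1, hn⟩ := exists_spread ι
  obtain ⟨m, hm1, hm⟩ := exists_spread β
  obtain ⟨B, hB⟩ := (finite_range R).bddAbove
  let γ : (ι × Bool) ⊕ β → ℝ → V :=
    Sum.elim (fun a u => ρ a.1 (u, endSign a.2)) fun b u => c b (gapArc κ u) 1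
  have hend : ∀ ε, |endSign ε| = 1 := by
    rintro (_ | _) <;> simp [endSign]
  have hendI : ∀ ε, endSign ε ∈ Icc (-1 : ℝ) 1 := fun ε => abs_le.1 (hend ε).le
  have hendi : ∀ ε ε', endSign ε = endSign ε' → ε = ε' := by
    rintro (_ | _) (_ | _) <;> simp [endSign] <;> norm_num
  have hht1 : ∀ b w, ht (c b w 1) = 1 := fun b w => hc.ht_c_of_pos b w zero_le_one
  have hγm : ∀ a, ∀ u ∈ Icc (-1 : ℝ) 1, γ a u ∈ {x | ht x ≤ 1} \ Γ := by
    rintro (a | b) u hu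
    · exact ⟨(hh.ρ_lt _ _).le, hh.ρ_edge _ u hu _ (hend _)⟩
    · exact ⟨(hht1 _ _).le, fun h => absurd (hht1 _ _) (hh.Γ_lt _ h).ne⟩
  have hγc : ∀ a, Continuous (γ a) := by
    rintro (a | b)
    · exact (hh.continuous_ρ _).comp (by fun_prop)
    · exact (hc.continuous_c b).comp ((continuous_gapArc κ).prodMk continuous_const)
  have hγi : ∀ a, ∀ u ∈ Icc (-1 : ℝ) 1, ∀ b, ∀ v ∈ Icc (-1 : ℝ) 1, γ a u = γ b v →
      a = b ∧ u = v := by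
    rintro (⟨i, ε⟩ | b) u hu (⟨j, ε'⟩ | b') v hv he
    · obtain ⟨rfl, h2⟩ := hh.ρ_inj _ _ ⟨hu, hendI _⟩ _ _ ⟨hv, hendI _⟩ he
      rw [Prod.mk.injEq] at h2
      obtain rfl := hendi ε ε' h2.2
      exact ⟨rfl, h2.1⟩
    · exact absurd ((congrArg ht he).trans (hht1 _ _)) (hh.ρ_lt _ _).ne
    · exact absurd ((congrArg ht he).symm.trans (hht1 _ _)) (hh.ρ_lt _ _).ne
    · obtain ⟨rfl, h2, -⟩ := hc.inj _ _ _ _ _ _ one_pos he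
      exact ⟨rfl, gapArc_inj hκ (abs_mul_le_one_of_mem hκ hκ1 hu)
        (abs_mul_le_one_of_mem hκ hκ1 hv) h2⟩
  have hQ : ∀ a b, a ≠ b → 2 * (κ / 8) < ‖legBase n m a - legBase n m b‖ := by
    intro a b hab
    refine lt_of_lt_of_le (b := 1) (by linarith) ?_
    exact legBase_sep hn1 hn hm1 hm hab
  obtain ⟨H, hHc, hH0, hH1, hHi⟩ := movable_standard (γ := fun a u => f (γ a u))
    (fun a => hh.continuousOn_f.comp (hγc a).continuousOn (hγm a))
    (fun a u hu b v hv he => hγi a u hu b v hv (hh.injOn_f (hγm a u hu) (hγm b v hv) he))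
    (by positivity : 0 < κ / 8) hQ
  have hl : IsLayout (2 * B + 4) κ R (fun b => -m b) φ fun b => H (.inr b) :=
    { κ_pos := hκ
      κ_le := hκ1
      one_le := hR
      lt_K := fun b => by linarith [hB (mem_range_self b)]
      h_le := fun b => by linarith [hm1 b]
      sep := fun b b' hb => by
        rw [show -m b - -m b' = m b' - m b by ring]
        exact hm b' b hb.symm
      continuous_φ := hφ
      half_le := hhalf
      continuous_H := fun b => hHc _
      H_one := fun b => hH1 (.inr b)
      H_inj := fun s hs a u hu b v hv he => by
        obtain ⟨h1, h2⟩ := hHi s hs _ u hu _ v hv he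
        exact ⟨Sum.inr_injective h1, h2⟩ }
  obtain ⟨q, hqc, hqi, hq⟩ := hh.exists_sheet hc hl hHc (fun a => hH0 (.inl a))
    (fun b => hH0 (.inr b)) (fun a => hH1 (.inl a)) hHi hn1 hn
  exact ⟨δ, _, q, hh.isOpenEmbedding, hh.disc_lt, hl.sep, hqc, hqi, hq⟩

end

section

variable {V : Type} [TopologicalSpace V] {β : Type} {ht : V → ℝ} {c : β → Circle → ℝ → V}

/-- Extend an embedding of the complement of an open disc over the disc by coning in one more
dimension. -/
theorem exists_cone {Y : Set V} [T2Space V] {N : Type*} [NormedAddCommGroup N]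
    [NormedSpace ℝ N] {δ : ℂ → V} (hδ : IsOpenEmbedding δ) (hY : IsClosed Y)
    (hYδ : ∀ x ∈ Y, x ∉ δ '' ball 0 1) (hS : ∀ w : Circle, δ w ∈ Y) {q : V → N}
    (hqc : ContinuousOn q Y) (hqi : InjOn q Y) :
    ∃ F : V → N × ℝ, ContinuousOn F (δ '' closedBall 0 1 ∪ Y) ∧
      InjOn F (δ '' closedBall 0 1 ∪ Y) ∧ (∀ x ∈ Y, F x = (q x, 1)) ∧
      ∀ x ∈ δ '' closedBall 0 1 ∪ Y, 1 ≤ (F x).2 := by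
  let ρ : ℝ × Circle → V := fun p => δ (p.1 * (p.2 : ℂ))
  have hw : Continuous fun p : ℝ × Circle => ((p.2 : Circle) : ℂ) :=
    continuous_induced_dom.comp continuous_snd
  have hρ : Continuous ρ :=
    hδ.continuous.comp ((Complex.continuous_ofReal.comp continuous_fst).mul hw)
  have hnorm : ∀ (r : ℝ) (w : Circle), 0 ≤ r → ‖(r : ℂ) * w‖ = r := fun r w hr => by
    rw [norm_mul, Circle.norm_coe, mul_one, Complex.norm_real, Real.norm_of_nonneg hr]
  have hρi : ∀ p : ℝ × Circle, 0 ≤ p.1 → ∀ p' : ℝ × Circle, 0 ≤ p'.1 → ρ p = ρ p' →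
      p.1 = p'.1 ∧ (p.1 ≠ 0 → p.2 = p'.2) := by
    intro p hp p' hp' he
    have h1 := hδ.injective he
    have h2 : p.1 = p'.1 := by rw [← hnorm p.1 p.2 hp, h1, hnorm p'.1 p'.2 hp']
    refine ⟨h2, fun h0 => Circle.ext ?_⟩
    rw [← h2] at h1
    exact mul_left_cancel₀ (by exact_mod_cast h0) h1
  have himage : ρ '' Icc (0 : ℝ) 1 ×ˢ univ = δ '' closedBall 0 1 := by
    ext x
    constructor
    · rintro ⟨p, hp, rfl⟩
      refine ⟨_, ?_, rfl⟩
      rw [mem_closedBall_zero_iff, hnorm _ _ hp.1.1]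
      exact hp.1.2
    · rintro ⟨z, hz, rfl⟩
      rw [mem_closedBall_zero_iff] at hz
      obtain ⟨w, hw⟩ : ∃ w : Circle, (‖z‖ : ℂ) * (w : ℂ) = z := by
        refine ⟨Circle.exp z.arg, ?_⟩
        rw [Circle.coe_exp, Complex.norm_mul_exp_arg_mul_I]
      refine ⟨(‖z‖, w), ⟨⟨norm_nonneg _, hz⟩, mem_univ _⟩, ?_⟩
      simp only [ρ]
      rw [hw]
  have hK : IsCompact (Icc (0 : ℝ) 1 ×ˢ (univ : Set Circle)) := isCompact_Icc.prod isCompact_univ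
  have hqS : Continuous fun w : Circle => q (δ w) :=
    hqc.comp_continuous (hδ.continuous.comp continuous_induced_dom) hS
  obtain ⟨g, hgc, hg⟩ := exists_factor_of_isCompact hK hρ.continuousOn
    (g := fun p : ℝ × Circle => (p.1 • q (δ p.2), 2 - p.1))
    ((continuous_fst.smul (hqS.comp continuous_snd)).prodMk
      (continuous_const.sub continuous_fst)).continuousOn
    fun p hp p' hp' he => by
      obtain ⟨h1, h2⟩ := hρi p hp.1.1 p' hp'.1.1 he
      by_cases h0 : p.1 = 0
      · simp [← h1, h0]
      · simp [h1, h2 h0]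
  rw [himage] at hgc
  obtain ⟨F, hFc, hFi, hFg, hFq⟩ := exists_glue (f := g) (g := fun x => (q x, (1 : ℝ)))
    ((isCompact_closedBall (0 : ℂ) 1).image hδ.continuous).isClosed hY hgc
    (hqc.prodMk continuousOn_const)
    (by
      rw [← himage]
      rintro _ ⟨p, hp, rfl⟩ _ ⟨p', hp', rfl⟩ he
      rw [hg p hp, hg p' hp', Prod.mk.injEq] at he
      have h1 : p.1 = p'.1 := by linarith [he.2]
      by_cases h0 : p.1 = 0
      · simp [ρ, ← h1, h0]
      · have h2 := hqi (hS _) (hS _) (smul_right_injective N h0 (h1 ▸ he.1 :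
          p.1 • q (δ p.2) = p.1 • q (δ p'.2)))
        simp only [ρ, h1, hδ.injective h2])
    (fun x hx y hy he => hqi hx hy (Prod.mk.inj he).1)
    (by
      rw [← himage]
      rintro _ ⟨p, hp, rfl⟩ hxY
      have h1 : p.1 = 1 := by
        refine hp.1.2.antisymm (not_lt.1 fun h => hYδ _ hxY ⟨_, ?_, rfl⟩)
        rwa [mem_ball_zero_iff, hnorm _ _ hp.1.1]
      rw [hg p hp]
      simp only [ρ, h1, one_smul, Complex.ofReal_one, one_mul]
      norm_num)
    (by
      rw [← himage]
      rintro _ ⟨p, hp, rfl⟩ y hy he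
      rw [hg p hp, Prod.mk.injEq] at he
      have h1 : p.1 = 1 := by linarith [he.2]
      rw [h1, one_smul] at he
      rw [← hqi (hS _) hy he.1]
      simp only [ρ, h1, Complex.ofReal_one, one_mul])
  refine ⟨F, hFc, hFi, fun x hx => hFq hx, ?_⟩
  rintro x (hx | hx)
  · rw [hFg hx]
    rw [← himage] at hx
    obtain ⟨p, hp, rfl⟩ := hx
    rw [hg p hp]
    linarith [hp.1.2]
  · rw [hFq hx]

/-- A cuffed surface maps to four-space, injectively below height `4` and with its cuffs wrapping
round prescribed circles at height `4`. -/
theorem Cuffed.exists_model (hc : Cuffed ht c) [T2Space V] [Nonempty V] [Finite β] {R : β → ℝ}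
    (hR : ∀ b, 1 ≤ R b) {φ : β → Circle → Circle} (hφ : ∀ b, Continuous (φ b))
    (hφ1 : ∀ b, φ b 1 = 1) :
    ∃ F : V → (ℂ × ℝ) × ℝ, ContinuousOn F {x | ht x ≤ 4} ∧ InjOn F {x | ht x < 4} ∧
      (∀ x, ht x < 4 → 0 < (F x).2) ∧
      ∀ b w, (F (c b w 4)).1.1 = R b * φ b w ∧ (F (c b w 4)).2 = 0 := by
  classical
  have hht := hc.continuous_ht
  obtain ⟨δ, h, q, hδ, hδ3, hsep, hqc, hqi, hq⟩ := hc.exists_sheet hR hφ hφ1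
  have hht3 : ∀ b w, ht (c b w 3) = 3 := fun b w => hc.ht_c_of_pos b w (by norm_num)
  obtain ⟨F₁, hF₁c, hF₁i, hF₁q, hF₁⟩ := exists_cone hδ (Y := {x | ht x ≤ 3} \ δ '' ball 0 1)
    ((isClosed_le hht continuous_const).inter (hδ.isOpenMap _ isOpen_ball).isClosed_compl)
    (fun x hx => hx.2) (fun w => ⟨(hδ3 _).le, fun ⟨z, hz, he⟩ => by
      rw [hδ.injective he, mem_ball_zero_iff, Circle.norm_coe] at hz
      exact lt_irrefl _ hz⟩) hqc hqi
  have hunion : {x | ht x ≤ 3} ⊆ δ '' closedBall 0 1 ∪ ({x | ht x ≤ 3} \ δ '' ball 0 1) := by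
    intro x hx
    by_cases h1 : x ∈ δ '' ball 0 1
    · exact Or.inl (image_mono ball_subset_closedBall h1)
    · exact Or.inr ⟨hx, h1⟩
  obtain ⟨F₂, hF₂c, hF₂⟩ := exists_factor_of_family
    (isCompact_univ.prod isCompact_Icc : IsCompact ((univ : Set Circle) ×ˢ Icc (3 : ℝ) 4))
    (c := fun b p => c b p.1 p.2)
    (g := fun b p => (rib (R b) (h b) (φ b) p.1 ((4 - p.2) / 2), 4 - p.2))
    (fun b => (hc.continuous_c b).continuousOn)
    (fun b => (((continuous_rib (R b) (h b) (hφ b)).comp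
      (by fun_prop : Continuous fun p : Circle × ℝ => (p.1, (4 - p.2) / 2))).prodMk
        (continuous_const.sub continuous_snd)).continuousOn)
    fun b p hp b' p' hp' he => by
      obtain ⟨rfl, h2, h3⟩ := hc.inj _ _ _ _ _ _ (by linarith [hp.2.1]) he
      rw [h2, h3]
  set T : Set V := ⋃ b, (fun p : Circle × ℝ => c b p.1 p.2) '' univ ×ˢ Icc (3 : ℝ) 4 with hT
  have hTc : IsClosed T := isClosed_iUnion_of_finite fun b =>
    ((isCompact_univ.prod isCompact_Icc).image (hc.continuous_c b)).isClosed
  have hval : ∀ b w, ∀ s ∈ Icc (3 : ℝ) 4,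
      F₂ (c b w s) = (rib (R b) (h b) (φ b) w ((4 - s) / 2), 4 - s) := fun b w s hs =>
    hF₂ b (w, s) ⟨mem_univ _, hs⟩
  have hcover : ∀ x, 3 ≤ ht x → ht x ≤ 4 → ∃ b w, c b w (ht x) = x := fun x h3 _ =>
    hc.surj x (by linarith)
  have hagree : ∀ x, ht x = 3 → F₁ x = F₂ x := by
    intro x hx
    obtain ⟨b, w, hw⟩ := hcover x hx.ge (by linarith)
    rw [hx] at hw
    rw [← hw, hval b w 3 ⟨le_rfl, by norm_num⟩, hF₁q _ ⟨(hht3 b w).le, ?_⟩, hq]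
    · norm_num
    · rintro ⟨z, -, hz⟩
      exact absurd (hz ▸ hδ3 z) (not_lt.2 (hht3 b w).ge)
  let F : V → (ℂ × ℝ) × ℝ := {x | ht x ≤ 3}.piecewise F₁ F₂
  have hFF₁ : ∀ x, ht x ≤ 3 → F x = F₁ x := fun x hx => piecewise_eq_of_mem _ _ _ hx
  have hFF₂ : ∀ x, 3 ≤ ht x → F x = F₂ x := by
    intro x hx
    rcases eq_or_lt_of_le hx with h3 | h3
    · rw [hFF₁ x h3.ge, hagree x h3.symm]
    · exact piecewise_eq_of_notMem _ _ _ (not_le.2 h3)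
  have hpos : ∀ x, ht x ≤ 3 → 1 ≤ (F x).2 := fun x hx => by
    rw [hFF₁ x hx]
    exact hF₁ x (hunion hx)
  have hlate : ∀ x, 3 ≤ ht x → ht x ≤ 4 → ∃ b w, c b w (ht x) = x ∧
      F x = (rib (R b) (h b) (φ b) w ((4 - ht x) / 2), 4 - ht x) := by
    intro x h3 h4
    obtain ⟨b, w, hw⟩ := hcover x h3 h4
    refine ⟨b, w, hw, ?_⟩
    rw [hFF₂ x h3, ← hval b w _ ⟨h3, h4⟩, hw]
  refine ⟨F, ?_, ?_, ?_, fun b w => ?_⟩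
  · have hTm : {x | 3 ≤ ht x ∧ ht x ≤ 4} ⊆ T := fun x hx => by
      obtain ⟨b, w, hw⟩ := hcover x hx.1 hx.2
      exact mem_iUnion.2 ⟨b, (w, ht x), ⟨mem_univ _, hx⟩, hw⟩
    refine (((hF₁c.mono hunion).congr fun x hx => hFF₁ x hx).union_of_isClosed
      ((hF₂c.mono hTm).congr fun x hx => hFF₂ x hx.1) (isClosed_le hht continuous_const)
      ((isClosed_le continuous_const hht).inter (isClosed_le hht continuous_const))).mono ?_
    intro x hx
    rcases le_total (ht x) 3 with h3 | h3
    · exact Or.inl h3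
    · exact Or.inr ⟨h3, hx⟩
  · intro x hx y hy he
    have hlt : ∀ z, 3 < ht z → ht z < 4 → (F z).2 < 1 := by
      intro z h3 h4
      obtain ⟨b, w, -, hz⟩ := hlate z h3.le h4.le
      rw [hz]
      linarith
    rcases le_or_gt (ht x) 3 with h1 | h1 <;> rcases le_or_gt (ht y) 3 with h2 | h2
    · rw [hFF₁ x h1, hFF₁ y h2] at he
      exact hF₁i (hunion h1) (hunion h2) he
    · exact absurd (he ▸ hpos x h1) (not_le.2 (hlt y h2 hy))
    · exact absurd (he ▸ hpos y h2) (not_le.2 (hlt x h1 hx))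
    · obtain ⟨b, w, hx', hx2⟩ := hlate x h1.le (le_of_lt hx)
      obtain ⟨b', w', hy', hy2⟩ := hlate y h2.le (le_of_lt hy)
      rw [hx2, hy2, Prod.mk.injEq] at he
      have hxy : ht x = ht y := by linarith [he.2]
      have hμ : (4 - ht x) / 2 ∈ Ioc (0 : ℝ) 1 := by
        have : ht x < 4 := hx
        constructor <;> linarith
      rw [← hxy] at he
      obtain rfl := eq_of_abs_sub_le hsep
        (abs_rib_snd_sub_le (h := h b) (Ioc_subset_Icc_self hμ))
        (he.1 ▸ abs_rib_snd_sub_le (h := h b') (Ioc_subset_Icc_self hμ))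
      obtain ⟨rfl, -⟩ := rib_inj (hR b) hμ hμ he.1
      rw [← hx', ← hy', hxy]
  · intro x hx
    rcases le_or_gt (ht x) 3 with h1 | h1
    · exact lt_of_lt_of_le one_pos (hpos x h1)
    · obtain ⟨b, w, -, hz⟩ := hlate x h1.le hx.le
      rw [hz]
      exact sub_pos.2 hx
  · have h4 : ht (c b w 4) = 4 := hc.ht_c_of_pos b w (by norm_num)
    rw [hFF₂ _ (by linarith), hval b w 4 ⟨by norm_num, le_rfl⟩]
    simp [rib]

end

/-- A connected compact surface maps to the upper half-space, with interior embedded in the open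
half-space and with boundary circles lying over prescribed circles. -/
theorem HalfSurface.exists_model {E : Type} [TopologicalSpace E] [T2Space E] [CompactSpace E]
    [ConnectedSpace E] {bd : Set E} (h : HalfSurface E bd) {β : Type} [Finite β]
    {Ω : β → Circle → E} (hΩ : ∀ b, Continuous (Ω b)) (hΩb : ∀ b w, Ω b w ∈ bd)
    (hΩs : ∀ x ∈ bd, ∃ b w, Ω b w = x)
    (hΩi : ∀ b w b' w', Ω b w = Ω b' w' → b = b' ∧ w = w') {R : β → ℝ} (hR : ∀ b, 1 ≤ R b)
    {φ : β → Circle → Circle} (hφ : ∀ b, Continuous (φ b)) (hφ1 : ∀ b, φ b 1 = 1) :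
    ∃ G : E → (ℂ × ℝ) × ℝ, Continuous G ∧ InjOn G bdᶜ ∧ (∀ x ∉ bd, 0 < (G x).2) ∧
      ∀ b w, (G (Ω b w)).1.1 = R b * φ b w ∧ (G (Ω b w)).2 = 0 := by
  have hc := h.cuffed (fun b w => ⟨Ω b w, hΩb b w⟩) (fun b => (hΩ b).subtype_mk _)
    (fun x => by
      obtain ⟨b, w, hx⟩ := hΩs x.1 x.2
      exact ⟨b, w, Subtype.ext hx⟩)
    fun b w b' w' he => hΩi b w b' w' (congrArg Subtype.val he)
  have : Nonempty (Collar bd) := ⟨Collar.base bd (Classical.arbitrary E)⟩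
  obtain ⟨F, hFc, hFi, hF, hFb⟩ := hc.exists_model hR hφ hφ1
  obtain ⟨Θ, hΘ, hΘi, hΘb, hΘl⟩ := h.exists_collar_embedding
  have hle : ∀ x, (Θ x).1.2 ≤ 4 := fun x => by
    by_cases hx : x ∈ bd
    · rw [hΘb x hx]
    · exact (hΘl x hx).le
  refine ⟨F ∘ Θ, hFc.comp_continuous hΘ hle, fun x hx y hy he =>
    hΘi (hFi (hΘl x hx) (hΘl y hy) he), fun x hx => hF _ (hΘl x hx), fun b w => ?_⟩
  have he : Θ (Ω b w) = Collar.tail (hΩb b w) 4 := Subtype.ext <| by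
    rw [hΘb _ (hΩb b w)]
    show _ = (Ω b w, max (4 : ℝ) 0)
    norm_num
  have := hFb b w
  rwa [← he] at this

/-- A compact surface with circle boundary components maps to the upper half-space, with interior
embedded in the open half-space and with boundary circles wrapping round prescribed circles. -/
theorem HalfSurface.exists_map {E : Type} [TopologicalSpace E] [T2Space E] [CompactSpace E]
    [LocallyConnectedSpace E] {bd : Set E} (h : HalfSurface E bd) {β : Type} [Finite β]
    {Ω : β → Circle → E} (hΩ : ∀ b, Continuous (Ω b)) (hΩb : ∀ b w, Ω b w ∈ bd)
    (hΩs : ∀ x ∈ bd, ∃ b w, Ω b w = x)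
    (hΩi : ∀ b w b' w', Ω b w = Ω b' w' → b = b' ∧ w = w') {R : β → ℝ} (hR : ∀ b, 1 ≤ R b)
    {φ : β → Circle → Circle} (hφ : ∀ b, Continuous (φ b)) (hφ1 : ∀ b, φ b 1 = 1) :
    ∃ G : E → (ℂ × ℝ) × ℝ, Continuous G ∧ InjOn G bdᶜ ∧ (∀ x ∉ bd, 0 < (G x).2) ∧
      ∀ b w, G (Ω b w) = (((R b : ℂ) * ((φ b w : Circle) : ℂ), 0), 0) := by
  let C : ConnectedComponents E → Set E := fun k => ConnectedComponents.mk ⁻¹' {k}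
  have hC : ∀ k, IsClopen (C k) := fun k =>
    (isClopen_discrete {k}).preimage ConnectedComponents.continuous_coe
  have hmodel : ∀ k, ∃ G : C k → (ℂ × ℝ) × ℝ, Continuous G ∧
      InjOn G (Subtype.val ⁻¹' bd)ᶜ ∧ (∀ x : C k, x.1 ∉ bd → 0 < (G x).2) ∧
      ∀ b w (hw : Ω b w ∈ C k), (G ⟨Ω b w, hw⟩).1.1 = R b * φ b w ∧ (G ⟨Ω b w, hw⟩).2 = 0 := by
    intro k
    have : CompactSpace (C k) := isCompact_iff_compactSpace.1 (hC k).isClosed.isCompact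
    have : ConnectedSpace (C k) := by
      obtain ⟨x, rfl⟩ := ConnectedComponents.surjective_coe k
      refine isConnected_iff_connectedSpace.1 ?_
      show IsConnected (ConnectedComponents.mk ⁻¹' {ConnectedComponents.mk x})
      rw [connectedComponents_preimage_singleton]
      exact isConnected_connectedComponent
    have hm : ∀ b w w', Ω b w ∈ C k → Ω b w' ∈ C k := fun b w w' hw =>
      (isPreconnected_range (hΩ b)).subset_isClopen (hC k) ⟨_, mem_range_self w, hw⟩
        (mem_range_self w')
    obtain ⟨G, hG, hGi, hGp, hGb⟩ := (h.restrict (hC k)).exists_model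
      (β := {b // Ω b 1 ∈ C k}) (Ω := fun b w => ⟨Ω b.1 w, hm _ _ _ b.2⟩)
      (fun b => (hΩ b.1).subtype_mk _) (fun b w => hΩb b.1 w)
      (fun x hx => by
        obtain ⟨b, w, hw⟩ := hΩs x.1 hx
        exact ⟨⟨b, hm b w 1 (hw ▸ x.2)⟩, w, Subtype.ext hw⟩)
      (fun b w b' w' he => by
        obtain ⟨h1, h2⟩ := hΩi _ _ _ _ (congrArg Subtype.val he)
        exact ⟨Subtype.ext h1, h2⟩)
      (R := fun b => R b.1) (fun b => hR b.1) (φ := fun b => φ b.1) (fun b => hφ b.1)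
      fun b => hφ1 b.1
    exact ⟨G, hG, hGi, hGp, fun b w hw => hGb ⟨b, hm b w 1 hw⟩ w⟩
  choose G hG hGi hGp hGb using hmodel
  obtain ⟨n, -, hn⟩ := exists_spread (ConnectedComponents E)
  let T : ℝ → (ℂ × ℝ) × ℝ → (ℂ × ℝ) × ℝ := fun a p =>
    ((p.1.1, p.2 * (4 * a + Real.arctan p.1.2)), p.2)
  let Φ : E → (ℂ × ℝ) × ℝ := fun x => T (n x) (G x ⟨x, rfl⟩)
  have hT : ∀ a, Continuous (T a) := fun a => by
    have : Continuous fun p : (ℂ × ℝ) × ℝ => Real.arctan p.1.2 :=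
      Real.continuous_arctan.comp (by fun_prop)
    fun_prop
  have hΦC : ∀ k (x : C k), Φ x = T (n k) (G k x) := by
    rintro k ⟨x, rfl⟩
    rfl
  refine ⟨Φ, continuous_iff_continuousAt.2 fun x => ?_, ?_, fun x hx => hGp _ _ hx, fun b w => ?_⟩
  · have h1 : ContinuousOn Φ (C x) := by
      rw [continuousOn_iff_continuous_domRestrict]
      have : (C x).domRestrict Φ = fun y => T (n x) (G x y) := funext fun y => hΦC _ y
      rw [this]
      exact (hT _).comp (hG _)
    exact h1.continuousAt ((hC _).isOpen.mem_nhds rfl)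
  · intro x hx y hy he
    have ht : (G x ⟨x, rfl⟩).2 = (G y ⟨y, rfl⟩).2 :=
      congrArg (fun p => p.2) (he : T _ _ = T _ _)
    have hz : (G x ⟨x, rfl⟩).1.1 = (G y ⟨y, rfl⟩).1.1 :=
      congrArg (fun p => p.1.1) (he : T _ _ = T _ _)
    have hs : (G x ⟨x, rfl⟩).2 * (4 * n x + Real.arctan (G x ⟨x, rfl⟩).1.2)
        = (G y ⟨y, rfl⟩).2 * (4 * n y + Real.arctan (G y ⟨y, rfl⟩).1.2) :=
      congrArg (fun p => p.1.2) (he : T _ _ = T _ _)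
    rw [← ht] at hs
    have hs := mul_left_cancel₀ (hGp _ ⟨x, rfl⟩ hx).ne' hs
    have hxy : (x : ConnectedComponents E) = y := by
      by_contra hne
      have h1 := hn _ _ hne
      have h2 := Real.neg_pi_div_two_lt_arctan (G x ⟨x, rfl⟩).1.2
      have h3 := Real.arctan_lt_pi_div_two (G x ⟨x, rfl⟩).1.2
      have h4 := Real.neg_pi_div_two_lt_arctan (G y ⟨y, rfl⟩).1.2
      have h5 := Real.arctan_lt_pi_div_two (G y ⟨y, rfl⟩).1.2
      have h6 := Real.pi_le_four
      rcases le_abs.1 h1 with h1 | h1 <;> linarith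
    have hGG : ∀ k (hk : (y : ConnectedComponents E) = k),
        G y ⟨y, rfl⟩ = G k ⟨y, hk⟩ := by
      rintro _ rfl
      rfl
    have hnn : n x = n y := congrArg n hxy
    have ha : (G x ⟨x, rfl⟩).1.2 = (G y ⟨y, rfl⟩).1.2 :=
      Real.arctan_injective (by linarith)
    have hG' : G x ⟨x, rfl⟩ = G y ⟨y, rfl⟩ := Prod.ext (Prod.ext hz ha) ht
    rw [hGG _ hxy.symm] at hG'
    exact congrArg Subtype.val (hGi _ hx hy hG')
  · obtain ⟨h1, h2⟩ := hGb _ b w rfl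
    show T _ _ = _
    simp only [T, h1, h2, zero_mul]

/-- The union of a finite family of circles and a surface glued to them embeds in four-space. -/
theorem exists_adjunction_embedding {E : Type} [TopologicalSpace E] [T2Space E]
    [CompactSpace E] [ChartedSpace (EuclideanHalfSpace 2) E] {L : Type} [TopologicalSpace L]
    {M : ℕ} (Λ : L ≃ₜ Fin M × Circle) {φ : ((𝓡∂ 2).boundary E) → L} (hφ : Continuous φ)
    (hcov : ∀ x : ((𝓡∂ 2).boundary E),
      ∃ h : Set.MapsTo φ (connectedComponent x) (connectedComponent (φ x)),
        IsCoveringMap h.restrict ∧ Function.Surjective h.restrict) :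
    ∃ f : Quot (fun a b : L ⊕ E =>
        ∃ (x : E) (hx : x ∈ (𝓡∂ 2).boundary E),
          a = Sum.inr x ∧ b = Sum.inl (φ ⟨x, hx⟩)) → (ℂ × ℝ) × ℝ,
      Continuous f ∧ Function.Injective f := by
  obtain ⟨β, _, Ω, m, φ', hΩ, hφ', hφ1, hΩs, hΩi, hΛ⟩ := exists_boundary_param Λ hφ hcov
  have : LocallyConnectedSpace E := ChartedSpace.locallyConnectedSpace (EuclideanHalfSpace 2) E
  obtain ⟨G, hG, hGi, hGp, hGb⟩ := (HalfSurface.of_chartedSpace (E := E)).exists_map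
    (Ω := fun b w => (Ω b w : E)) (fun b => continuous_subtype_val.comp (hΩ b))
    (fun b w => (Ω b w).2)
    (fun x hx => by
      obtain ⟨b, w, hw⟩ := hΩs ⟨x, hx⟩
      exact ⟨b, w, congrArg Subtype.val hw⟩)
    (fun b w b' w' he => hΩi b w b' w' (Subtype.ext he))
    (R := fun b => ((m b : ℕ) : ℝ) + 1) (fun b => by simp) hφ' hφ1
  let g : L → (ℂ × ℝ) × ℝ := fun l =>
    (((((((Λ l).1 : ℕ) : ℝ) + 1 : ℝ) : ℂ) * ((Λ l).2 : Circle), 0), 0)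
  have hg : Continuous g := by
    have h1 : Continuous fun l => (((Λ l).2 : Circle) : ℂ) :=
      continuous_induced_dom.comp (continuous_snd.comp Λ.continuous)
    have h2 : Continuous fun l => (((((Λ l).1 : ℕ) : ℝ) + 1 : ℝ) : ℂ) :=
      (continuous_of_discreteTopology (f := fun i : Fin M => ((((i : ℕ) : ℝ) + 1 : ℝ) : ℂ))).comp
        (continuous_fst.comp Λ.continuous)
    exact ((h2.mul h1).prodMk continuous_const).prodMk continuous_const
  have hgi : Function.Injective g := by
    intro l l' he
    have h1 : (((((Λ l).1 : ℕ) : ℝ) + 1 : ℝ) : ℂ) * ((Λ l).2 : Circle)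
        = (((((Λ l').1 : ℕ) : ℝ) + 1 : ℝ) : ℂ) * ((Λ l').2 : Circle) :=
      congrArg (fun p => p.1.1) he
    have h2 := congrArg norm h1
    rw [norm_mul, norm_mul, Circle.norm_coe, Circle.norm_coe, Complex.norm_real, Complex.norm_real,
      Real.norm_of_nonneg (by positivity), Real.norm_of_nonneg (by positivity)] at h2
    have h3 : (Λ l).1 = (Λ l').1 := by
      rw [mul_one, mul_one, add_left_inj, Nat.cast_inj] at h2
      exact Fin.ext h2
    rw [h3] at h1
    have h0 : (((((Λ l').1 : ℕ) : ℝ) + 1 : ℝ) : ℂ) ≠ 0 :=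
      Complex.ofReal_ne_zero.2 (by positivity)
    have h4 := mul_left_cancel₀ h0 h1
    exact Λ.injective (Prod.ext h3 (Circle.ext h4))
  have hgG : ∀ x (hx : x ∈ (𝓡∂ 2).boundary E), G x = g (φ ⟨x, hx⟩) := by
    intro x hx
    obtain ⟨b, w, hw⟩ := hΩs ⟨x, hx⟩
    have h1 : x = Ω b w := (congrArg Subtype.val hw).symm
    rw [← hw, h1, hGb]
    simp only [g, hΛ]
  refine ⟨Quot.lift (Sum.elim g G) ?_, continuous_quot_lift _ (hg.sumElim hG), ?_⟩
  · rintro _ _ ⟨x, hx, rfl, rfl⟩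
    exact hgG x hx
  · have key : ∀ q : Quot (fun a b : L ⊕ E => ∃ (x : E) (hx : x ∈ (𝓡∂ 2).boundary E),
        a = Sum.inr x ∧ b = Sum.inl (φ ⟨x, hx⟩)),
        (∃ l, q = Quot.mk _ (Sum.inl l)) ∨
          ∃ x, x ∉ (𝓡∂ 2).boundary E ∧ q = Quot.mk _ (Sum.inr x) := by
      rintro ⟨l | x⟩
      · exact Or.inl ⟨l, rfl⟩
      · by_cases hx : x ∈ (𝓡∂ 2).boundary E
        · exact Or.inl ⟨φ ⟨x, hx⟩, Quot.sound ⟨x, hx, rfl, rfl⟩⟩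
        · exact Or.inr ⟨x, hx, rfl⟩
    intro q q' he
    obtain ⟨l, rfl⟩ | ⟨x, hx, rfl⟩ := key q <;> obtain ⟨l', rfl⟩ | ⟨x', hx', rfl⟩ := key q'
    · rw [hgi (he : g l = g l')]
    · have h1 := hGp x' hx'
      have h2 : g l = G x' := he
      rw [← h2] at h1
      exact absurd h1 (lt_irrefl _)
    · have h1 := hGp x hx
      have h2 : G x = g l' := he
      rw [h2] at h1
      exact absurd h1 (lt_irrefl _)
    · rw [hGi hx hx' he]

theorem continuous_toEuclidean :
    Continuous fun p : (ℂ × ℝ) × ℝ => !₂[p.1.1.re, p.1.1.im, p.1.2, p.2] := by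
  fun_prop

theorem injective_toEuclidean :
    Function.Injective fun p : (ℂ × ℝ) × ℝ => !₂[p.1.1.re, p.1.1.im, p.1.2, p.2] := by
  intro p q h
  have h' : ∀ i, !₂[p.1.1.re, p.1.1.im, p.1.2, p.2] i = !₂[q.1.1.re, q.1.1.im, q.1.2, q.2] i :=
    fun i => congrArg (fun v : EuclideanSpace ℝ (Fin 4) => v i) h
  exact Prod.ext (Prod.ext (Complex.ext (h' 0) (h' 1)) (h' 2)) (h' 3)

end MultibranchedSurface

/-- Proposition 2.1 of the paper. Let `E` be a compact topological 2-manifold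
with boundary (a compact Hausdorff second-countable space charted on the Euclidean half-plane)
each of whose connected components has nonempty boundary, let `L` be a space homeomorphic to a
finite disjoint union of circles, and let `φ : ∂E → L` be a continuous map restricting on each
connected component of `∂E` to a covering map onto a connected component of `L`. Then the
adjunction space `X = L ∪_φ E`, the quotient of `L ⊔ E` identifying each boundary point
`x ∈ ∂E` with `φ(x) ∈ L`, embeds topologically into `ℝ⁴`. -/
theorem multibranched_surface_embeds_in_R4
    (E : Type) [TopologicalSpace E] [T2Space E] [SecondCountableTopology E] [CompactSpace E]
    [ChartedSpace (EuclideanHalfSpace 2) E]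
    (L : Type) [TopologicalSpace L]
    (hL : ∃ m : ℕ, Nonempty (L ≃ₜ Fin m × Circle))
    (φ : ((𝓡∂ 2).boundary E) → L)
    (hφ : Continuous φ)
    (hbd : ∀ x : E, ∃ y ∈ (𝓡∂ 2).boundary E, y ∈ connectedComponent x)
    (hcov : ∀ x : ((𝓡∂ 2).boundary E),
      ∃ h : Set.MapsTo φ (connectedComponent x) (connectedComponent (φ x)),
        IsCoveringMap h.restrict ∧ Function.Surjective h.restrict) :
    ∃ f : Quot (fun a b : L ⊕ E =>
        ∃ (x : E) (hx : x ∈ (𝓡∂ 2).boundary E),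
          a = Sum.inr x ∧ b = Sum.inl (φ ⟨x, hx⟩)) →
      EuclideanSpace ℝ (Fin 4), Topology.IsEmbedding f := by
  obtain ⟨M, ⟨Λ⟩⟩ := hL
  obtain ⟨f, hf, hfi⟩ := MultibranchedSurface.exists_adjunction_embedding Λ hφ hcov
  have : CompactSpace L := Λ.symm.compactSpace
  exact ⟨_, ((MultibranchedSurface.continuous_toEuclidean.comp hf).isClosedEmbedding
    (MultibranchedSurface.injective_toEuclidean.comp hfi)).isEmbedding⟩
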